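/- Let Ω ⊂ ℂⁿ, n ≥ 2, be a bounded pseudoconvex domain with C^∞ boundary, and let p ∈ ∂Ω be a strongly pseudoconvex boundary point. Let F : Ω → Ω be a holomorphic map with F(z) = z + o(‖z−p‖) as z → p within Ω. Suppose r : Ω → Ω is a holomorphic retraction (r ∘ r = r) which is the limit, uniformly on compact subsets of Ω, of a subsequence of the iterates {F^m}, that r is nonconstant and r is not the identity map of Ω, and that p lies in the closure of M := r(Ω). Then F(w) = w for every w ∈ M. -/

import Mathlib

open Complex Topology Filter Metric Set Function

noncomputable section

/-- `ℂⁿ` as a normed space. -/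
abbrev En (n : ℕ) : Type := EuclideanSpace ℂ (Fin n)

/-- A domain: a nonempty open connected set. -/
def IsDomain' {n : ℕ} (Ω : Set (En n)) : Prop :=
  IsOpen Ω ∧ IsConnected Ω

/-- The Levi form of `ρ` at `q` in direction `ξ`:
`(1/4)(H_q(ξ,ξ) + H_q(iξ,iξ))` with `H_q` the second real Fréchet derivative. -/
def LeviForm {n : ℕ} (ρ : En n → ℝ) (q ξ : En n) : ℝ :=
  (1 / 4) * (iteratedFDeriv ℝ 2 ρ q ![ξ, ξ] + iteratedFDeriv ℝ 2 ρ q ![I • ξ, I • ξ])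

/-- `ξ` lies in the complex tangent space of `{ρ = 0}` at `q`. -/
def InCplxTangent {n : ℕ} (ρ : En n → ℝ) (q ξ : En n) : Prop :=
  fderiv ℝ ρ q ξ = 0 ∧ fderiv ℝ ρ q (I • ξ) = 0

/-- `ρ` is a `C^m` defining function for `Ω`. -/
def IsDefiningFunction {n : ℕ} (Ω : Set (En n)) (m : ℕ∞) (ρ : En n → ℝ) : Prop :=
  ContDiff ℝ m ρ ∧ Ω = {z | ρ z < 0} ∧ frontier Ω = {z | ρ z = 0} ∧
    ∀ q ∈ frontier Ω, fderiv ℝ ρ q ≠ 0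

/-- `q` is a strongly pseudoconvex point with respect to `ρ`. -/
def StronglyPcxAt {n : ℕ} (ρ : En n → ℝ) (q : En n) : Prop :=
  ∀ ξ : En n, ξ ≠ 0 → InCplxTangent ρ q ξ → 0 < LeviForm ρ q ξ

/-- `Ω` is pseudoconvex with `C^∞` boundary, witnessed by the defining function `ρ`. -/
def IsPcxCinfBoundary {n : ℕ} (Ω : Set (En n)) (ρ : En n → ℝ) : Prop :=
  IsDefiningFunction Ω ⊤ ρ ∧
    ∀ q ∈ frontier Ω, ∀ ξ : En n, InCplxTangent ρ q ξ → 0 ≤ LeviForm ρ q ξ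

/-- `F z = z + o(‖z - p‖^k)` as `z → p` within `Ω`. -/
def LittleOh {n : ℕ} (Ω : Set (En n)) (F : En n → En n) (p : En n) (k : ℕ) : Prop :=
  Tendsto (fun z => ‖F z - z‖ / ‖z - p‖ ^ k) (𝓝[Ω] p) (𝓝 0)

/-- `F` is an automorphism of `Ω`: a holomorphic bijection with holomorphic inverse. -/
def IsAutomorphismOf {n : ℕ} (F : En n → En n) (Ω : Set (En n)) : Prop :=
  DifferentiableOn ℂ F Ω ∧ MapsTo F Ω Ω ∧
    ∃ G : En n → En n, DifferentiableOn ℂ G Ω ∧ MapsTo G Ω Ω ∧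
      (∀ z ∈ Ω, G (F z) = z) ∧ (∀ z ∈ Ω, F (G z) = z)


section Harnack

variable {V W : Type*} [NormedAddCommGroup V] [NormedSpace ℂ V]
  [NormedAddCommGroup W] [NormedSpace ℂ W]

/-- Borel–Carathéodory estimate for maps with values in the right half-plane. -/
theorem norm_sub_le_of_re_nonneg {f : V → ℂ} {c z : V} {R : ℝ}
    (hd : DifferentiableOn ℂ f (ball c R)) (hre : ∀ x ∈ ball c R, 0 ≤ (f x).re)
    (hz : z ∈ ball c R) :
    ‖f z - f c‖ ≤ 2 * (f c).re * ‖z - c‖ / (R - ‖z - c‖) := by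
  have hR : 0 < R := nonempty_ball.1 ⟨z, hz⟩
  have hzR : ‖z - c‖ < R := by simpa [dist_eq_norm] using hz
  have hc : c ∈ ball c R := mem_ball_self hR
  have key : ∀ ε : ℝ, 0 < ε →
      ‖f z - f c‖ ≤ 2 * ((f c).re + ε) * ‖z - c‖ / (R - ‖z - c‖) := by
    intro ε hε
    set b : ℝ := (f c).re + ε with hb
    have hbpos : 0 < b := by have := hre c hc; positivity
    set g : V → ℂ := fun x => (f x - f c) / (f x - f c + 2 * b) with hg
    have hden : ∀ x ∈ ball c R, ‖f x - f c‖ ≤ ‖f x - f c + 2 * b‖ ∧ f x - f c + 2 * b ≠ 0 := by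
      intro x hx
      have h1 := hre x hx
      constructor
      · rw [← sq_le_sq₀ (norm_nonneg _) (norm_nonneg _), Complex.sq_norm, Complex.sq_norm,
          normSq_apply, normSq_apply]
        simp
        nlinarith
      · intro h
        have := congrArg Complex.re h
        simp at this
        linarith
    have hgd : DifferentiableOn ℂ g (ball c R) := by
      simp only [hg, div_eq_mul_inv]
      exact (hd.sub_const _).mul
        (((hd.sub_const _).add_const _).inv fun x hx => (hden x hx).2)
    have hgc : g c = 0 := by simp [hg]
    have hgm : MapsTo g (ball c R) (closedBall (g c) 1) := by
      intro x hx
      rw [hgc, mem_closedBall_zero_iff, hg, norm_div]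
      exact div_le_one_of_le₀ (hden x hx).1 (norm_nonneg _)
    have h1 := dist_le_div_mul_dist_of_mapsTo_ball hgd hgm hz
    rw [hgc, dist_zero_right, dist_eq_norm, hg] at h1
    simp only [norm_div] at h1
    set u := f z - f c
    have hpos : 0 < ‖u + 2 * b‖ := norm_pos_iff.2 (hden z hz).2
    have h2 : ‖u + 2 * b‖ ≤ ‖u‖ + 2 * b := by
      refine (norm_add_le _ _).trans ?_
      simp [abs_of_pos hbpos]
    rw [div_le_iff₀ hpos] at h1
    rw [le_div_iff₀ (by linarith)]
    have h3 : ‖u‖ ≤ 1 / R * ‖z - c‖ * (‖u‖ + 2 * b) :=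
      h1.trans (by gcongr)
    have h4 : ‖u‖ * R ≤ ‖z - c‖ * (‖u‖ + 2 * b) := by
      calc ‖u‖ * R ≤ (1 / R * ‖z - c‖ * (‖u‖ + 2 * b)) * R := by gcongr
        _ = ‖z - c‖ * (‖u‖ + 2 * b) := by field_simp
    nlinarith
  have hcont : Tendsto (fun ε : ℝ => 2 * ((f c).re + ε) * ‖z - c‖ / (R - ‖z - c‖)) (𝓝[>] 0)
      (𝓝 (2 * ((f c).re + 0) * ‖z - c‖ / (R - ‖z - c‖))) := by
    apply Tendsto.mono_left _ nhdsWithin_le_nhds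
    apply Continuous.tendsto
    fun_prop
  rw [add_zero] at hcont
  exact ge_of_tendsto hcont (eventually_mem_nhdsWithin.mono fun ε hε => key ε hε)

theorem re_le_of_re_nonneg {f : V → ℂ} {c z : V} {R : ℝ}
    (hd : DifferentiableOn ℂ f (ball c R)) (hre : ∀ x ∈ ball c R, 0 ≤ (f x).re)
    (hz : z ∈ ball c R) :
    (f z).re ≤ (f c).re * (R + ‖z - c‖) / (R - ‖z - c‖) := by
  have hzR : ‖z - c‖ < R := by simpa [dist_eq_norm] using hz
  have h1 := norm_sub_le_of_re_nonneg hd hre hz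
  have h2 : (f z).re - (f c).re ≤ ‖f z - f c‖ := by
    simpa using Complex.re_le_norm (f z - f c)
  have h3 : (f c).re * (R + ‖z - c‖) / (R - ‖z - c‖) =
      (f c).re + 2 * (f c).re * ‖z - c‖ / (R - ‖z - c‖) := by
    have : R - ‖z - c‖ ≠ 0 := by linarith
    field_simp
    ring
  linarith

/-- The lower Harnack inequality in a disc. -/
theorem le_re_of_re_nonneg {f : ℂ → ℂ} {ζ : ℂ}
    (hd : DifferentiableOn ℂ f (ball 0 1)) (hre : ∀ x ∈ ball (0 : ℂ) 1, 0 ≤ (f x).re)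
    (hζ : ‖ζ‖ < 1) :
    (f 0).re * ((1 - ‖ζ‖) / (1 + ‖ζ‖)) ≤ (f ζ).re := by
  set b := (f 0).re with hb
  have hb0 : 0 ≤ b := hre 0 (by simp)
  -- interchange the two points by the involution `x ↦ (ζ - x) / (1 - conj ζ * x)`
  set m : ℂ → ℂ := fun x => (ζ - x) / (1 - (starRingEnd ℂ) ζ * x) with hm
  have hden : ∀ x ∈ ball (0 : ℂ) 1, 1 - (starRingEnd ℂ) ζ * x ≠ 0 := by
    intro x hx h
    have hx' : ‖x‖ < 1 := by simpa using hx
    have : ‖(starRingEnd ℂ) ζ * x‖ = 1 := by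
      rw [← sub_eq_zero.1 h]; simp
    rw [norm_mul, RCLike.norm_conj] at this
    nlinarith [norm_nonneg x, norm_nonneg ζ]
  have hmaps : MapsTo m (ball 0 1) (ball 0 1) := by
    intro x hx
    have hx' : ‖x‖ < 1 := by simpa using hx
    rw [mem_ball_zero_iff, hm]
    simp only
    rw [norm_div, div_lt_one (norm_pos_iff.2 (hden x hx)),
      ← sq_lt_sq₀ (norm_nonneg _) (norm_nonneg _), Complex.sq_norm, Complex.sq_norm,
      normSq_apply, normSq_apply]
    have h1 : x.re * x.re + x.im * x.im < 1 := by
      rw [← normSq_apply, ← Complex.sq_norm]; nlinarith [norm_nonneg x]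
    have h2 : ζ.re * ζ.re + ζ.im * ζ.im < 1 := by
      rw [← normSq_apply, ← Complex.sq_norm]; nlinarith [norm_nonneg ζ]
    simp
    nlinarith [mul_pos (sub_pos.2 h1) (sub_pos.2 h2)]
  have hmd : DifferentiableOn ℂ m (ball 0 1) :=
    ((differentiable_const _).sub differentiable_id).differentiableOn.div
      (by fun_prop) hden
  have h1 := re_le_of_re_nonneg (f := f ∘ m) (c := 0) (z := ζ) (R := 1) (hd.comp hmd hmaps)
    (fun x hx => hre _ (hmaps hx)) (by simpa using hζ)
  have h2 : m ζ = 0 := by simp [hm]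
  have h3 : m 0 = ζ := by simp [hm]
  simp only [comp_apply, h2, h3, sub_zero] at h1
  rw [le_div_iff₀ (by linarith)] at h1
  rw [← mul_div_assoc, div_le_iff₀ (by positivity)]
  exact h1

theorem norm_fderiv_le_of_bound {f : V → W} {x : V} {R C : ℝ} (hR : 0 < R)
    (hd : DifferentiableOn ℂ f (ball x R)) (hC : ∀ z ∈ ball x R, ‖f z‖ ≤ C) :
    ‖fderiv ℂ f x‖ ≤ 2 * C / R := by
  refine norm_fderiv_le_div_of_mapsTo_ball hd (fun z hz => ?_) hR
  rw [mem_closedBall, dist_eq_norm]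
  have := hC z hz
  have := hC x (mem_ball_self hR)
  exact (norm_sub_le _ _).trans (by linarith)

theorem norm_fderiv_le_of_bound_half {f : V → W} {x₀ x : V} {R C : ℝ} (hR : 0 < R)
    (hd : DifferentiableOn ℂ f (ball x₀ R)) (hC : ∀ z ∈ ball x₀ R, ‖f z‖ ≤ C)
    (hx : x ∈ ball x₀ (R / 2)) :
    ‖fderiv ℂ f x‖ ≤ 4 * C / R := by
  have hsub : ball x (R / 2) ⊆ ball x₀ R := ball_subset_ball' (by
    rw [mem_ball] at hx; linarith)
  have := norm_fderiv_le_of_bound (by linarith) (hd.mono hsub) fun z hz => hC z (hsub hz)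
  refine this.trans (le_of_eq ?_)
  field_simp
  ring

theorem norm_sub_le_of_bound {f : V → W} {x₀ x y : V} {R C : ℝ} (hR : 0 < R)
    (hd : DifferentiableOn ℂ f (ball x₀ R)) (hC : ∀ z ∈ ball x₀ R, ‖f z‖ ≤ C)
    (hx : x ∈ ball x₀ (R / 2)) (hy : y ∈ ball x₀ (R / 2)) :
    ‖f y - f x‖ ≤ 4 * C / R * ‖y - x‖ := by
  refine (convex_ball x₀ (R / 2)).norm_image_sub_le_of_norm_fderiv_le (𝕜 := ℂ) (fun z hz => ?_)
    (fun z hz => norm_fderiv_le_of_bound_half hR hd hC hz) hx hy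
  exact (hd.differentiableAt (isOpen_ball.mem_nhds (ball_subset_ball (by linarith) hz)))

theorem norm_fderiv_sub_le_of_bound {f : V → W} {x₀ x y : V} {R C : ℝ} (hR : 0 < R)
    (hd : DifferentiableOn ℂ f (ball x₀ R)) (hC : ∀ z ∈ ball x₀ R, ‖f z‖ ≤ C)
    (hx : x ∈ ball x₀ (R / 4)) (hy : y ∈ ball x₀ (R / 4)) :
    ‖fderiv ℂ f y - fderiv ℂ f x‖ ≤ 32 * C / R ^ 2 * ‖y - x‖ := by
  have hb : ∀ w ∈ ball x₀ (R / 4), ∀ z ∈ ball (0 : V) (R / 4), w + z ∈ ball x₀ (R / 2) := by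
    intro w hw z hz
    rw [mem_ball, dist_eq_norm] at *
    calc ‖w + z - x₀‖ = ‖(w - x₀) + (z - 0)‖ := by congr 1; abel
      _ ≤ _ := norm_add_le _ _
      _ < R / 2 := by linarith
  have hb' : ball x₀ (R / 2) ⊆ ball x₀ R := ball_subset_ball (by linarith)
  have hda : ∀ w ∈ ball x₀ (R / 4), ∀ z ∈ ball (0 : V) (R / 4),
      DifferentiableAt ℂ f (w + z) := fun w hw z hz =>
    hd.differentiableAt (isOpen_ball.mem_nhds (hb' (hb w hw z hz)))
  have hda0 : ∀ w ∈ ball x₀ (R / 4), DifferentiableAt ℂ f w := fun w hw => by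
    simpa using hda w hw 0 (mem_ball_self (by linarith))
  have h1 := norm_fderiv_le_of_bound (f := fun z => f (y + z) - f (x + z)) (x := 0) (R := R / 4)
    (C := 4 * C / R * ‖y - x‖) (by linarith)
    (fun z hz => (((hda y hy z hz).comp z (by fun_prop)).sub
      ((hda x hx z hz).comp z (by fun_prop))).differentiableWithinAt)
    (fun z hz => by
      simpa using norm_sub_le_of_bound hR hd hC (hb x hx z hz) (hb y hy z hz))
  have h2 : fderiv ℂ (fun z => f (y + z) - f (x + z)) 0 = fderiv ℂ f y - fderiv ℂ f x := by
    have e1 := (hda y hy 0 (mem_ball_self (by linarith))).hasFDerivAt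
    have e2 := (hda x hx 0 (mem_ball_self (by linarith))).hasFDerivAt
    have e3 := (e1.comp 0 ((hasFDerivAt_id (𝕜 := ℂ) (0 : V)).const_add y)).sub
      (e2.comp 0 ((hasFDerivAt_id (𝕜 := ℂ) (0 : V)).const_add x))
    have e4 : HasFDerivAt (fun z => f (y + z) - f (x + z)) (fderiv ℂ f y - fderiv ℂ f x) 0 := by
      simp only [add_zero, ContinuousLinearMap.comp_id] at e3
      exact e3
    exact e4.fderiv
  rw [h2] at h1
  refine h1.trans (le_of_eq ?_)
  field_simp
  ring

/-- First-order Taylor estimate with a uniform error on a ball. -/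
theorem norm_sub_sub_fderiv_le_of_bound {f : V → W} {x₀ q x y : V} {R C δ : ℝ} (hR : 0 < R)
    (hd : DifferentiableOn ℂ f (ball x₀ R)) (hC : ∀ z ∈ ball x₀ R, ‖f z‖ ≤ C)
    (hq : q ∈ ball x₀ (R / 8)) (hx : x ∈ ball q δ) (hy : y ∈ ball q δ) (hδ : δ ≤ R / 8) :
    ‖f y - f x - fderiv ℂ f q (y - x)‖ ≤ 32 * C / R ^ 2 * δ * ‖y - x‖ := by
  have hC0 : 0 ≤ C := (norm_nonneg _).trans (hC x₀ (mem_ball_self hR))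
  have hsub : ball q δ ⊆ ball x₀ (R / 4) := ball_subset_ball' (by rw [mem_ball] at hq; linarith)
  refine (convex_ball q δ).norm_image_sub_le_of_norm_hasFDerivWithin_le' (𝕜 := ℂ)
    (f' := fderiv ℂ f) (fun z hz => ?_) (fun z hz => ?_) hx hy
  · exact (hd.differentiableAt (isOpen_ball.mem_nhds
      (ball_subset_ball (by linarith) (hsub hz)))).hasFDerivAt.hasFDerivWithinAt
  · refine (norm_fderiv_sub_le_of_bound hR hd hC (ball_subset_ball (by linarith) hq)
      (hsub hz)).trans ?_
    rw [mem_ball, dist_eq_norm] at hz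
    gcongr

end Harnack

section HalfPlane

/-- A Möbius map of the unit disc onto the right half-plane through two prescribed points. -/
theorem exists_mobius_halfPlane {w₀ w₁ : ℂ} (h₀ : 0 < w₀.re) (h₁ : 0 < w₁.re) :
    ∃ (m : ℂ → ℂ) (ζ : ℂ), DifferentiableOn ℂ m (ball 0 1) ∧
      (∀ x ∈ ball (0 : ℂ) 1, 0 < (m x).re) ∧ m 0 = w₀ ∧ m ζ = w₁ ∧ ‖ζ‖ < 1 ∧
      ‖ζ‖ = ‖w₁ - w₀‖ / ‖w₁ + (starRingEnd ℂ) w₀‖ ∧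
      1 - ‖ζ‖ ^ 2 = 4 * w₀.re * w₁.re / ‖w₁ + (starRingEnd ℂ) w₀‖ ^ 2 := by
  have hne : w₁ + (starRingEnd ℂ) w₀ ≠ 0 := by
    intro h
    have := congrArg Complex.re h
    simp at this
    linarith
  have hpos : 0 < ‖w₁ + (starRingEnd ℂ) w₀‖ := norm_pos_iff.2 hne
  set ζ := (w₁ - w₀) / (w₁ + (starRingEnd ℂ) w₀) with hζ
  have hn : ‖ζ‖ = ‖w₁ - w₀‖ / ‖w₁ + (starRingEnd ℂ) w₀‖ := by rw [hζ, norm_div]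
  have hsq : 1 - ‖ζ‖ ^ 2 = 4 * w₀.re * w₁.re / ‖w₁ + (starRingEnd ℂ) w₀‖ ^ 2 := by
    rw [hn, div_pow, eq_div_iff (by positivity), sub_mul, div_mul_cancel₀ _ (by positivity),
      Complex.sq_norm, Complex.sq_norm, normSq_apply, normSq_apply]
    simp
    ring
  have hlt : ‖ζ‖ < 1 := by
    have : 0 < 1 - ‖ζ‖ ^ 2 := by rw [hsq]; positivity
    nlinarith [norm_nonneg ζ]
  have hx1 : ∀ x ∈ ball (0 : ℂ) 1, 1 - x ≠ 0 := by
    intro x hx h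
    rw [mem_ball_zero_iff, ← sub_eq_zero.1 h] at hx
    simp at hx
  refine ⟨fun x => (w₀ + (starRingEnd ℂ) w₀ * x) / (1 - x), ζ, ?_, ?_, by simp, ?_, hlt, hn, hsq⟩
  · exact DifferentiableOn.div (by fun_prop) (by fun_prop) hx1
  · intro x hx
    have h2 : normSq (1 - x) > 0 := normSq_pos.2 (hx1 x hx)
    have h3 : x.re * x.re + x.im * x.im < 1 := by
      have hx' : ‖x‖ < 1 := by simpa using hx
      rw [← normSq_apply, ← Complex.sq_norm]; nlinarith [norm_nonneg x]
    rw [Complex.div_re, ← add_div]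
    refine div_pos ?_ h2
    simp
    nlinarith
  · have h1 := hx1 ζ (by simpa using hlt)
    simp only
    rw [div_eq_iff h1, hζ]
    field_simp
    ring

variable {f : ℂ → ℂ}

theorem halfPlane_harnack (hd : DifferentiableOn ℂ f {w | 0 < w.re})
    (hre : ∀ w : ℂ, 0 < w.re → 0 ≤ (f w).re) {w₀ w₁ : ℂ} (h₀ : 0 < w₀.re) (h₁ : 0 < w₁.re) :
    (f w₀).re * (w₀.re * w₁.re / ‖w₁ + (starRingEnd ℂ) w₀‖ ^ 2) ≤ (f w₁).re := by
  obtain ⟨m, ζ, hm, hmaps, hm0, hm1, hζ, -, hsq⟩ := exists_mobius_halfPlane h₀ h₁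
  have h := le_re_of_re_nonneg (f := f ∘ m) (hd.comp hm hmaps) (fun x hx => hre _ (hmaps x hx)) hζ
  simp only [comp_apply, hm0, hm1] at h
  refine le_trans (mul_le_mul_of_nonneg_left ?_ (hre _ h₀)) h
  have h2 : w₀.re * w₁.re / ‖w₁ + (starRingEnd ℂ) w₀‖ ^ 2 = (1 - ‖ζ‖ ^ 2) / 4 := by
    rw [hsq]; ring
  have := norm_nonneg ζ
  rw [h2, div_le_div_iff₀ (by norm_num) (by positivity)]
  nlinarith [mul_nonneg (mul_nonneg (sub_nonneg.2 hζ.le) (sub_nonneg.2 hζ.le))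
    (by linarith : (0 : ℝ) ≤ 3 + ‖ζ‖)]

theorem halfPlane_re_div_antitone (hd : DifferentiableOn ℂ f {w | 0 < w.re})
    (hre : ∀ w : ℂ, 0 < w.re → 0 ≤ (f w).re) {y y' : ℝ} (h₀ : 0 < y) (h₁ : y ≤ y') :
    (f y').re / y' ≤ (f y).re / y := by
  obtain ⟨m, ζ, hm, hmaps, hm0, hm1, hζ, hn, -⟩ :=
    exists_mobius_halfPlane (w₀ := y) (w₁ := y') (by simpa) (by simp; linarith)
  have h := re_le_of_re_nonneg (f := f ∘ m) (c := 0) (z := ζ) (R := 1) (hd.comp hm hmaps)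
    (fun x hx => hre _ (hmaps x hx)) (by simpa using hζ)
  simp only [comp_apply, hm0, hm1, sub_zero] at h
  have hn' : ‖ζ‖ = (y' - y) / (y' + y) := by
    rw [hn]
    simp only [conj_ofReal, ← ofReal_add, ← ofReal_sub, norm_real, Real.norm_eq_abs]
    rw [abs_of_nonneg (by linarith), abs_of_pos (by linarith)]
  rw [hn'] at h
  have hy' : 0 < y' := by linarith
  have h2 : (f y).re * (1 + (y' - y) / (y' + y)) / (1 - (y' - y) / (y' + y)) =
      (f y).re / y * y' := by
    have : y' + y ≠ 0 := by positivity
    have h3 : 1 + (y' - y) / (y' + y) = 2 * y' / (y' + y) := by field_simp; ring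
    have h4 : 1 - (y' - y) / (y' + y) = 2 * y / (y' + y) := by field_simp; ring
    rw [h3, h4]
    field_simp
  rw [h2] at h
  rwa [div_le_iff₀ hy']

theorem halfPlane_tendsto_re_div (hd : DifferentiableOn ℂ f {w | 0 < w.re})
    (hre : ∀ w : ℂ, 0 < w.re → 0 ≤ (f w).re) :
    ∃ L : ℝ, Tendsto (fun y : ℝ => (f y).re / y) atTop (𝓝 L) := by
  have hanti : Antitone fun y : ℝ => (f (max y 1 : ℝ)).re / (max y 1) := fun y y' h =>
    halfPlane_re_div_antitone hd hre (by positivity) (max_le_max_right 1 h)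
  have hbdd : BddBelow (range fun y : ℝ => (f (max y 1 : ℝ)).re / (max y 1)) := by
    refine ⟨0, ?_⟩
    rintro _ ⟨y, rfl⟩
    exact div_nonneg (hre _ (by simp)) (by positivity)
  refine ⟨_, (tendsto_atTop_ciInf hanti hbdd).congr' ?_⟩
  filter_upwards [eventually_ge_atTop (1 : ℝ)] with y hy
  rw [max_eq_left hy]

/-- Julia's lemma at infinity for functions with nonnegative real part. -/
theorem halfPlane_julia (hd : DifferentiableOn ℂ f {w | 0 < w.re})
    (hre : ∀ w : ℂ, 0 < w.re → 0 ≤ (f w).re) {L : ℝ}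
    (hL : Tendsto (fun y : ℝ => (f y).re / y) atTop (𝓝 L)) {w : ℂ} (hw : 0 < w.re) :
    L * w.re ≤ (f w).re := by
  have h1 : Tendsto (fun y : ℝ => ‖w + y‖ / y) atTop (𝓝 1) := by
    have h2 : Tendsto (fun y : ℝ => ‖w * (y⁻¹ : ℝ) + 1‖) atTop (𝓝 ‖w * ((0 : ℝ) : ℂ) + 1‖) :=
      ((tendsto_const_nhds.mul
        ((continuous_ofReal.tendsto 0).comp tendsto_inv_atTop_zero)).add_const 1).norm
    simp only [ofReal_zero, mul_zero, zero_add, norm_one] at h2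
    refine h2.congr' ?_
    filter_upwards [eventually_gt_atTop (0 : ℝ)] with y hy
    have : w + y = (w * (y⁻¹ : ℝ) + 1) * y := by
      have : (y : ℂ) ≠ 0 := ofReal_ne_zero.2 hy.ne'
      push_cast
      field_simp
    rw [this, norm_mul, norm_real, Real.norm_of_nonneg hy.le, mul_div_cancel_right₀ _ hy.ne']
  have h3 : Tendsto (fun y : ℝ => (f y).re / y * (w.re / (‖w + y‖ / y) ^ 2)) atTop
      (𝓝 (L * (w.re / 1 ^ 2))) :=
    hL.mul (tendsto_const_nhds.div (h1.pow 2) (by norm_num))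
  simp only [one_pow, div_one] at h3
  refine le_of_tendsto h3 ?_
  filter_upwards [eventually_gt_atTop (0 : ℝ)] with y hy
  have := halfPlane_harnack hd hre (w₀ := y) (w₁ := w) (by simpa) hw
  refine le_trans (le_of_eq ?_) this
  simp only [conj_ofReal, ofReal_re]
  field_simp

end HalfPlane

section Barrier

variable {V E : Type*} [NormedAddCommGroup V] [NormedSpace ℂ V]
  [NormedAddCommGroup E] [NormedSpace ℂ E]

/-- The truncation of `-Re P` to a ball around `q`, extended by the constant `η`. -/
def barrier (P : E → ℂ) (q : E) (s η : ℝ) (z : E) : ℝ :=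
  open Classical in if ‖z - q‖ < s then min (-(P z).re) η else η

/-- `P` is a local peak function for `Ω` at `q` with constants `s`, `c`. -/
structure PeakAt (Ω : Set E) (P : E → ℂ) (q : E) (s c : ℝ) : Prop where
  s_pos : 0 < s
  c_pos : 0 < c
  diff : Differentiable ℂ P
  re_le : ∀ z ∈ Ω, ‖z - q‖ ≤ s → (P z).re ≤ -c * ‖z - q‖ ^ 2

variable {Ω : Set E} {P : E → ℂ} {q : E} {s c d η : ℝ}

theorem barrier_le (z : E) : barrier P q s η z ≤ η := by
  unfold barrier; split_ifs <;> simp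

theorem barrier_le_neg_re {z : E} (hz : ‖z - q‖ < s) : barrier P q s η z ≤ -(P z).re := by
  unfold barrier; simp [hz]

theorem barrier_of_lt {z : E} (hz : barrier P q s η z < η) :
    ‖z - q‖ < s ∧ barrier P q s η z = -(P z).re := by
  unfold barrier at *
  split_ifs at * with h
  · refine ⟨h, min_eq_left ?_⟩
    by_contra! h'
    rw [min_eq_right h'.le] at hz
    exact lt_irrefl _ hz
  · exact absurd hz (lt_irrefl _)

theorem PeakAt.barrier_nonneg (h : PeakAt Ω P q s c) (hη : 0 ≤ η) {z : E} (hz : z ∈ Ω) :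
    0 ≤ barrier P q s η z := by
  unfold barrier
  split_ifs with h'
  · refine le_min ?_ hη
    have := h.re_le z hz h'.le
    have := h.c_pos
    have : 0 ≤ c * ‖z - q‖ ^ 2 := by positivity
    linarith
  · exact hη

theorem PeakAt.sq_le_barrier (h : PeakAt Ω P q s c) {z : E} (hz : z ∈ Ω)
    (hlt : barrier P q s η z < η) : c * ‖z - q‖ ^ 2 ≤ barrier P q s η z := by
  obtain ⟨h1, h2⟩ := barrier_of_lt hlt
  rw [h2]
  have := h.re_le z hz h1.le
  linarith

theorem PeakAt.norm_lt_half (h : PeakAt Ω P q s c) (hη : η ≤ c * s ^ 2 / 4) {z : E} (hz : z ∈ Ω)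
    (hlt : barrier P q s η z < η) : ‖z - q‖ < s / 2 := by
  have h1 := h.sq_le_barrier hz hlt
  have h2 : c * ‖z - q‖ ^ 2 < c * (s / 2) ^ 2 := by
    calc _ ≤ _ := h1
      _ < η := hlt
      _ ≤ _ := hη
      _ = _ := by ring
  have h3 := lt_of_mul_lt_mul_left h2 h.c_pos.le
  exact lt_of_pow_lt_pow_left₀ 2 (by have := h.s_pos; positivity) h3

theorem PeakAt.barrier_le_three (h : PeakAt Ω P q s c) (hη0 : 0 < η) (hη : η ≤ c * s ^ 2 / 4)
    (hsd : s ≤ d) (hd : ∀ z ∈ Ω, ∀ w ∈ Ω, ‖z - w‖ ≤ d)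
    {φ : V → E} {x : V} {R : ℝ} (hR : 0 < R) (hφ : DifferentiableOn ℂ φ (ball x R))
    (hmaps : MapsTo φ (ball x R) Ω) {ζ : V} (hζ : ‖ζ - x‖ ≤ s / (4 * d) * R) :
    barrier P q s η (φ ζ) ≤ 3 * barrier P q s η (φ x) := by
  have hs := h.s_pos
  have hd0 : 0 < d := by linarith
  have hxm : x ∈ ball x R := mem_ball_self hR
  have hb0 := h.barrier_nonneg hη0.le (hmaps hxm)
  by_cases hb : barrier P q s η (φ x) < η
  swap
  · have := barrier_le (P := P) (q := q) (s := s) (η := η) (φ ζ)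
    linarith
  have h1 := h.norm_lt_half hη (hmaps hxm) hb
  obtain ⟨-, h2⟩ := barrier_of_lt hb
  set R' := s / (2 * d) * R with hR'
  have hR'0 : 0 < R' := by positivity
  have hR'R : R' ≤ R := by
    have : s / (2 * d) ≤ 1 := by rw [div_le_one (by positivity)]; linarith
    nlinarith
  have hsub : ball x R' ⊆ ball x R := ball_subset_ball hR'R
  have hnear : ∀ y ∈ ball x R', ‖φ y - q‖ < s := by
    intro y hy
    have h3 := dist_le_div_mul_dist_of_mapsTo_ball hφ (R₂ := d) (fun z hz => by
      rw [mem_closedBall, dist_eq_norm]; exact hd _ (hmaps hz) _ (hmaps hxm)) (hsub hy)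
    rw [mem_ball] at hy
    have h4 : d / R * dist y x ≤ s / 2 := by
      calc d / R * dist y x ≤ d / R * R' := by gcongr
        _ = s / 2 := by rw [hR']; field_simp
    rw [dist_eq_norm] at h3
    calc ‖φ y - q‖ = ‖(φ y - φ x) + (φ x - q)‖ := by congr 1; abel
      _ ≤ _ := norm_add_le _ _
      _ < s := by linarith
  have hζR : ‖ζ - x‖ ≤ R' / 2 := hζ.trans (le_of_eq (by rw [hR']; field_simp; ring))
  have hζm : ζ ∈ ball x R' := by rw [mem_ball, dist_eq_norm]; linarith
  have h5 := re_le_of_re_nonneg (f := fun y => -P (φ y)) (c := x) (z := ζ) (R := R')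
    ((h.diff.comp_differentiableOn (hφ.mono hsub)).neg) (fun y hy => by
      have h6 := h.re_le _ (hmaps (hsub hy)) (hnear y hy).le
      have := h.c_pos
      have : 0 ≤ c * ‖φ y - q‖ ^ 2 := by positivity
      simp only [neg_re]
      linarith) hζm
  simp only [neg_re, ← h2] at h5
  refine (barrier_le_neg_re (hnear ζ hζm)).trans (h5.trans ?_)
  rw [div_le_iff₀ (by linarith)]
  nlinarith [norm_nonneg (ζ - x)]

/-- Harnack-type comparison of the barrier along a holomorphic map into `Ω`. -/
theorem PeakAt.barrier_le_pow (h : PeakAt Ω P q s c) (hη0 : 0 < η) (hη : η ≤ c * s ^ 2 / 4)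
    (hsd : s ≤ d) (hd : ∀ z ∈ Ω, ∀ w ∈ Ω, ‖z - w‖ ≤ d)
    {φ : V → E} {x : V} {R : ℝ} (hR : 0 < R) (hφ : DifferentiableOn ℂ φ (ball x R))
    (hmaps : MapsTo φ (ball x R) Ω) {ζ : V} (hζ : ‖ζ - x‖ ≤ R / 2) :
    barrier P q s η (φ ζ) ≤ 3 ^ ⌈4 * d / s⌉₊ * barrier P q s η (φ x) := by
  have hs := h.s_pos
  have hd0 : 0 < d := by linarith
  set N := ⌈4 * d / s⌉₊ with hN
  have hN1 : 4 * d / s ≤ N := Nat.le_ceil _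
  have hN0 : (0 : ℝ) < N := lt_of_lt_of_le (by positivity) hN1
  set u : ℕ → V := fun k => x + ((k / N : ℝ) : ℂ) • (ζ - x) with hu
  have key : ∀ k : ℕ, k ≤ N →
      barrier P q s η (φ (u k)) ≤ 3 ^ k * barrier P q s η (φ x) := by
    intro k
    induction k with
    | zero => intro _; simp [hu]
    | succ k ih =>
      intro hk
      have hkN : (k : ℝ) ≤ N := by exact_mod_cast (Nat.le_succ k).trans hk
      have h1 : ‖u k - x‖ ≤ R / 2 := by
        have : u k - x = ((k / N : ℝ) : ℂ) • (ζ - x) := by simp [hu]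
        rw [this, norm_smul, norm_real, Real.norm_of_nonneg (by positivity)]
        have : (k : ℝ) / N ≤ 1 := by rw [div_le_one hN0]; exact hkN
        nlinarith [norm_nonneg (ζ - x)]
      have hsub : ball (u k) (R / 2) ⊆ ball x R :=
        ball_subset_ball' (by rw [dist_eq_norm]; linarith)
      have h2 : ‖u (k + 1) - u k‖ ≤ s / (4 * d) * (R / 2) := by
        have : u (k + 1) - u k = ((1 / N : ℝ) : ℂ) • (ζ - x) := by
          simp only [hu, add_sub_add_left_eq_sub, ← sub_smul]
          congr 1
          push_cast
          ring
        rw [this, norm_smul, norm_real, Real.norm_of_nonneg (by positivity)]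
        have h3 : (1 : ℝ) / N ≤ s / (4 * d) := by
          rw [div_le_div_iff₀ hN0 (by positivity)]
          rw [div_le_iff₀ hs] at hN1
          linarith
        gcongr
      have h4 := h.barrier_le_three hη0 hη hsd hd (by linarith) (hφ.mono hsub)
        (hmaps.mono_left hsub) h2
      calc _ ≤ _ := h4
        _ ≤ 3 * (3 ^ k * barrier P q s η (φ x)) := by
          gcongr
          exact ih ((Nat.le_succ k).trans hk)
        _ = _ := by ring
  have hlast : u N = ζ := by
    simp only [hu, div_self hN0.ne', ofReal_one, one_smul]
    abel
  simpa [hlast] using key N le_rfl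

/-- A quantitative Hopf lemma: the barrier decays at most linearly along analytic discs. -/
theorem PeakAt.hopf (h : PeakAt Ω P q s c) (hη0 : 0 < η) (hη : η ≤ c * s ^ 2 / 4)
    (hsd : s ≤ d) (hd : ∀ z ∈ Ω, ∀ w ∈ Ω, ‖z - w‖ ≤ d)
    {φ : ℂ → E} (hφ : DifferentiableOn ℂ φ (ball 0 1))
    (hmaps : MapsTo φ (ball 0 1) Ω) {ζ : ℂ} (hζ : ‖ζ‖ < 1) :
    1 / (3 * Real.log (8 * d / s)) * barrier P q s η (φ 0) * (1 - ‖ζ‖) ≤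
      barrier P q s η (φ ζ) := by
  have hs := h.s_pos
  have hd0 : 0 < d := by linarith
  set ρ₀ := s / (8 * d) with hρ₀
  have hρ₀0 : 0 < ρ₀ := by positivity
  have hρ₀1 : ρ₀ ≤ 1 / 8 := by
    rw [hρ₀, div_le_div_iff₀ (by positivity) (by norm_num)]; linarith
  set L := Real.log (8 * d / s) with hL
  have hLexp : Real.exp (-L) = ρ₀ := by
    rw [hL, ← Real.log_inv, Real.exp_log (by positivity), inv_div]
  have hL1 : 1 ≤ L := by
    rw [hL, Real.le_log_iff_exp_le (by positivity), le_div_iff₀ hs]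
    have := Real.exp_one_lt_d9
    nlinarith
  set β := barrier P q s η (φ 0) with hβ
  have hζm : ζ ∈ ball (0 : ℂ) 1 := by simpa using hζ
  have hβη : β ≤ η := barrier_le _
  have hβ0 : 0 ≤ β := h.barrier_nonneg hη0.le (hmaps (by simp))
  have hsmall : ∀ x : ℂ, ‖x‖ ≤ ρ₀ → β / 3 ≤ barrier P q s η (φ x) := by
    intro x hx
    have hsub : ball x (1 / 2) ⊆ ball (0 : ℂ) 1 :=
      ball_subset_ball' (by rw [dist_eq_norm, sub_zero]; linarith)
    have := h.barrier_le_three hη0 hη hsd hd (x := x) (R := 1 / 2) (by norm_num)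
      (hφ.mono hsub) (hmaps.mono_left hsub) (ζ := 0) (by
        rw [zero_sub, norm_neg]; exact hx.trans (le_of_eq (by rw [hρ₀]; field_simp; ring)))
    linarith
  by_cases hcase : β / 3 ≤ barrier P q s η (φ ζ)
  · refine le_trans ?_ hcase
    have h1 : 1 / (3 * L) ≤ 1 / 3 := by
      apply one_div_le_one_div_of_le <;> linarith
    have h2 : 1 / (3 * L) * β ≤ β / 3 := by nlinarith
    have h3 : 0 ≤ 1 / (3 * L) * β := by positivity
    nlinarith [norm_nonneg ζ]
  push Not at hcase
  have hβpos : 0 < β := by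
    have := h.barrier_nonneg hη0.le (hmaps hζm)
    linarith
  obtain ⟨hz1, hz2⟩ := barrier_of_lt (hcase.trans_le (by linarith))
  have hζρ : ρ₀ < ‖ζ‖ := by
    by_contra! h'
    have := hsmall ζ h'
    linarith
  set c' := β / (3 * L) with hc'
  have hc'0 : 0 < c' := by positivity
  have hPneg : ∀ x ∈ ball (0 : ℂ) 1, ‖φ x - q‖ ≤ s → (P (φ x)).re ≤ -c * ‖φ x - q‖ ^ 2 :=
    fun x hx hx' => h.re_le _ (hmaps hx) hx'
  have key : ∀ R : ℝ, ‖ζ‖ < R → R < 1 → Real.exp ((P (φ ζ)).re / c') ≤ ‖ζ‖ / R := by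
    intro R hR1 hR2
    have hR0 : 0 < R := (norm_nonneg ζ).trans_lt hR1
    have hcb : closedBall (0 : ℂ) R ⊆ ball 0 1 := closedBall_subset_ball hR2
    have hφc : ContinuousOn φ (ball 0 1) := hφ.continuousOn
    have hPc : ContinuousOn (fun x => -(P (φ x)).re) (ball 0 1) :=
      (continuous_re.comp_continuousOn (h.diff.continuous.comp_continuousOn hφc)).neg
    set A : Set ℂ := {x | x ∈ ball 0 1 ∧ ρ₀ < ‖x‖ ∧ ‖x‖ < R ∧ ‖φ x - q‖ < s ∧
      -(P (φ x)).re < β / 3} with hA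
    set G : ℂ → ℝ × ℝ × ℝ := fun x => (‖x‖, ‖φ x - q‖, -(P (φ x)).re) with hG
    have hGc : ContinuousOn G (ball 0 1) :=
      continuous_norm.continuousOn.prodMk ((hφc.sub continuousOn_const).norm.prodMk hPc)
    have hcl : closure A ⊆ closedBall 0 R ∩ G ⁻¹' (Icc ρ₀ R ×ˢ Iic s ×ˢ Iic (β / 3)) := by
      refine closure_minimal ?_ ?_
      · rintro x ⟨-, h1, h2, h3, h4⟩
        exact ⟨by simpa using h2.le, ⟨h1.le, h2.le⟩, h3.le, h4.le⟩
      · exact (hGc.mono hcb).preimage_isClosed_of_isClosed isClosed_closedBall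
          (isClosed_Icc.prod (isClosed_Iic.prod isClosed_Iic))
    have hopen : IsOpen A := by
      have : A = ball 0 1 ∩ G ⁻¹' (Ioo ρ₀ R ×ˢ Iio s ×ˢ Iio (β / 3)) := by
        ext x; simp [hA, hG, and_assoc]
      rw [this]
      exact hGc.isOpen_inter_preimage isOpen_ball (isOpen_Ioo.prod (isOpen_Iio.prod isOpen_Iio))
    set g : ℂ → ℂ := fun x => Complex.exp (P (φ x) / c') / x with hg
    have hne : ∀ x ∈ closure A, x ≠ 0 := by
      intro x hx h0
      have := (hcl hx).2.1.1
      rw [h0] at this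
      simp only [hG, norm_zero] at this
      linarith
    have hgd : DiffContOnCl ℂ g A := by
      apply DifferentiableOn.diffContOnCl
      refine DifferentiableOn.div ?_ differentiableOn_id hne
      refine DifferentiableOn.cexp (DifferentiableOn.div_const ?_ _)
      exact h.diff.comp_differentiableOn (hφ.mono fun x hx => hcb (hcl hx).1)
    have hnorm : ∀ x, ‖g x‖ = Real.exp ((P (φ x)).re / c') / ‖x‖ := by
      intro x
      simp only [hg, norm_div, Complex.norm_exp]
      congr 3
      rw [Complex.div_ofReal_re]
    have hfr : ∀ x ∈ frontier A, ‖g x‖ ≤ 1 / R := by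
      intro x hx
      have hxc := hcl hx.1
      have hxA : x ∉ A := by rw [hopen.frontier_eq] at hx; exact hx.2
      obtain ⟨hxR, ⟨h1, h2⟩, h3, h4⟩ := hxc
      simp only [hG, mem_Iic] at h1 h2 h3 h4
      have hx1 := hcb hxR
      have hx0 : 0 < ‖x‖ := hρ₀0.trans_le h1
      have hP1 := hPneg x hx1 h3
      have hcpos := h.c_pos
      have h3' : ‖φ x - q‖ < s := by
        refine lt_of_le_of_ne h3 fun h' => ?_
        rw [h'] at hP1
        have : 0 < c * s ^ 2 := by positivity
        linarith
      have hsmallcase : β / 3 ≤ -(P (φ x)).re → ‖g x‖ ≤ 1 / R := by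
        intro h5
        rw [hnorm]
        have h6 : Real.exp ((P (φ x)).re / c') ≤ ρ₀ := by
          rw [← hLexp]
          apply Real.exp_le_exp.2
          rw [div_le_iff₀ hc'0, hc']
          have : -L * (β / (3 * L)) = -(β / 3) := by field_simp
          linarith
        calc _ ≤ ρ₀ / ρ₀ := by gcongr
          _ = 1 := div_self hρ₀0.ne'
          _ ≤ 1 / R := by rw [le_div_iff₀ hR0]; linarith
      by_cases c1 : ‖x‖ = ρ₀
      · exact hsmallcase ((hsmall x c1.le).trans (barrier_le_neg_re h3'))
      by_cases c2 : ‖x‖ = R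
      · rw [hnorm, c2]
        gcongr
        rw [Real.exp_le_one_iff]
        apply div_nonpos_of_nonpos_of_nonneg _ hc'0.le
        have : 0 ≤ c * ‖φ x - q‖ ^ 2 := by positivity
        linarith
      apply hsmallcase
      by_contra! c3
      exact hxA ⟨hx1, lt_of_le_of_ne h1 (Ne.symm c1), lt_of_le_of_ne h2 c2, h3', c3⟩
    have hbdd : Bornology.IsBounded A :=
      isBounded_ball.subset fun x hx => hx.1
    have hζA : ζ ∈ A := ⟨hζm, hζρ, hR1, hz1, by rw [← hz2]; exact hcase⟩
    have := norm_le_of_forall_mem_frontier_norm_le hbdd hgd hfr (subset_closure hζA)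
    rw [hnorm, div_le_div_iff₀ (by linarith) hR0] at this
    rw [le_div_iff₀ hR0]
    linarith
  have hlim : Real.exp ((P (φ ζ)).re / c') ≤ ‖ζ‖ := by
    have ht : Tendsto (fun R : ℝ => ‖ζ‖ / R) (𝓝[<] 1) (𝓝 (‖ζ‖ / 1)) :=
      Tendsto.mono_left (tendsto_const_nhds.div tendsto_id one_ne_zero) nhdsWithin_le_nhds
    rw [div_one] at ht
    refine ge_of_tendsto ht ?_
    filter_upwards [Ioo_mem_nhdsLT hζ] with R hR
    exact key R hR.1 hR.2
  have hfin := (Real.add_one_le_exp _).trans hlim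
  have h7 : (P (φ ζ)).re / c' ≤ ‖ζ‖ - 1 := by linarith
  rw [div_le_iff₀ hc'0] at h7
  rw [hz2]
  have h8 : 1 / (3 * L) * β = c' := by rw [hc']; ring
  rw [h8]
  linarith

/-- The Hopf lemma for discs parametrized by the right half-plane. -/
theorem PeakAt.hopf_halfPlane (h : PeakAt Ω P q s c) (hη0 : 0 < η) (hη : η ≤ c * s ^ 2 / 4)
    (hsd : s ≤ d) (hd : ∀ z ∈ Ω, ∀ w ∈ Ω, ‖z - w‖ ≤ d)
    {φ : ℂ → E} (hφ : DifferentiableOn ℂ φ {w | 0 < w.re})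
    (hmaps : ∀ w : ℂ, 0 < w.re → φ w ∈ Ω) {w₀ w₁ : ℂ} (h₀ : 0 < w₀.re) (h₁ : 0 < w₁.re) :
    1 / (3 * Real.log (8 * d / s)) * barrier P q s η (φ w₀) *
      (w₀.re * w₁.re / ‖w₁ + (starRingEnd ℂ) w₀‖ ^ 2) ≤ barrier P q s η (φ w₁) := by
  obtain ⟨m, ζ, hm, hmm, hm0, hm1, hζ, -, hsq⟩ := exists_mobius_halfPlane h₀ h₁
  have key := h.hopf hη0 hη hsd hd (φ := φ ∘ m) (hφ.comp hm hmm)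
    (fun x hx => hmaps _ (hmm x hx)) hζ
  simp only [comp_apply, hm0, hm1] at key
  refine le_trans (mul_le_mul_of_nonneg_left ?_ ?_) key
  · have h2 : w₀.re * w₁.re / ‖w₁ + (starRingEnd ℂ) w₀‖ ^ 2 = (1 - ‖ζ‖ ^ 2) / 4 := by
      rw [hsq]; ring
    rw [h2]
    nlinarith [norm_nonneg ζ]
  · have hs := h.s_pos
    have : 0 ≤ Real.log (8 * d / s) := Real.log_nonneg (by
      rw [le_div_iff₀ hs]; linarith)
    have := h.barrier_nonneg hη0.le (hmaps w₀ h₀)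
    positivity

end Barrier

/-- Holomorphic support data for `Ω` at the boundary points near `p`: a quadratic peak
function `z ↦ ℓ q (z - q) + B (z - q) (z - q)` at every boundary point `q` near `p`. -/
structure LocalPeak {E : Type*} [NormedAddCommGroup E] [NormedSpace ℂ E]
    (Ω : Set E) (p : E) where
  (s c C : ℝ)
  ℓ : E → E →L[ℂ] ℂ
  B : E →L[ℂ] E →L[ℂ] ℂ
  ν : E
  s_pos : 0 < s
  c_pos : 0 < c
  C_pos : 0 < C
  re_le : ∀ q ∈ frontier Ω, ‖q - p‖ < s → ∀ z ∈ Ω, ‖z - q‖ ≤ s →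
    (ℓ q (z - q) + B (z - q) (z - q)).re ≤ -c * ‖z - q‖ ^ 2
  mem : ∀ q ∈ frontier Ω, ‖q - p‖ < s → ∀ z, ‖z - q‖ < s →
    (ℓ q (z - q)).re + C * ‖z - q‖ ^ 2 < 0 → z ∈ Ω
  lip : ∀ q, ‖q - p‖ < s → ‖ℓ q - ℓ p‖ ≤ C * ‖q - p‖
  norm_ℓ : ‖ℓ p‖ ≤ C
  norm_B : ‖B‖ ≤ C
  norm_ν : ‖ν‖ ≤ C
  ℓ_ν : ℓ p ν = 1

section LeviPeak

variable {n : ℕ}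

/-- The complex bilinear part of a real bilinear form `H`. -/
theorem exists_complex_bilinear (H : En n →L[ℝ] En n →L[ℝ] ℝ) :
    ∃ B : En n →L[ℂ] En n →L[ℂ] ℂ, ∀ ξ,
      (B ξ ξ).re = (1 / 4) * (H ξ ξ - H (I • ξ) (I • ξ)) := by
  have hsm : ∀ (a : ℂ) (x : En n), a • x = a.re • x + a.im • (I • x) := by
    intro a x
    conv_lhs => rw [← re_add_im a]
    rw [add_smul, mul_smul]
    rfl
  have hII : ∀ x : En n, I • I • x = -x := fun x => by rw [smul_smul, I_mul_I]; simp
  let b : En n →ₗ[ℂ] En n →ₗ[ℂ] ℂ := LinearMap.mk₂ ℂ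
    (fun ξ η => (((1 / 4) * (H ξ η - H (I • ξ) (I • η)) : ℝ) : ℂ) -
      I * (((1 / 4) * (H ξ (I • η) + H (I • ξ) η) : ℝ) : ℂ))
    (fun x y z => by simp; ring)
    (fun a x y => by
      rw [smul_comm I a x, hsm a x, hsm a (I • x), hII]
      apply Complex.ext <;> simp <;> ring)
    (fun x y z => by simp; ring)
    (fun a x y => by
      rw [smul_comm I a y, hsm a y, hsm a (I • y), hII]
      apply Complex.ext <;> simp <;> ring)
  refine ⟨LinearMap.toContinuousLinearMap
    ((LinearMap.toContinuousLinearMap : (En n →ₗ[ℂ] ℂ) ≃ₗ[ℂ] _).toLinearMap ∘ₗ b), fun ξ => ?_⟩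
  simp [b]

/-- Adding a multiple of the square of the differential makes the Levi form positive definite. -/
theorem exists_levi_pos (H : En n →L[ℝ] En n →L[ℝ] ℝ) (D : En n →L[ℝ] ℝ)
    (hpos : ∀ ξ : En n, ξ ≠ 0 → D ξ = 0 → D (I • ξ) = 0 →
      0 < (1 / 4) * (H ξ ξ + H (I • ξ) (I • ξ))) :
    ∃ A c : ℝ, 0 < A ∧ 0 < c ∧ ∀ ξ : En n, c * ‖ξ‖ ^ 2 ≤
      (1 / 4) * (H ξ ξ + H (I • ξ) (I • ξ)) + A / 2 * (D ξ ^ 2 + D (I • ξ) ^ 2) := by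
  set f : ℝ → En n → ℝ := fun A ξ =>
    (1 / 4) * (H ξ ξ + H (I • ξ) (I • ξ)) + A / 2 * (D ξ ^ 2 + D (I • ξ) ^ 2) with hf
  have hfc : ∀ A, Continuous (f A) := fun A => by
    simp only [hf]
    fun_prop
  have hS : IsCompact (sphere (0 : En n) 1) := isCompact_sphere 0 1
  obtain ⟨A, hA⟩ : ∃ k : ℕ, ∀ ξ ∈ sphere (0 : En n) 1, 0 < f (k + 1) ξ := by
    by_contra! hcon
    set K : ℕ → Set (En n) := fun k => sphere 0 1 ∩ {ξ | f (k + 1) ξ ≤ 0} with hK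
    have hKc : ∀ k : ℕ, IsClosed {ξ | f (k + 1) ξ ≤ 0} := fun k =>
      isClosed_le (hfc _) continuous_const
    obtain ⟨ξ, hξ⟩ := IsCompact.nonempty_iInter_of_sequence_nonempty_isCompact_isClosed K
      (fun k ξ hξ => ⟨hξ.1, by
        have h1 := hξ.2
        simp only [hf, mem_ofPred_eq] at h1 ⊢
        refine le_trans ?_ h1
        push_cast
        gcongr
        linarith⟩)
      (fun k => by obtain ⟨ξ, h1, h2⟩ := hcon k; exact ⟨ξ, h1, h2⟩)
      (hS.inter_right (hKc 0)) (fun k => isClosed_sphere.inter (hKc k))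
    rw [mem_iInter] at hξ
    have hξ1 : ‖ξ‖ = 1 := by simpa using (hξ 0).1
    have hN : D ξ ^ 2 + D (I • ξ) ^ 2 = 0 := by
      by_contra hne
      have hpos' : 0 < D ξ ^ 2 + D (I • ξ) ^ 2 := lt_of_le_of_ne (by positivity) (Ne.symm hne)
      obtain ⟨k, hk⟩ := exists_nat_gt
        (-2 * ((1 / 4) * (H ξ ξ + H (I • ξ) (I • ξ))) / (D ξ ^ 2 + D (I • ξ) ^ 2))
      rw [div_lt_iff₀ hpos'] at hk
      have := (hξ k).2
      simp only [hf, mem_ofPred_eq] at this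
      nlinarith
    have h1 : D ξ = 0 := by nlinarith [sq_nonneg (D ξ), sq_nonneg (D (I • ξ))]
    have h2 : D (I • ξ) = 0 := by nlinarith [sq_nonneg (D ξ), sq_nonneg (D (I • ξ))]
    have h3 := hpos ξ (by rintro rfl; simp at hξ1) h1 h2
    have h4 := (hξ 0).2
    simp only [hf, mem_ofPred_eq, hN] at h4
    linarith
  obtain ⟨c, hc, hcf⟩ : ∃ c : ℝ, 0 < c ∧ ∀ ξ ∈ sphere (0 : En n) 1, c ≤ f (A + 1) ξ := by
    rcases (sphere (0 : En n) 1).eq_empty_or_nonempty with he | hne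
    · exact ⟨1, one_pos, by simp [he]⟩
    · obtain ⟨x, hx, hmin⟩ := hS.exists_isMinOn hne (hfc (A + 1)).continuousOn
      exact ⟨_, hA x hx, fun ξ hξ => hmin hξ⟩
  refine ⟨A + 1, c, by positivity, hc, fun ξ => ?_⟩
  by_cases h0 : ξ = 0
  · simp [h0]
  have hn : 0 < ‖ξ‖ := norm_pos_iff.2 h0
  have h1 := hcf ((‖ξ‖⁻¹ : ℝ) • ξ) (by simp [norm_smul, hn.ne'])
  have h2 : f (A + 1) ((‖ξ‖⁻¹ : ℝ) • ξ) = (‖ξ‖⁻¹) ^ 2 * f (A + 1) ξ := by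
    simp only [hf, smul_comm I (‖ξ‖⁻¹ : ℝ) ξ, map_smul, smul_apply,
      smul_eq_mul]
    ring
  rw [h2, inv_pow, ← div_eq_inv_mul, le_div_iff₀ (by positivity)] at h1
  exact h1

set_option maxHeartbeats 800000 in
theorem exists_localPeak {Ω : Set (En n)} {ρ : En n → ℝ} (hρ : IsDefiningFunction Ω ⊤ ρ)
    {p : En n} (hp : p ∈ frontier Ω) (hspc : StronglyPcxAt ρ p) :
    Nonempty (LocalPeak Ω p) := by
  obtain ⟨hsm, hΩ, hfr, hne⟩ := hρ
  have hsm2 : ContDiff ℝ 2 ρ := hsm.of_le (WithTop.coe_le_coe.2 (le_top : (2 : ℕ∞) ≤ ⊤))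
  set D : En n → En n →L[ℝ] ℝ := fderiv ℝ ρ with hD
  have hDs : ContDiff ℝ 1 D := hsm2.fderiv_right (by norm_num)
  set H := fderiv ℝ D p with hH
  have hstrict : HasStrictFDerivAt D H p := hDs.contDiffAt.hasStrictFDerivAt (by norm_num)
  have hstrict0 : HasStrictFDerivAt ρ (D p) p := hsm2.contDiffAt.hasStrictFDerivAt (by norm_num)
  have hLevi : ∀ ξ : En n, LeviForm ρ p ξ = (1 / 4) * (H ξ ξ + H (I • ξ) (I • ξ)) := by
    intro ξ
    simp [LeviForm, iteratedFDeriv_two_apply, hH, hD]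
  obtain ⟨A, c, hA, hc, hpos⟩ := exists_levi_pos H (D p) (fun ξ h0 h1 h2 => by
    rw [← hLevi]; exact hspc ξ h0 ⟨h1, h2⟩)
  obtain ⟨B, hB⟩ := exists_complex_bilinear (H + (2 * A) • ((D p).smulRight (D p)))
  set ℓ : En n → En n →L[ℂ] ℂ := fun q => StrongDual.extendRCLikeₗᵢ (𝕜 := ℂ) (D q) with hℓ
  have hℓre : ∀ q ξ, (ℓ q ξ).re = D q ξ := fun q ξ => by
    exact StrongDual.re_extendRCLike_apply (𝕜 := ℂ) (D q) ξ
  have hℓn : ∀ q q', ‖ℓ q - ℓ q'‖ = ‖D q - D q'‖ := fun q q' => by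
    simp only [hℓ]
    rw [← map_sub, LinearIsometryEquiv.norm_map]
  obtain ⟨ν, hν⟩ : ∃ ν, ℓ p ν = 1 := by
    have h1 : ℓ p ≠ 0 := by
      intro h
      exact hne p hp (ContinuousLinearMap.ext fun ξ => by
        have := hℓre p ξ
        rw [h] at this
        simpa using this.symm)
    obtain ⟨w, hw⟩ : ∃ w, ℓ p w ≠ 0 := by
      by_contra! h
      exact h1 (ContinuousLinearMap.ext h)
    exact ⟨(ℓ p w)⁻¹ • w, by simp [hw]⟩
  -- small constants
  set ε' : ℝ := min 1 (c / (4 * A * (2 * ‖D p‖ + 1))) with hε'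
  have hε'0 : 0 < ε' := by positivity
  have hε'2 : A * (ε' * (2 * ‖D p‖ + 1)) ≤ c / 4 := by
    have : ε' ≤ c / (4 * A * (2 * ‖D p‖ + 1)) := min_le_right _ _
    rw [le_div_iff₀ (by positivity)] at this
    linarith
  have e1 := (hstrict.isLittleO.def (show (0 : ℝ) < c / 4 by positivity))
  have e2 := (hstrict0.isLittleO.def hε'0)
  have e3 : ∀ᶠ z in 𝓝 p, -(1 / A) < ρ z := by
    have hρp : ρ p = 0 := by rw [hfr] at hp; exact hp
    have : Tendsto ρ (𝓝 p) (𝓝 0) := hρp ▸ hsm2.continuous.tendsto p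
    exact this.eventually (lt_mem_nhds (by simp [hA]))
  rw [nhds_prod_eq] at e1 e2
  obtain ⟨u1, hu1, hu1'⟩ := mem_prod_self_iff.1 e1
  obtain ⟨u2, hu2, hu2'⟩ := mem_prod_self_iff.1 e2
  obtain ⟨s0, hs0, hball⟩ := Metric.mem_nhds_iff.1 (inter_mem (inter_mem hu1 hu2) e3)
  have hb : ∀ z : En n, ‖z - p‖ < s0 → z ∈ u1 ∧ z ∈ u2 ∧ -(1 / A) < ρ z := fun z hz => by
    obtain ⟨⟨h1, h2⟩, h3⟩ := hball (show z ∈ ball p s0 by rwa [mem_ball, dist_eq_norm])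
    exact ⟨h1, h2, h3⟩
  set s := s0 / 3 with hs
  have hs1 : 0 < s := by positivity
  have hnear : ∀ q z : En n, ‖q - p‖ < s → ‖z - q‖ ≤ s → ‖z - p‖ < s0 := by
    intro q z h1 h2
    calc ‖z - p‖ = ‖(z - q) + (q - p)‖ := by congr 1; abel
      _ ≤ _ := norm_add_le _ _
      _ < s0 := by linarith
  -- second order Taylor expansion
  have taylor : ∀ q ∈ frontier Ω, ‖q - p‖ < s → ∀ z, ‖z - q‖ ≤ s →
      |ρ z - D q (z - q) - 1 / 2 * H (z - q) (z - q)| ≤ c / 4 * ‖z - q‖ ^ 2 := by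
    intro q hq hqp z hz
    have hρq : ρ q = 0 := by rw [hfr] at hq; exact hq
    set ξ := z - q with hξ
    set g : ℝ → ℝ := fun τ => ρ (q + τ • ξ) - τ * D q ξ - τ ^ 2 / 2 * H ξ ξ with hg
    have hgd : ∀ τ : ℝ, HasDerivAt g (D (q + τ • ξ) ξ - D q ξ - τ * H ξ ξ) τ := by
      intro τ
      have h1 : HasDerivAt (fun τ : ℝ => q + τ • ξ) ξ τ := by
        simpa using ((hasDerivAt_id τ).smul_const ξ).const_add q
      have h2 : HasFDerivAt ρ (D (q + τ • ξ)) (q + τ • ξ) :=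
        (hsm2.differentiable (by norm_num)).differentiableAt.hasFDerivAt
      have h3 := h2.comp_hasDerivAt τ h1
      have h4 := (h3.sub ((hasDerivAt_id τ).mul_const (D q ξ))).sub
        ((((hasDerivAt_id τ).pow 2).div_const 2).mul_const (H ξ ξ))
      refine h4.congr_deriv ?_
      simp
    have := norm_image_sub_le_of_norm_deriv_le_segment_01' (f := g)
      (f' := fun τ => D (q + τ • ξ) ξ - D q ξ - τ * H ξ ξ) (C := c / 4 * ‖ξ‖ ^ 2)
      (fun τ _ => (hgd τ).hasDerivWithinAt) (fun τ hτ => by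
        have hx1 : ‖q + τ • ξ - q‖ = τ * ‖ξ‖ := by
          rw [add_sub_cancel_left, norm_smul, Real.norm_of_nonneg hτ.1]
        have hx : ‖q + τ • ξ - p‖ < s0 := hnear q _ hqp (by
          rw [hx1]; nlinarith [norm_nonneg ξ, hτ.1, hτ.2])
        have hqs : ‖q - p‖ < s0 := by linarith
        have h5 := hu1' (show (q + τ • ξ, q) ∈ u1 ×ˢ u1 from ⟨(hb _ hx).1, (hb _ hqs).1⟩)
        simp only [mem_ofPred_eq] at h5
        rw [add_sub_cancel_left, norm_smul, Real.norm_of_nonneg hτ.1] at h5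
        have h6 : D (q + τ • ξ) ξ - D q ξ - τ * H ξ ξ =
            (D (q + τ • ξ) - D q - H (τ • ξ)) ξ := by simp
        rw [h6]
        refine (ContinuousLinearMap.le_opNorm _ _).trans ?_
        calc _ ≤ c / 4 * (τ * ‖ξ‖) * ‖ξ‖ := by gcongr
          _ ≤ c / 4 * (1 * ‖ξ‖) * ‖ξ‖ := by gcongr; exact hτ.2.le
          _ = _ := by ring)
    simp only [hg, one_smul, zero_smul, add_zero, hρq, Real.norm_eq_abs] at this
    rw [show q + ξ = z by rw [hξ]; abel] at this
    refine le_trans (le_of_eq ?_) this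
    congr 1
    ring
  have hstr : ∀ q ∈ frontier Ω, ‖q - p‖ < s → ∀ z, ‖z - q‖ ≤ s →
      |ρ z - D p (z - q)| ≤ ε' * ‖z - q‖ := by
    intro q hq hqp z hz
    have hρq : ρ q = 0 := by rw [hfr] at hq; exact hq
    have h5 := hu2' (show (z, q) ∈ u2 ×ˢ u2 from
      ⟨(hb _ (hnear q z hqp hz)).2.1, (hb _ (by linarith)).2.1⟩)
    simpa [hρq] using h5
  set C : ℝ := ‖ℓ p‖ + ‖B‖ + ‖ν‖ + ‖H‖ + c + 1 with hC
  have hC0 : 0 < C := by positivity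
  refine ⟨{
    s := s, c := c / 2, C := C, ℓ := ℓ, B := B, ν := ν
    s_pos := hs1, c_pos := by positivity, C_pos := hC0
    re_le := ?_, mem := ?_, lip := ?_
    norm_ℓ := ?_, norm_B := ?_, norm_ν := ?_, ℓ_ν := hν }⟩
  · intro q hq hqp z hz hzq
    have h1 := taylor q hq hqp z hzq
    have h2 := hstr q hq hqp z hzq
    have h3 := hpos (z - q)
    have h4 := (hb z (hnear q z hqp hzq)).2.2
    have h5 : ρ z < 0 := by rw [hΩ] at hz; exact hz
    rw [add_re, hℓre, hB]
    set ξ := z - q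
    simp only [add_apply, smul_apply,
      ContinuousLinearMap.smulRight_apply, smul_eq_mul]
    have h6 : ρ z + A * ρ z ^ 2 ≤ 0 := by
      have : -(1 / A) * A = -1 := by field_simp
      nlinarith
    have h7 : |D p ξ| ≤ ‖D p‖ * ‖ξ‖ := by
      simpa using (D p).le_opNorm ξ
    have h8 : (D p ξ) ^ 2 - ρ z ^ 2 ≤ ε' * (2 * ‖D p‖ + 1) * ‖ξ‖ ^ 2 := by
      have h9 : |D p ξ + ρ z| ≤ (2 * ‖D p‖ + 1) * ‖ξ‖ := by
        have h10 : D p ξ + ρ z = 2 * D p ξ + (ρ z - D p ξ) := by ring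
        have h11 : ε' ≤ 1 := min_le_left _ _
        rw [h10]
        calc _ ≤ |2 * D p ξ| + |ρ z - D p ξ| := abs_add_le _ _
          _ ≤ 2 * (‖D p‖ * ‖ξ‖) + 1 * ‖ξ‖ := by
            rw [abs_mul, abs_two]
            gcongr
            exact h2.trans (by gcongr)
          _ = _ := by ring
      calc (D p ξ) ^ 2 - ρ z ^ 2 = -(ρ z - D p ξ) * (D p ξ + ρ z) := by ring
        _ ≤ |-(ρ z - D p ξ) * (D p ξ + ρ z)| := le_abs_self _
        _ = |ρ z - D p ξ| * |D p ξ + ρ z| := by rw [abs_mul, abs_neg]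
        _ ≤ (ε' * ‖ξ‖) * ((2 * ‖D p‖ + 1) * ‖ξ‖) := by gcongr
        _ = _ := by ring
    have h12 : A * ((D p ξ) ^ 2 - ρ z ^ 2) ≤ c / 4 * ‖ξ‖ ^ 2 := by
      calc _ ≤ A * (ε' * (2 * ‖D p‖ + 1) * ‖ξ‖ ^ 2) := by gcongr
        _ = A * (ε' * (2 * ‖D p‖ + 1)) * ‖ξ‖ ^ 2 := by ring
        _ ≤ _ := by gcongr
    have h13 := (abs_le.1 h1).1
    linarith
  · intro q hq hqp z hzq hlt
    have h1 := taylor q hq hqp z hzq.le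
    rw [hℓre] at hlt
    rw [hΩ, mem_ofPred_eq]
    set ξ := z - q
    have h2 : |H ξ ξ| ≤ ‖H‖ * ‖ξ‖ ^ 2 := by
      have := H.le_opNorm₂ ξ ξ
      rw [Real.norm_eq_abs] at this
      linarith
    have h3 := (abs_le.1 h1).2
    have h4 := (abs_le.1 h2).2
    have h5 : (‖H‖ + c) * ‖ξ‖ ^ 2 ≤ C * ‖ξ‖ ^ 2 := by
      gcongr
      rw [hC]
      linarith [norm_nonneg (ℓ p), norm_nonneg B, norm_nonneg ν]
    have h6 : 0 ≤ ‖H‖ * ‖ξ‖ ^ 2 := by positivity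
    have h7 : 0 ≤ c * ‖ξ‖ ^ 2 := by positivity
    linarith
  · intro q hqp
    rw [hℓn]
    have h5 := hu1' (show (q, p) ∈ u1 ×ˢ u1 from ⟨(hb _ (by linarith)).1, (hb _ (by simp [hs0])).1⟩)
    simp only [mem_ofPred_eq] at h5
    calc ‖D q - D p‖ = ‖(D q - D p - H (q - p)) + H (q - p)‖ := by congr 1; abel
      _ ≤ c / 4 * ‖q - p‖ + ‖H‖ * ‖q - p‖ := (norm_add_le _ _).trans
        (add_le_add h5 (H.le_opNorm _))
      _ ≤ (‖H‖ + c) * ‖q - p‖ := by nlinarith [norm_nonneg (q - p)]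
      _ ≤ C * ‖q - p‖ := by
        gcongr
        rw [hC]
        linarith [norm_nonneg (ℓ p), norm_nonneg B, norm_nonneg ν]
  all_goals
    rw [hC]
    linarith [norm_nonneg (ℓ p), norm_nonneg B, norm_nonneg ν, norm_nonneg H]

end LeviPeak

section RetractFlow

variable {E : Type*} [NormedAddCommGroup E] [NormedSpace ℂ E]

/-- A discrete holomorphic semigroup `f` on `Ω`, based at the retraction `f 0`, which returns to
`f 0` along the sequence of times `ms`. -/
structure RetractFlow (Ω : Set E) (f : ℕ → E → E) (ms : ℕ → ℕ) : Prop where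
  isOpen : IsOpen Ω
  bdd : Bornology.IsBounded Ω
  diff : ∀ m, DifferentiableOn ℂ (f m) Ω
  maps : ∀ m, MapsTo (f m) Ω Ω
  add : ∀ l m, ∀ z ∈ Ω, f l (f m z) = f (l + m) z
  ms_tendsto : Tendsto ms atTop atTop
  tendsto : ∀ z ∈ Ω, Tendsto (fun j => f (ms j) z) atTop (𝓝 (f 0 z))

theorem norm_sum_sub_sum_shift_le {G : Type*} [NormedAddCommGroup G] {u : ℕ → G} {K : ℝ}
    (hu : ∀ m, ‖u m‖ ≤ K) (N l : ℕ) :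
    ‖∑ m ∈ Finset.range N, u m - ∑ m ∈ Finset.range N, u (l + m)‖ ≤ 2 * K * l := by
  induction l with
  | zero => simp
  | succ l ih =>
    have h1 : ∑ m ∈ Finset.range N, u (l + m) - ∑ m ∈ Finset.range N, u (l + 1 + m) =
        u l - u (l + N) := by
      have h2 := Finset.sum_range_sub' (fun m => u (l + m)) N
      rw [add_zero] at h2
      rw [← Finset.sum_sub_distrib, ← h2]
      refine Finset.sum_congr rfl fun m _ => ?_
      rw [add_assoc, add_comm 1 m]
    calc _ = ‖(∑ m ∈ Finset.range N, u m - ∑ m ∈ Finset.range N, u (l + m)) +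
          (u l - u (l + N))‖ := by rw [← h1]; congr 1; abel
      _ ≤ 2 * K * l + (K + K) := (norm_add_le _ _).trans
        (add_le_add ih ((norm_sub_le _ _).trans (add_le_add (hu _) (hu _))))
      _ = _ := by push_cast; ring

theorem tendsto_const_mul_inv_natCast (a : ℝ) :
    Tendsto (fun N : ℕ => a * ((N : ℝ) + 1)⁻¹) atTop (𝓝 0) := by
  simpa using (tendsto_one_div_add_atTop_nhds_zero_nat (𝕜 := ℝ)).const_mul a

/-- The Cesàro average of the first `N + 1` terms. -/
def cesaro (u : ℕ → E) (N : ℕ) : E := ((N : ℝ) + 1)⁻¹ • ∑ m ∈ Finset.range (N + 1), u m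

theorem cesaro_sub (u v : ℕ → E) (N : ℕ) :
    cesaro u N - cesaro v N = cesaro (fun m => u m - v m) N := by
  simp [cesaro, smul_sub, Finset.sum_sub_distrib]

theorem cesaro_const (a : E) (N : ℕ) : cesaro (fun _ => a) N = a := by
  have : ((N : ℝ) + 1) ≠ 0 := by positivity
  rw [cesaro, Finset.sum_const, Finset.card_range, ← Nat.cast_smul_eq_nsmul ℝ, smul_smul]
  push_cast
  rw [inv_mul_cancel₀ this, one_smul]

theorem norm_cesaro_le {u : ℕ → E} {K : ℝ} (hu : ∀ m, ‖u m‖ ≤ K) (N : ℕ) : ‖cesaro u N‖ ≤ K := by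
  have hN : (0 : ℝ) < (N : ℝ) + 1 := by positivity
  rw [cesaro, norm_smul, norm_inv, Real.norm_of_nonneg hN.le, inv_mul_le_iff₀ hN]
  refine (norm_sum_le _ _).trans ((Finset.sum_le_card_nsmul _ _ K fun m _ => hu m).trans ?_)
  simp

theorem map_cesaro {W : Type*} [NormedAddCommGroup W] [NormedSpace ℂ W] (T : E →L[ℂ] W)
    (u : ℕ → E) (N : ℕ) : T (cesaro u N) = cesaro (fun m => T (u m)) N := by
  rw [cesaro, cesaro, ← map_sum, ← Complex.coe_smul, ← Complex.coe_smul, map_smul]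

theorem tendsto_cesaro_sub_shift {u : ℕ → E} {K : ℝ} (hu : ∀ m, ‖u m‖ ≤ K) (l : ℕ) :
    Tendsto (fun N => cesaro u N - cesaro (fun m => u (l + m)) N) atTop (𝓝 0) := by
  refine squeeze_zero_norm (fun N => ?_) (tendsto_const_mul_inv_natCast (2 * K * l))
  have hN : (0 : ℝ) < (N : ℝ) + 1 := by positivity
  rw [cesaro, cesaro, ← smul_sub, norm_smul, norm_inv, Real.norm_of_nonneg hN.le, mul_comm]
  gcongr
  exact norm_sum_sub_sum_shift_le hu _ _

variable {Ω : Set E} {f : ℕ → E → E} {ms : ℕ → ℕ}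

theorem RetractFlow.exists_better_point [FiniteDimensional ℂ E] (h : RetractFlow Ω f ms)
    {x₀ x : E} {R C δ : ℝ} (hR : 0 < R) (hδ : 0 < δ) (hball : ball x₀ R ⊆ Ω)
    (hC : ∀ m, ∀ z ∈ ball x₀ R, ‖f m z‖ ≤ C) (hx : x ∈ ball x₀ (R / 8)) (hδR : 2 * δ ≤ R / 8)
    (hδC : 256 * C * δ ≤ R ^ 2) (hD : ∀ m, ‖f m x - x‖ ≤ δ) :
    ∃ y, ‖y - x‖ ≤ δ ∧ ∀ m, ‖f m y - y‖ ≤ δ / 2 := by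
  have hprop := FiniteDimensional.proper ℂ E
  have hxΩ : x ∈ Ω := hball (ball_subset_ball (by linarith) hx)
  set A : ℕ → E := cesaro fun m => f m x with hA
  have hAx : ∀ N, ‖A N - x‖ ≤ δ := fun N => by
    rw [hA, ← cesaro_const x N, cesaro_sub]
    exact norm_cesaro_le (fun m => by simpa [cesaro_const] using hD m) N
  have hbx : ∀ {y}, ‖y - x‖ ≤ δ → y ∈ ball x (2 * δ) := fun hy => by
    rw [mem_ball, dist_eq_norm]; linarith
  have hC0 : 0 ≤ C := (norm_nonneg _).trans (hC 0 x₀ (mem_ball_self hR))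
  obtain ⟨y, hy, φ, hφ, hlim⟩ := (isCompact_closedBall x δ).tendsto_subseq (x := A)
    fun N => by rw [mem_closedBall, dist_eq_norm]; exact hAx N
  rw [mem_closedBall, dist_eq_norm] at hy
  refine ⟨y, hy, fun l => ?_⟩
  have hyΩ : y ∈ Ω := hball (by
    rw [mem_ball, dist_eq_norm] at *
    calc ‖y - x₀‖ = ‖(y - x) + (x - x₀)‖ := by congr 1; abel
      _ ≤ _ := norm_add_le _ _
      _ < R := by linarith)
  have hfl : Tendsto (fun k => f l (A (φ k))) atTop (𝓝 (f l y)) :=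
    (((h.diff l).differentiableAt (h.isOpen.mem_nhds hyΩ)).continuousAt.tendsto).comp hlim
  have htay : ∀ z, ‖z - x‖ ≤ δ → ‖f l z - f l x - fderiv ℂ (f l) x (z - x)‖ ≤ δ / 4 := by
    intro z hz
    refine (norm_sub_sub_fderiv_le_of_bound hR ((h.diff l).mono hball) (hC l) hx
      (mem_ball_self (by linarith)) (hbx hz) hδR).trans ?_
    calc 32 * C / R ^ 2 * (2 * δ) * ‖z - x‖ ≤ 32 * C / R ^ 2 * (2 * δ) * δ := by gcongr
      _ = (256 * C * δ) / R ^ 2 * (δ / 4) := by ring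
      _ ≤ 1 * (δ / 4) := by
        gcongr
        rw [div_le_one (by positivity)]
        exact hδC
      _ = _ := one_mul _
  have hbdd : ∀ m, ‖f m x‖ ≤ C := fun m => hC m x (ball_subset_ball (by linarith) hx)
  have hshift := (tendsto_cesaro_sub_shift hbdd l).comp hφ.tendsto_atTop
  have hest : ∀ N, ‖f l (A N) - cesaro (fun m => f (l + m) x) N‖ ≤ δ / 2 := by
    intro N
    have h1 : ‖cesaro (fun m => f l (f m x) - f l x - fderiv ℂ (f l) x (f m x - x)) N‖ ≤ δ / 4 :=
      norm_cesaro_le (fun m => htay _ (hD m)) N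
    have h2 : cesaro (fun m => f l (f m x) - f l x - fderiv ℂ (f l) x (f m x - x)) N =
        cesaro (fun m => f (l + m) x) N - f l x - fderiv ℂ (f l) x (A N - x) := by
      rw [← cesaro_sub, ← cesaro_sub, cesaro_const, ← map_cesaro, ← cesaro_sub, cesaro_const]
      simp only [h.add l _ x hxΩ, hA]
    rw [h2] at h1
    calc _ = ‖(f l (A N) - f l x - fderiv ℂ (f l) x (A N - x)) -
          (cesaro (fun m => f (l + m) x) N - f l x - fderiv ℂ (f l) x (A N - x))‖ := by
          congr 1; abel
      _ ≤ δ / 4 + δ / 4 := (norm_sub_le _ _).trans (add_le_add (htay _ (hAx N)) h1)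
      _ = _ := by ring
  have hfin : Tendsto (fun k => f l (A (φ k)) - cesaro (fun m => f (l + m) x) (φ k)) atTop
      (𝓝 (f l y - y)) := by
    have := (hfl.sub hlim).add hshift
    simp only [add_zero, comp_apply] at this
    refine this.congr fun k => ?_
    simp only [hA]
    abel
  exact le_of_tendsto hfin.norm (Eventually.of_forall fun k => hest _)

/-- An almost fixed point of a bounded retract flow is close to a common fixed point. -/
theorem RetractFlow.exists_fixedPoint [FiniteDimensional ℂ E] (h : RetractFlow Ω f ms)
    {x₀ x : E} {R C δ : ℝ} (hR : 0 < R) (hδ : 0 < δ) (hball : ball x₀ R ⊆ Ω)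
    (hC : ∀ m, ∀ z ∈ ball x₀ R, ‖f m z‖ ≤ C) (hx : x ∈ ball x₀ (R / 16)) (hδR : 2 * δ ≤ R / 16)
    (hδC : 256 * C * δ ≤ R ^ 2) (hD : ∀ m, ‖f m x - x‖ ≤ δ) :
    ∃ q, ‖q - x‖ ≤ 2 * δ ∧ ∀ m, f m q = q := by
  have hprop := FiniteDimensional.proper ℂ E
  have hC0 : 0 ≤ C := (norm_nonneg _).trans (hC 0 x₀ (mem_ball_self hR))
  have step : ∀ (k : ℕ) (y : E), ∃ y', (‖y - x‖ ≤ 2 * δ ∧ ∀ m, ‖f m y - y‖ ≤ δ / 2 ^ k) →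
      ‖y' - y‖ ≤ δ / 2 ^ k ∧ ∀ m, ‖f m y' - y'‖ ≤ δ / 2 ^ (k + 1) := by
    intro k y
    by_cases hy : ‖y - x‖ ≤ 2 * δ ∧ ∀ m, ‖f m y - y‖ ≤ δ / 2 ^ k
    · have hle : δ / 2 ^ k ≤ δ := div_le_self hδ.le (one_le_pow₀ (by norm_num))
      obtain ⟨y', h1, h2⟩ := h.exists_better_point (x₀ := x₀) (x := y) (R := R) (C := C)
        (δ := δ / 2 ^ k) hR (by positivity) hball hC (by
          rw [mem_ball, dist_eq_norm] at *
          calc ‖y - x₀‖ = ‖(y - x) + (x - x₀)‖ := by congr 1; abel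
            _ ≤ _ := norm_add_le _ _
            _ < R / 8 := by linarith [hy.1]) (by linarith)
        (le_trans (by gcongr) hδC) hy.2
      refine ⟨y', fun _ => ⟨h1, fun m => (h2 m).trans (le_of_eq ?_)⟩⟩
      rw [pow_succ, div_div]
    · exact ⟨y, fun hy' => absurd hy' hy⟩
  choose nx hnx using step
  let Y : ℕ → E := fun k => Nat.rec x nx k
  have hY : ∀ k, ‖Y k - x‖ ≤ 2 * δ - 2 * δ / 2 ^ k ∧ ∀ m, ‖f m (Y k) - Y k‖ ≤ δ / 2 ^ k := by
    intro k
    induction k with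
    | zero => simpa [Y] using hD
    | succ k ih =>
      have h0 : ‖Y k - x‖ ≤ 2 * δ := ih.1.trans (sub_le_self _ (by positivity))
      obtain ⟨h1, h2⟩ := hnx k (Y k) ⟨h0, ih.2⟩
      refine ⟨?_, h2⟩
      calc ‖Y (k + 1) - x‖ = ‖(Y (k + 1) - Y k) + (Y k - x)‖ := by congr 1; abel
        _ ≤ δ / 2 ^ k + (2 * δ - 2 * δ / 2 ^ k) := (norm_add_le _ _).trans (add_le_add h1 ih.1)
        _ = _ := by rw [pow_succ]; field_simp; ring
  have hY' : ∀ k, ‖Y k - x‖ ≤ 2 * δ := fun k => (hY k).1.trans (sub_le_self _ (by positivity))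
  obtain ⟨q, hq, φ, hφ, hlim⟩ := (isCompact_closedBall x (2 * δ)).tendsto_subseq (x := Y)
    fun k => by rw [mem_closedBall, dist_eq_norm]; exact hY' k
  rw [mem_closedBall, dist_eq_norm] at hq
  have hqΩ : q ∈ Ω := hball (by
    rw [mem_ball, dist_eq_norm] at *
    calc ‖q - x₀‖ = ‖(q - x) + (x - x₀)‖ := by congr 1; abel
      _ ≤ _ := norm_add_le _ _
      _ < R := by linarith)
  refine ⟨q, hq, fun m => ?_⟩
  have h1 : Tendsto (fun k => f m (Y (φ k)) - Y (φ k)) atTop (𝓝 (f m q - q)) :=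
    ((((h.diff m).differentiableAt (h.isOpen.mem_nhds hqΩ)).continuousAt.tendsto).comp hlim).sub
      hlim
  have h2 : Tendsto (fun k => f m (Y (φ k)) - Y (φ k)) atTop (𝓝 0) := by
    refine squeeze_zero_norm (fun k => (hY (φ k)).2 m) ?_
    have : Tendsto (fun k : ℕ => δ / 2 ^ k) atTop (𝓝 0) :=
      tendsto_const_nhds.div_atTop (tendsto_pow_atTop_atTop_of_one_lt (by norm_num))
    exact this.comp hφ.tendsto_atTop
  exact sub_eq_zero.1 (tendsto_nhds_unique h1 h2)

end RetractFlow

section FixedPoint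

variable {E : Type*} [NormedAddCommGroup E] [NormedSpace ℂ E]

/-- An eigenvalue of modulus one persists under perturbations of a semigroup of operators
which are uniformly small in time. -/
theorem exists_eigenvector_of_near [FiniteDimensional ℂ E] {D D' : ℕ → E →L[ℂ] E}
    (hD' : ∀ l m, D' l ∘L D' m = D' (l + m)) (hclose : ∀ m, ‖D' m - D m‖ ≤ 1 / 2)
    {v : E} {μ : ℂ} (hμ : ‖μ‖ = 1) (hv : v ≠ 0) (hDv : ∀ m, D m v = μ ^ m • v) :
    ∃ u, u ≠ 0 ∧ D' 1 u = μ • u := by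
  have hprop := FiniteDimensional.proper ℂ E
  have hμ0 : μ ≠ 0 := by rintro rfl; simp at hμ
  set w : ℕ → E := fun m => (μ ^ m)⁻¹ • D' m v with hw
  have hwv : ∀ m, ‖w m - v‖ ≤ 1 / 2 * ‖v‖ := by
    intro m
    have h1 : w m - v = (μ ^ m)⁻¹ • ((D' m - D m) v) := by
      rw [sub_apply, hDv, smul_sub, smul_smul,
        inv_mul_cancel₀ (pow_ne_zero _ hμ0), one_smul]
    rw [h1, norm_smul, norm_inv, norm_pow, hμ, one_pow, inv_one, one_mul]
    exact (ContinuousLinearMap.le_opNorm _ _).trans (by gcongr; exact hclose m)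
  have hwb : ∀ m, ‖w m‖ ≤ 2 * ‖v‖ := fun m => by
    calc ‖w m‖ = ‖(w m - v) + v‖ := by simp
      _ ≤ 1 / 2 * ‖v‖ + ‖v‖ := (norm_add_le _ _).trans (by gcongr; exact hwv m)
      _ ≤ _ := by linarith [norm_nonneg v]
  have hstep : ∀ m, D' 1 (w m) = μ • w (1 + m) := by
    intro m
    simp only [hw, map_smul, ← ContinuousLinearMap.comp_apply, hD', smul_smul]
    congr 1
    rw [pow_add, pow_one]
    field_simp
  have hcv : ∀ N, ‖cesaro w N - v‖ ≤ 1 / 2 * ‖v‖ := fun N => by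
    rw [← cesaro_const v N, cesaro_sub]
    simpa [cesaro_const] using norm_cesaro_le hwv N
  obtain ⟨u, hu, φ, hφ, hlim⟩ := (isCompact_closedBall v (1 / 2 * ‖v‖)).tendsto_subseq
    (x := cesaro w) fun N => by rw [mem_closedBall, dist_eq_norm]; exact hcv N
  rw [mem_closedBall, dist_eq_norm] at hu
  refine ⟨u, ?_, ?_⟩
  · rintro rfl
    rw [zero_sub, norm_neg] at hu
    linarith [norm_pos_iff.2 hv]
  · have h1 : Tendsto (fun k => D' 1 (cesaro w (φ k))) atTop (𝓝 (D' 1 u)) :=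
      ((D' 1).continuous.tendsto u).comp hlim
    have h2 := (hlim.sub ((tendsto_cesaro_sub_shift hwb 1).comp hφ.tendsto_atTop)).const_smul μ
    refine tendsto_nhds_unique h1 ((h2.congr fun k => ?_).trans (by simp))
    simp only [comp_apply, sub_sub_cancel, map_cesaro, hstep]
    have : (fun m => μ • w (1 + m)) = fun m => (μ • ContinuousLinearMap.id ℂ E) (w (1 + m)) := by
      ext; simp
    rw [this, ← map_cesaro]
    simp

variable {Ω : Set E} {f : ℕ → E → E} {ms : ℕ → ℕ} {q : E}

theorem RetractFlow.fderiv_comp_fderiv (h : RetractFlow Ω f ms) (hq : q ∈ Ω) (hfix : ∀ m, f m q = q)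
    (l m : ℕ) : fderiv ℂ (f l) q ∘L fderiv ℂ (f m) q = fderiv ℂ (f (l + m)) q := by
  have hd : ∀ m, DifferentiableAt ℂ (f m) q := fun m =>
    (h.diff m).differentiableAt (h.isOpen.mem_nhds hq)
  have h1 : fderiv ℂ (f l ∘ f m) q = _ :=
    fderiv_comp q (by rw [hfix]; exact hd l) (hd m)
  rw [hfix] at h1
  rw [← h1]
  refine Filter.EventuallyEq.fderiv_eq ?_
  filter_upwards [h.isOpen.mem_nhds hq] with z hz
  exact h.add l m z hz

theorem RetractFlow.exists_bound (h : RetractFlow Ω f ms) :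
    ∃ C, 0 < C ∧ ∀ m, ∀ z ∈ Ω, ‖f m z‖ ≤ C := by
  obtain ⟨C, hC0, hC⟩ := h.bdd.exists_pos_norm_le
  exact ⟨C, hC0, fun m z hz => hC _ (h.maps m hz)⟩

theorem RetractFlow.exists_fderiv_bound (h : RetractFlow Ω f ms) (hq : q ∈ Ω) :
    ∃ K, 0 < K ∧ ∀ m, ‖fderiv ℂ (f m) q‖ ≤ K := by
  obtain ⟨C, hC0, hC⟩ := h.exists_bound
  obtain ⟨R, hR, hball⟩ := Metric.isOpen_iff.1 h.isOpen q hq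
  exact ⟨2 * C / R, by positivity, fun m => norm_fderiv_le_of_bound hR ((h.diff m).mono hball)
    fun z hz => hC m z (hball hz)⟩

/-- Uniform first order Taylor estimate at a point of the domain. -/
theorem RetractFlow.exists_taylor_bound (h : RetractFlow Ω f ms) (hq : q ∈ Ω) :
    ∃ K ρ, 0 < K ∧ 0 < ρ ∧ ball q ρ ⊆ Ω ∧ ∀ δ ≤ ρ, ∀ x ∈ ball q δ, ∀ y ∈ ball q δ, ∀ m,
      ‖f m y - f m x - fderiv ℂ (f m) q (y - x)‖ ≤ K * δ * ‖y - x‖ := by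
  obtain ⟨C, hC0, hC⟩ := h.exists_bound
  obtain ⟨R, hR, hball⟩ := Metric.isOpen_iff.1 h.isOpen q hq
  exact ⟨32 * C / R ^ 2, R / 8, by positivity, by positivity,
    (ball_subset_ball (by linarith)).trans hball, fun δ hδ x hx y hy m =>
    norm_sub_sub_fderiv_le_of_bound hR ((h.diff m).mono hball) (fun z hz => hC m z (hball hz))
      (mem_ball_self (by positivity)) hx hy hδ⟩

/-- A vector killed in the limit by the derivatives of the flow is killed by the retraction. -/
theorem RetractFlow.fderiv_zero_eq_zero (h : RetractFlow Ω f ms) (hq : q ∈ Ω)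
    (hfix : ∀ m, f m q = q) {v : E}
    (hv : Tendsto (fun m => fderiv ℂ (f m) q v) atTop (𝓝 0)) : fderiv ℂ (f 0) q v = 0 := by
  obtain ⟨K, ρ, hK, hρ, hball, htay⟩ := h.exists_taylor_bound hq
  by_contra hne
  have hv0 : v ≠ 0 := by rintro rfl; simp at hne
  have hn := norm_pos_iff.2 hv0
  have hN := norm_pos_iff.2 hne
  have key : ∀ τ : ℝ, 0 < τ → 2 * τ * ‖v‖ ≤ ρ →
      ‖fderiv ℂ (f 0) q v‖ ≤ 4 * K * τ * ‖v‖ ^ 2 := by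
    intro τ hτ hτρ
    have hmem : q + τ • v ∈ ball q (2 * τ * ‖v‖) := by
      rw [mem_ball, dist_eq_norm, add_sub_cancel_left, norm_smul, Real.norm_of_nonneg hτ.le]
      nlinarith [mul_pos hτ hn]
    have ht := fun m => htay _ hτρ q (mem_ball_self (by positivity)) _ hmem m
    simp only [hfix, add_sub_cancel_left] at ht
    have hsm : ∀ m, fderiv ℂ (f m) q (τ • v) = τ • fderiv ℂ (f m) q v := fun m => by
      rw [← Complex.coe_smul, map_smul, Complex.coe_smul]
    have hlim : Tendsto (fun j => f (ms j) (q + τ • v) - q - fderiv ℂ (f (ms j)) q (τ • v))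
        atTop (𝓝 (f 0 (q + τ • v) - q - τ • (0 : E))) := by
      refine ((h.tendsto _ (hball (ball_subset_ball hτρ hmem))).sub_const q).sub ?_
      simp only [hsm]
      exact (hv.comp h.ms_tendsto).const_smul τ
    have h1 := le_of_tendsto hlim.norm (Eventually.of_forall fun j => ht (ms j))
    have h2 := ht 0
    have h3 : ‖τ • fderiv ℂ (f 0) q v‖ ≤ 2 * (K * (2 * τ * ‖v‖) * ‖τ • v‖) := by
      calc _ = ‖(f 0 (q + τ • v) - q - τ • (0 : E)) -
            (f 0 (q + τ • v) - q - fderiv ℂ (f 0) q (τ • v))‖ := by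
            rw [hsm]; congr 1; simp
        _ ≤ _ := (norm_sub_le _ _).trans (by linarith)
    rw [norm_smul, norm_smul, Real.norm_of_nonneg hτ.le] at h3
    refine le_of_mul_le_mul_left (h3.trans (le_of_eq ?_)) hτ
    ring
  set τ := min (ρ / (2 * ‖v‖)) (‖fderiv ℂ (f 0) q v‖ / (8 * K * ‖v‖ ^ 2)) with hτ
  have h1 : τ ≤ ρ / (2 * ‖v‖) := min_le_left _ _
  have h2 : τ ≤ ‖fderiv ℂ (f 0) q v‖ / (8 * K * ‖v‖ ^ 2) := min_le_right _ _
  rw [le_div_iff₀ (by positivity)] at h1 h2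
  have := key τ (by positivity) (by linarith)
  linarith

theorem RetractFlow.norm_eigenvalue_eq_one (h : RetractFlow Ω f ms) (hq : q ∈ Ω)
    (hfix : ∀ m, f m q = q) {v : E} (hv : v ≠ 0) {μ : ℂ} (hμ : μ ≠ 0)
    (hev : fderiv ℂ (f 1) q v = μ • v) :
    ‖μ‖ = 1 ∧ ∀ m, fderiv ℂ (f m) q v = μ ^ m • v := by
  have h0 : fderiv ℂ (f 0) q v = v := by
    have h1 := congrArg (fun T => T v) (h.fderiv_comp_fderiv hq hfix 0 1)
    simp only [ContinuousLinearMap.comp_apply, hev, map_smul, zero_add] at h1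
    exact smul_right_injective E hμ h1
  have hm : ∀ m, fderiv ℂ (f m) q v = μ ^ m • v := by
    intro m
    induction m with
    | zero => simpa using h0
    | succ m ih =>
      rw [← h.fderiv_comp_fderiv hq hfix m 1, ContinuousLinearMap.comp_apply, hev, map_smul, ih,
        smul_smul, pow_succ']
  refine ⟨le_antisymm ?_ ?_, hm⟩
  · by_contra! hlt
    obtain ⟨K, -, hK⟩ := h.exists_fderiv_bound hq
    obtain ⟨m, hm'⟩ := ((tendsto_pow_atTop_atTop_of_one_lt hlt).eventually_gt_atTop K).exists
    have h1 := ((fderiv ℂ (f m) q).le_opNorm v).trans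
      (mul_le_mul_of_nonneg_right (hK m) (norm_nonneg v))
    rw [hm, norm_smul, norm_pow] at h1
    exact absurd (le_of_mul_le_mul_right h1 (norm_pos_iff.2 hv)) (not_le.2 hm')
  · by_contra! hlt
    refine hv (h0 ▸ h.fderiv_zero_eq_zero hq hfix (v := v) ?_)
    simp only [hm]
    simpa using (tendsto_pow_atTop_nhds_zero_of_norm_lt_one hlt).smul_const v

/-- A power bounded operator all of whose eigenvalues equal one is the identity. -/
theorem eq_one_of_bounded_of_eigenvalue [FiniteDimensional ℂ E] {T : E →L[ℂ] E} {K : ℝ}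
    (hT : ∀ m, ‖T ^ m‖ ≤ K) (hev : ∀ v, v ≠ 0 → ∀ μ : ℂ, T v = μ • v → μ = 1) : T = 1 := by
  have hker : ∀ x, T (T x - x) = T x - x → T x = x := by
    intro x hx
    set y := T x - x with hy
    have hpow : ∀ m : ℕ, (T ^ m) x = x + (m : ℂ) • y := by
      intro m
      induction m with
      | zero => simp
      | succ m ih =>
        rw [pow_succ', mul_apply_eq_comp, ih, map_add, map_smul, hx]
        have : T x = x + y := by rw [hy]; abel
        rw [this, Nat.cast_succ, add_smul, one_smul]
        abel
    by_contra hne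
    have hy0 : 0 < ‖y‖ := norm_pos_iff.2 (sub_ne_zero.2 hne)
    obtain ⟨m, hm⟩ := exists_nat_gt ((K * ‖x‖ + ‖x‖) / ‖y‖)
    rw [div_lt_iff₀ hy0] at hm
    have h1 := ((T ^ m).le_opNorm x).trans (mul_le_mul_of_nonneg_right (hT m) (norm_nonneg x))
    have h2 : (m : ℂ) • y = (T ^ m) x - x := by rw [hpow]; simp
    have h3 := congrArg norm h2
    rw [norm_smul, Complex.norm_natCast] at h3
    linarith [norm_sub_le ((T ^ m) x) x]
  have hgen : ∀ k : ℕ, ∀ x, (((T : E →ₗ[ℂ] E) - algebraMap ℂ (Module.End ℂ E) 1) ^ k) x = 0 →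
      T x = x := by
    intro k
    induction k with
    | zero => intro x hx; simp at hx; simp [hx]
    | succ k ih =>
      intro x hx
      rw [pow_succ, Module.End.mul_apply] at hx
      have := ih _ hx
      refine hker x ?_
      simpa using this
  have htop := Module.End.iSup_maxGenEigenspace_eq_top (T : E →ₗ[ℂ] E)
  have hle : (⨆ μ : ℂ, Module.End.maxGenEigenspace (T : E →ₗ[ℂ] E) μ) ≤
      LinearMap.ker ((T : E →ₗ[ℂ] E) - LinearMap.id) := by
    refine iSup_le fun μ => ?_
    by_cases hμ : μ = 1
    · subst hμ
      intro x hx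
      rw [Module.End.mem_maxGenEigenspace] at hx
      obtain ⟨k, hk⟩ := hx
      rw [LinearMap.mem_ker]
      simp [hgen k x (by simpa [Algebra.algebraMap_eq_smul_one] using hk)]
    · have hno : ¬ Module.End.HasEigenvalue (T : E →ₗ[ℂ] E) μ := by
        intro hE
        obtain ⟨v, hv⟩ := hE.exists_hasEigenvector
        exact hμ (hev v hv.2 μ (by simpa using hv.apply_eq_smul))
      have : Module.End.maxGenEigenspace (T : E →ₗ[ℂ] E) μ = ⊥ := by
        by_contra hbot
        refine hno ?_
        rw [Module.End.hasEigenvalue_iff]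
        intro he
        refine hbot ?_
        rw [eq_bot_iff]
        intro x hx
        rw [Module.End.mem_maxGenEigenspace] at hx
        obtain ⟨k, hk⟩ := hx
        have hinj : Injective ((T : E →ₗ[ℂ] E) - μ • (1 : Module.End ℂ E)) := by
          rw [← LinearMap.ker_eq_bot]
          simpa [Module.End.eigenspace_def, Algebra.algebraMap_eq_smul_one] using he
        have hinj' : Injective ((((T : E →ₗ[ℂ] E) - μ • (1 : Module.End ℂ E)) ^ k)) := by
          rw [Module.End.coe_pow]
          exact hinj.iterate k
        exact hinj' (by simpa using hk)
      rw [this]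
      exact bot_le
  ext x
  have : x ∈ LinearMap.ker ((T : E →ₗ[ℂ] E) - LinearMap.id) :=
    hle (by rw [htop]; trivial)
  rw [LinearMap.mem_ker] at this
  simpa [sub_eq_zero] using this

theorem RetractFlow.fderiv_one_eq [FiniteDimensional ℂ E] (h : RetractFlow Ω f ms) (hq : q ∈ Ω)
    (hfix : ∀ m, f m q = q)
    (hev : ∀ v, v ≠ 0 → ∀ μ : ℂ, μ ≠ 0 → fderiv ℂ (f 1) q v = μ • v → μ = 1) (m : ℕ) :
    fderiv ℂ (f m) q = fderiv ℂ (f 0) q := by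
  set D : ℕ → E →L[ℂ] E := fun m => fderiv ℂ (f m) q with hD
  have hcomp : ∀ l m, D l * D m = D (l + m) := h.fderiv_comp_fderiv hq hfix
  obtain ⟨K, hK0, hK⟩ := h.exists_fderiv_bound hq
  set T : E →L[ℂ] E := D 1 + 1 - D 0 with hT
  have hpow : ∀ m, T ^ m = D m + 1 - D 0 := by
    intro m
    induction m with
    | zero => simp
    | succ m ih =>
      rw [pow_succ, ih, hT]
      simp only [mul_sub, mul_add, sub_mul, add_mul, hcomp, mul_one, one_mul, zero_add, add_zero]
      abel
  have h1 : T = 1 := by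
    refine eq_one_of_bounded_of_eigenvalue (K := K + ‖(1 : E →L[ℂ] E)‖ + K) (fun m => ?_) ?_
    · rw [hpow]
      exact (norm_sub_le _ _).trans (add_le_add ((norm_add_le _ _).trans
        (by gcongr; exact hK m)) (hK 0))
    · intro v hv μ hvμ
      have e0 : ∀ m, D 0 (D m v) = D m v := fun m => by
        rw [← mul_apply_eq_comp, hcomp, zero_add]
      have e1 : D 1 v + v - D 0 v = μ • v := by simpa [hT] using hvμ
      have e2 : D 1 v = μ • D 0 v := by
        have := congrArg (D 0) e1
        simpa [e0] using this
      by_cases hvv : D 0 v = v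
      · rw [hvv] at e2
        refine hev v hv μ ?_ e2
        rintro rfl
        have hz : ∀ m, D (m + 1) v = 0 := fun m => by
          rw [← hcomp, mul_apply_eq_comp, e2]; simp
        have := h.fderiv_zero_eq_zero hq hfix (v := v) (by
          rw [← tendsto_add_atTop_iff_nat 1]
          exact tendsto_const_nhds.congr fun m => (hz m).symm)
        exact hv (hvv.symm.trans this)
      · have e3 : (μ - 1) • (v - D 0 v) = 0 := by
          rw [e2] at e1
          rw [sub_smul, one_smul, smul_sub, ← e1]
          abel
        rcases smul_eq_zero.1 e3 with h0 | h0
        · exact sub_eq_zero.1 h0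
        · exact absurd (sub_eq_zero.1 h0).symm hvv
  have h2 := hpow m
  rw [h1, one_pow] at h2
  have : D m - D 0 = 0 := by
    calc D m - D 0 = (D m + 1 - D 0) - 1 := by abel
      _ = 0 := by rw [← h2, sub_self]
  exact sub_eq_zero.1 this

/-- If all derivatives of the flow at a fixed point agree, the flow is stationary nearby. -/
theorem RetractFlow.eventually_eq (h : RetractFlow Ω f ms) (hq : q ∈ Ω)
    (hfix : ∀ m, f m q = q) (hder : ∀ m, fderiv ℂ (f m) q = fderiv ℂ (f 0) q) :
    ∀ᶠ z in 𝓝 q, f 1 z = f 0 z := by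
  obtain ⟨K, ρ, hK, hρ, hball, htay⟩ := h.exists_taylor_bound hq
  obtain ⟨C, hC0, hC⟩ := h.exists_bound
  set δ := min ρ (1 / (4 * K)) with hδ
  have hδ0 : 0 < δ := by positivity
  have hδK : 2 * (K * δ) < 1 := by
    have : δ ≤ 1 / (4 * K) := min_le_right _ _
    rw [le_div_iff₀ (by positivity)] at this
    linarith
  have hcont : ∀ m, ∀ᶠ z in 𝓝 q, f m z ∈ ball q δ := fun m => by
    have := ((h.diff m).differentiableAt (h.isOpen.mem_nhds hq)).continuousAt.tendsto
    rw [hfix] at this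
    exact this (ball_mem_nhds q hδ0)
  filter_upwards [hcont 0, hcont 1, h.isOpen.mem_nhds hq] with z hz0 hz1 hzΩ
  set D := fderiv ℂ (f 0) q with hD
  set x := f 0 z with hx
  set x' := f 1 z with hx'
  have hT : ∀ m, ‖(f m x' - f m x) - D (x' - x)‖ ≤ K * δ * ‖x' - x‖ := fun m => by
    rw [← hder m]
    exact htay δ (min_le_left _ _) x hz0 x' hz1 m
  have h0 : f 0 x' - f 0 x = x' - x := by
    rw [hx, hx', h.add _ _ _ hzΩ, h.add _ _ _ hzΩ]
  have h1 : ‖D (x' - x)‖ ≤ K * δ * ‖x' - x‖ := by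
    have hces : Tendsto (fun N => cesaro (fun m => f m x' - f m x) N - D (x' - x)) atTop
        (𝓝 (-0 - D (x' - x))) := by
      refine Tendsto.sub_const ?_ _
      refine (tendsto_cesaro_sub_shift (fun m => hC m z hzΩ) 1).neg.congr fun N => ?_
      rw [neg_sub, cesaro_sub]
      congr 1
      ext m
      rw [hx, hx', h.add _ _ _ hzΩ, h.add _ _ _ hzΩ, add_comm 1 m, add_zero]
    have := le_of_tendsto hces.norm (Eventually.of_forall fun N => by
      rw [← cesaro_const (D (x' - x)) N, cesaro_sub]
      exact norm_cesaro_le (fun m => by simpa [cesaro_const] using hT m) N)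
    rwa [neg_zero, zero_sub, norm_neg] at this
  have h2 := hT 0
  rw [h0] at h2
  by_contra hne
  have hpos : 0 < ‖x' - x‖ := norm_pos_iff.2 (sub_ne_zero.2 hne)
  have h3 : ‖x' - x‖ ≤ ‖(x' - x) - D (x' - x)‖ + ‖D (x' - x)‖ := by
    calc ‖x' - x‖ = ‖((x' - x) - D (x' - x)) + D (x' - x)‖ := by simp
      _ ≤ _ := norm_add_le _ _
  nlinarith

end FixedPoint

section Returns

variable {E : Type*} [NormedAddCommGroup E] [NormedSpace ℂ E]
  {Ω : Set E} {f : ℕ → E → E} {ms : ℕ → ℕ}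

/-- The return times of a recurrent point of a retract flow are syndetic. -/
theorem RetractFlow.exists_syndetic_return [FiniteDimensional ℂ E] (h : RetractFlow Ω f ms) {x : E}
    (hx : x ∈ Ω) (hfx : f 0 x = x) {ε : ℝ} (hε : 0 < ε) :
    ∃ L : ℕ, ∀ m, ∃ l ≤ L, ‖f (m + l) x - x‖ ≤ ε := by
  have hprop := FiniteDimensional.proper ℂ E
  obtain ⟨C, hC0, hC⟩ := h.exists_bound
  obtain ⟨R, hR, hball⟩ := Metric.isOpen_iff.1 h.isOpen x hx
  set K : ℝ := 4 * C / R with hK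
  have hK0 : 0 < K := by positivity
  have hlip : ∀ m, ∀ y ∈ ball x (R / 2), ∀ z ∈ ball x (R / 2), ‖f m y - f m z‖ ≤ K * ‖y - z‖ :=
    fun m y hy z hz => norm_sub_le_of_bound hR ((h.diff m).mono hball)
      (fun w hw => hC m w (hball hw)) hz hy
  set ρ := min ε (R / 4) with hρ
  have hρ0 : 0 < ρ := by positivity
  have hρR : ρ ≤ R / 4 := min_le_right _ _
  have hadd : ∀ l m, f l (f m x) = f (l + m) x := fun l m => h.add l m x hx
  let Near : ℝ → ℕ → Prop := fun δ j => ∀ l, ‖f (l + j) x - f l x‖ ≤ δ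
  have hcancel : ∀ (δ : ℝ) (a j : ℕ), (∀ l, ‖f (l + (a + j)) x - f (l + a) x‖ ≤ δ) → Near δ j := by
    intro δ a j haj l
    have ht : ∀ i, Tendsto (fun k => f (ms k + i) x) atTop (𝓝 (f i x)) := fun i => by
      have := h.tendsto _ (h.maps i hx)
      simpa [hadd] using this
    refine le_of_tendsto ((ht (l + j)).sub (ht l)).norm ?_
    filter_upwards [h.ms_tendsto.eventually_ge_atTop a] with k hk
    have := haj (ms k - a + l)
    rwa [show ms k - a + l + (a + j) = ms k + (l + j) by omega,
      show ms k - a + l + a = ms k + l by omega] at this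
  have hreturn : ∀ δ : ℝ, 0 < δ → ∀ N : ℕ, ∃ n ≥ N, Near δ n := by
    intro δ hδ N
    have h1 := h.tendsto x hx
    rw [hfx] at h1
    have h2 := h1.eventually (ball_mem_nhds x (show 0 < min (R / 2) (δ / K) by positivity))
    obtain ⟨k, hk, hk'⟩ := (h2.and (h.ms_tendsto.eventually_ge_atTop N)).exists
    refine ⟨ms k, hk', fun l => ?_⟩
    change f (ms k) x ∈ ball _ _ at hk
    rw [mem_ball, dist_eq_norm, lt_min_iff] at hk
    have h3 := hlip l (f (ms k) x) (by rw [mem_ball, dist_eq_norm]; exact hk.1) x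
      (mem_ball_self (by positivity))
    rw [hadd] at h3
    have h4 := hk.2
    rw [lt_div_iff₀ hK0] at h4
    linarith
  obtain ⟨n, hn1, hn⟩ := hreturn (ρ / 2) (by positivity) 1
  have hNx : ∀ b, Near ρ b → ‖f b x - x‖ ≤ ρ := fun b hb => by
    simpa [hfx] using hb 0
  have hNball : ∀ b, Near ρ b → f b x ∈ ball x (R / 2) := fun b hb => by
    rw [mem_ball, dist_eq_norm]; linarith [hNx b hb]
  set S : Set E := (fun b => f b x) '' {b | Near ρ b} with hS
  have hSb : Bornology.IsBounded S := (isBounded_ball (x := x) (r := R / 2)).subset (by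
    rintro _ ⟨b, hb, rfl⟩; exact hNball b hb)
  obtain ⟨t, htS, htf, hcov⟩ := Metric.finite_approx_of_totallyBounded
    (hSb.isCompact_closure.totallyBounded.subset subset_closure)
    (ρ / (2 * K)) (by positivity)
  have hch : ∀ y, ∃ b, y ∈ t → Near ρ b ∧ f b x = y := fun y => by
    by_cases hy : y ∈ t
    · obtain ⟨b, hb, hby⟩ := htS hy
      exact ⟨b, fun _ => ⟨hb, hby⟩⟩
    · exact ⟨0, fun hy' => absurd hy' hy⟩
  choose g hg using hch
  obtain ⟨L₀, hL₀⟩ := (htf.image g).bddAbove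
  have hstep : ∀ b, Near ρ b → L₀ + n ≤ b → ∃ b' < b, b ≤ b' + (L₀ + n) ∧ Near ρ b' := by
    intro b hb hLb
    obtain ⟨y, hy, hby⟩ := mem_iUnion₂.1 (hcov ⟨b, hb, rfl⟩)
    obtain ⟨hgy, hgy'⟩ := hg y hy
    have hgL : g y ≤ L₀ := hL₀ ⟨y, hy, rfl⟩
    refine ⟨b - (g y + n), by omega, by omega, hcancel ρ (g y + n) _ fun l => ?_⟩
    rw [show g y + n + (b - (g y + n)) = b by omega]
    rw [mem_ball, dist_eq_norm, ← hgy', lt_div_iff₀ (by positivity)] at hby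
    have h1 := hlip l _ (hNball b hb) _ (hNball _ hgy)
    rw [hadd, hadd] at h1
    have h2 := hn (l + g y)
    rw [show l + g y + n = l + (g y + n) by ring] at h2
    calc _ = ‖(f (l + b) x - f (l + g y) x) - (f (l + (g y + n)) x - f (l + g y) x)‖ := by
          congr 1; abel
      _ ≤ ρ / 2 + ρ / 2 := (norm_sub_le _ _).trans (add_le_add (by linarith) h2)
      _ = ρ := by ring
  have hdesc : ∀ b, Near ρ b → ∀ m ≤ b, ∃ v, m ≤ v ∧ v ≤ m + (L₀ + n) ∧ Near ρ v := by
    intro b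
    induction b using Nat.strong_induction_on with
    | _ b ih =>
      intro hb m hm
      by_cases hbm : b ≤ m + (L₀ + n)
      · exact ⟨b, hm, hbm, hb⟩
      · obtain ⟨b', hb', hbb', hnear⟩ := hstep b hb (by omega)
        exact ih b' hb' hnear m (by omega)
  refine ⟨L₀ + n, fun m => ?_⟩
  obtain ⟨b, hbm, hb⟩ := hreturn ρ hρ0 m
  obtain ⟨v, hmv, hvL, hv⟩ := hdesc b hb m hbm
  refine ⟨v - m, by omega, ?_⟩
  rw [show m + (v - m) = v by omega]
  exact (hNx v hv).trans (min_le_left _ _)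

end Returns

section Identity

variable {E : Type*} [NormedAddCommGroup E] [NormedSpace ℂ E]

/-- The identity theorem for holomorphic maps on a preconnected open set. -/
theorem eqOn_of_eventuallyEq_of_differentiableOn {W : Type*} [NormedAddCommGroup W]
    [NormedSpace ℂ W] [CompleteSpace W] {Ω : Set E} (hΩ : IsOpen Ω) (hc : IsPreconnected Ω)
    {f g : E → W}
    (hf : DifferentiableOn ℂ f Ω) (hg : DifferentiableOn ℂ g Ω) {q : E} (hq : q ∈ Ω)
    (heq : ∀ᶠ z in 𝓝 q, f z = g z) : ∀ z ∈ Ω, f z = g z := by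
  set U : Set E := {z | ∀ᶠ w in 𝓝 z, f w = g w} with hU
  have hUo : IsOpen U := isOpen_setOfPred_eventually_nhds
  have hkey : ∀ z ∈ Ω, ∀ R, 0 < R → ball z R ⊆ Ω → ∀ u ∈ U, u ∈ ball z R → z ∈ U := by
    intro z hz R hR hball u hu huz
    refine mem_of_superset (ball_mem_nhds z hR) fun w hw => ?_
    -- restrict to the complex line through `u` and `w`
    set γ : ℂ → E := fun ζ => u + ζ • (w - u) with hγ
    have hγd : Differentiable ℂ γ := by fun_prop
    set V : Set ℂ := γ ⁻¹' ball z R with hV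
    have hVo : IsOpen V := isOpen_ball.preimage hγd.continuous
    have hVc : IsPreconnected V := by
      refine Convex.isPreconnected ?_
      intro a ha b hb s t hs ht hst
      have h1 : γ (s • a + t • b) = s • γ a + t • γ b := by
        calc γ (s • a + t • b) = (s + t) • u + (s • a • (w - u) + t • b • (w - u)) := by
              simp only [hγ, add_smul (s • a), smul_assoc, hst, one_smul]
          _ = _ := by
              simp only [hγ, smul_add, add_smul]
              abel
      rw [hV, mem_preimage, h1]
      exact (convex_ball z R) ha hb hs ht hst
    have hmaps : MapsTo γ V Ω := fun ζ hζ => hball hζ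
    have hfa : AnalyticOnNhd ℂ (f ∘ γ) V :=
      (hf.comp hγd.differentiableOn hmaps).analyticOnNhd hVo
    have hga : AnalyticOnNhd ℂ (g ∘ γ) V :=
      (hg.comp hγd.differentiableOn hmaps).analyticOnNhd hVo
    have h0 : (0 : ℂ) ∈ V := by simpa [hV, hγ] using huz
    have h1 : (1 : ℂ) ∈ V := by simpa [hV, hγ] using hw
    have hnear : (f ∘ γ) =ᶠ[𝓝 0] (g ∘ γ) := by
      have : Tendsto γ (𝓝 0) (𝓝 u) := by
        have := hγd.continuous.tendsto 0
        simpa [hγ] using this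
      exact this.eventually hu
    have := hfa.eqOn_of_preconnected_of_eventuallyEq hga hVc h0 hnear h1
    simpa [hγ] using this
  have hsub : Ω ⊆ U := by
    refine hc.subset_of_closure_inter_subset hUo ⟨q, hq, heq⟩ ?_
    rintro z ⟨hzU, hzΩ⟩
    obtain ⟨R, hR, hball⟩ := Metric.isOpen_iff.1 hΩ z hzΩ
    obtain ⟨u, huz, hu⟩ := mem_closure_iff.1 hzU (ball z R) isOpen_ball (mem_ball_self hR)
    exact hkey z hzΩ R hR hball u hu huz
  exact fun z hz => (hsub hz).self_of_nhds

end Identity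

/-- Eventual smallness of linear functions at zero. -/
theorem eventually_mul_lt_nhdsGT (a : ℝ) {b : ℝ} (hb : 0 < b) : ∀ᶠ ε in 𝓝[>] (0 : ℝ), a * ε < b := by
  have h : Tendsto (fun ε : ℝ => a * ε) (𝓝 0) (𝓝 (a * 0)) := tendsto_id.const_mul a
  rw [mul_zero] at h
  exact (h.mono_left nhdsWithin_le_nhds).eventually (gt_mem_nhds hb)

/-- A preconnected set meeting an open set and its complement meets its frontier. -/
theorem IsPreconnected.exists_mem_frontier {X : Type*} [TopologicalSpace X] {S U : Set X}
    (hS : IsPreconnected S) (hU : IsOpen U) {x y : X} (hx : x ∈ S) (hxU : x ∈ U) (hy : y ∈ S)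
    (hyU : y ∉ U) : ∃ z ∈ S, z ∈ frontier U := by
  by_contra! h
  have hcov : S ⊆ U ∪ (closure U)ᶜ := by
    intro z hz
    by_cases hzU : z ∈ U
    · exact Or.inl hzU
    · refine Or.inr fun hzc => h z hz ?_
      rw [hU.frontier_eq]
      exact ⟨hzc, hzU⟩
  obtain ⟨z, -, hz1, hz2⟩ := hS U (closure U)ᶜ hU isClosed_closure.isOpen_compl hcov ⟨x, hx, hxU⟩
    ⟨y, hy, (hcov hy).resolve_left hyU⟩
  exact hz2 (subset_closure hz1)

theorem norm_one_sub_sq (u : ℂ) : ‖1 - u‖ ^ 2 = 1 - 2 * u.re + ‖u‖ ^ 2 := by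
  rw [Complex.sq_norm, Complex.sq_norm, Complex.normSq_apply, Complex.normSq_apply]
  simp
  ring

theorem norm_one_sub_sq_le {ζ : ℂ} (hζ : ‖ζ‖ ≤ 1) : ‖1 - ζ‖ ^ 2 ≤ 2 * (1 - ζ).re := by
  have h3 : ‖ζ‖ ^ 2 ≤ 1 := pow_le_one₀ (norm_nonneg _) hζ
  rw [norm_one_sub_sq, sub_re, one_re]
  linarith

theorem norm_one_sub_bounds {u : ℂ} {x : ℝ} (hx : 0 < x) (hx' : x ≤ 2 / 9) (hn : ‖u‖ ≤ 3 / 2 * x)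
    (hre : 1 / 2 * x ≤ u.re) : ‖1 - u‖ < 1 ∧ x / 4 ≤ 1 - ‖1 - u‖ := by
  have h2 : ‖u‖ ^ 2 ≤ (3 / 2 * x) ^ 2 := by gcongr
  have h : ‖1 - u‖ ^ 2 ≤ 1 - x / 2 := by
    rw [norm_one_sub_sq]
    nlinarith
  have h1 : ‖1 - u‖ < 1 := by
    by_contra! hge
    nlinarith
  exact ⟨h1, by nlinarith [norm_nonneg (1 - u)]⟩

namespace LocalPeak

variable {E : Type*} [NormedAddCommGroup E] [NormedSpace ℂ E] {Ω : Set E} {p : E}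
  (K : LocalPeak Ω p)

/-- The quadratic peak function at `q`. -/
def P (q z : E) : ℂ := K.ℓ q (z - q) + K.B (z - q) (z - q)

/-- The barrier at `q`. -/
def v (q z : E) : ℝ := barrier (K.P q) q K.s (K.c * K.s ^ 2 / 4) z

theorem peakAt {q : E} (hq : q ∈ frontier Ω) (hqp : ‖q - p‖ < K.s) :
    PeakAt Ω (K.P q) q K.s K.c where
  s_pos := K.s_pos
  c_pos := K.c_pos
  diff := by
    unfold P
    have h1 : Differentiable ℂ fun z : E => z - q := differentiable_id.sub_const q
    exact ((K.ℓ q).differentiable.comp h1).add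
      ((K.B.differentiable.comp h1).clm_apply h1)
  re_le := fun z hz hzq => K.re_le q hq hqp z hz hzq

theorem peakAt_self (hp : p ∈ frontier Ω) : PeakAt Ω (K.P p) p K.s K.c :=
  K.peakAt hp (by simpa using K.s_pos)

theorem η_pos : 0 < K.c * K.s ^ 2 / 4 := by
  have := K.s_pos; have := K.c_pos; positivity

theorem one_le_C : 1 ≤ K.C := by
  have h := (K.ℓ p).le_opNorm K.ν
  rw [K.ℓ_ν, norm_one] at h
  have h1 : ‖K.ℓ p‖ * ‖K.ν‖ ≤ K.C * K.C :=
    mul_le_mul K.norm_ℓ K.norm_ν (norm_nonneg _) K.C_pos.le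
  nlinarith [K.C_pos]

theorem norm_ℓ_le (x : E) : ‖K.ℓ p x‖ ≤ K.C * ‖x‖ :=
  ((K.ℓ p).le_opNorm x).trans (by gcongr; exact K.norm_ℓ)

theorem norm_B_le (x y : E) : ‖K.B x y‖ ≤ K.C * ‖x‖ * ‖y‖ :=
  (K.B.le_opNorm₂ x y).trans (by gcongr; exact K.norm_B)

theorem norm_P_le (z : E) : ‖K.P p z‖ ≤ K.C * ‖z - p‖ + K.C * ‖z - p‖ ^ 2 := by
  refine (norm_add_le _ _).trans (add_le_add (K.norm_ℓ_le _) ?_)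
  rw [sq, ← mul_assoc]
  exact K.norm_B_le _ _

/-- Interior balls of radius comparable to the distance to `p` along the normal direction. -/
theorem ball_subset (hp : p ∈ frontier Ω) {T : ℝ} (hT : 0 < T)
    (h1 : 2 * K.C * (K.C + 1) ^ 2 * T ≤ 1) (h2 : (K.C + 1) * T < K.s) :
    ball (p - (T : ℂ) • K.ν) (T / (2 * K.C)) ⊆ Ω := by
  intro z hz
  have hC := K.one_le_C
  have hC0 := K.C_pos
  rw [mem_ball, dist_eq_norm] at hz
  set h := z - (p - (T : ℂ) • K.ν) with hh
  have hzp : z - p = h - (T : ℂ) • K.ν := by rw [hh]; abel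
  have hTC : T / (2 * K.C) ≤ T := div_le_self hT.le (by linarith)
  have hn : ‖z - p‖ ≤ (K.C + 1) * T := by
    rw [hzp]
    refine (norm_sub_le _ _).trans ?_
    rw [norm_smul, Complex.norm_of_nonneg hT.le]
    nlinarith [K.norm_ν, mul_le_mul_of_nonneg_left K.norm_ν hT.le]
  refine K.mem p hp (by simpa using K.s_pos) z (hn.trans_lt h2) ?_
  have h3 : (K.ℓ p (z - p)).re < -(T / 2) := by
    rw [hzp, map_sub, map_smul, K.ℓ_ν, smul_eq_mul, mul_one, sub_re, ofReal_re]
    have h4 := (re_le_norm _).trans (K.norm_ℓ_le h)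
    have h5 : K.C * ‖h‖ < T / 2 := by
      rw [lt_div_iff₀ (by positivity)] at hz
      linarith
    linarith
  have h6 : K.C * ‖z - p‖ ^ 2 ≤ K.C * ((K.C + 1) * T) ^ 2 := by gcongr
  nlinarith

variable {d : ℝ}

/-- A point of `Ω` near `p` lies below a boundary point in the normal direction. -/
theorem exists_frontier_above (hΩ : IsOpen Ω) (hp : p ∈ frontier Ω) {z : E} (hzΩ : z ∈ Ω) {ε : ℝ}
    (hε0 : 0 < ε) (hε : ‖z - p‖ ≤ ε) (h1 : (1 + 2 * K.C ^ 2) ^ 2 * ε < 1)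
    (h2 : (1 + 2 * K.C ^ 2) * ε < K.s) : ∃ σ : ℝ, 0 < σ ∧ σ ≤ 2 * K.C * ε ∧
      z + (σ : ℂ) • K.ν ∈ frontier Ω ∧ ‖z + (σ : ℂ) • K.ν - p‖ ≤ (1 + 2 * K.C ^ 2) * ε := by
  have hC0 := K.C_pos
  have hs := K.s_pos
  have hc := K.c_pos
  have hνC := K.norm_ν
  obtain ⟨K₂, hK₂⟩ : ∃ K₂, K₂ = 1 + 2 * K.C ^ 2 := ⟨_, rfl⟩
  have hℓ := K.norm_ℓ_le
  have hB := K.norm_B_le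
  rw [← hK₂] at h1 h2 ⊢
  have hK₂0 : 0 < K₂ := by rw [hK₂]; positivity
  have hnorm : ∀ σ : ℝ, 0 ≤ σ → σ ≤ 2 * K.C * ε → ‖z + (σ : ℂ) • K.ν - p‖ ≤ K₂ * ε := by
    intro σ h0 h1
    calc ‖z + (σ : ℂ) • K.ν - p‖ = ‖(z - p) + (σ : ℂ) • K.ν‖ := by congr 1; abel
      _ ≤ ‖z - p‖ + σ * ‖K.ν‖ := (norm_add_le _ _).trans (by
        rw [norm_smul, Complex.norm_of_nonneg h0])
      _ ≤ ε + (2 * K.C * ε) * K.C := by gcongr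
      _ = _ := by rw [hK₂]; ring
  suffices ∃ σ : ℝ, 0 < σ ∧ σ ≤ 2 * K.C * ε ∧ z + (σ : ℂ) • K.ν ∈ frontier Ω by
    obtain ⟨σ, h0, h1, h2⟩ := this
    exact ⟨σ, h0, h1, h2, hnorm σ h0.le h1⟩
  set γ : ℝ → E := fun σ => z + (σ : ℂ) • K.ν with hγ
  have hγc : Continuous γ := by fun_prop
  have hout : γ (2 * K.C * ε) ∉ Ω := by
    intro hin
    have h1 := hnorm (2 * K.C * ε) (by positivity) le_rfl
    have h2 := K.re_le p hp (by simpa using hs) _ hin (by linarith)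
    have h3 : (K.ℓ p (γ (2 * K.C * ε) - p)).re ≥ K.C * ε := by
      rw [hγ, show z + ((2 * K.C * ε : ℝ) : ℂ) • K.ν - p =
        (z - p) + ((2 * K.C * ε : ℝ) : ℂ) • K.ν by abel, map_add, map_smul, K.ℓ_ν, smul_eq_mul,
        mul_one, add_re, ofReal_re]
      have := (abs_le.1 ((abs_re_le_norm _).trans (hℓ (z - p)))).1
      nlinarith
    have h4 := (abs_le.1 ((abs_re_le_norm _).trans
      (hB (γ (2 * K.C * ε) - p) (γ (2 * K.C * ε) - p)))).1
    have h5 : K.C * ‖γ (2 * K.C * ε) - p‖ * ‖γ (2 * K.C * ε) - p‖ ≤ K.C * (K₂ * ε) * (K₂ * ε) := by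
      gcongr
    have h6 : K.C * (K₂ * ε) * (K₂ * ε) < K.C * ε := by
      calc _ = K.C * ε * (K₂ ^ 2 * ε) := by ring
        _ < K.C * ε * 1 := by gcongr
        _ = _ := mul_one _
    rw [add_re] at h2
    have h7 : 0 ≤ K.c * ‖γ (2 * K.C * ε) - p‖ ^ 2 := by positivity
    linarith
  have hpre : IsPreconnected (γ '' Icc 0 (2 * K.C * ε)) :=
    isPreconnected_Icc.image _ hγc.continuousOn
  have hin0 : γ 0 ∈ Ω := by simpa [hγ] using hzΩ
  obtain ⟨_, ⟨σ, hσ, rfl⟩, hσfr⟩ := hpre.exists_mem_frontier hΩ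
    ⟨0, ⟨le_rfl, by positivity⟩, rfl⟩ hin0 ⟨2 * K.C * ε, ⟨by positivity, le_rfl⟩, rfl⟩ hout
  refine ⟨σ, lt_of_le_of_ne hσ.1 ?_, hσ.2, hσfr⟩
  rintro rfl
  rw [hΩ.frontier_eq] at hσfr
  exact hσfr.2 hin0

/-- The Hopf lemma along a normal disc at the boundary point `p'` through a fixed point of `r`. -/
theorem barrier_normal_le (hsd : K.s ≤ d)
    (hd : ∀ z ∈ Ω, ∀ w ∈ Ω, ‖z - w‖ ≤ d) {r : E → E} (hr : DifferentiableOn ℂ r Ω)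
    (hrm : MapsTo r Ω Ω) {p' z : E} (hfr : p' ∈ frontier Ω) (hpps : ‖p' - p‖ < K.s)
    (hw1 : ‖K.ℓ p' K.ν - 1‖ ≤ 1 / 2) {σ T : ℝ} (hσ0 : 0 < σ) (hT0 : 0 < T)
    (hzp' : z - p' = -((σ : ℂ) • K.ν)) (hrz : r z = z) (hσT : σ / T ≤ 2 / 9)
    (h1 : 8 * K.C ^ 3 * T < 1) (h2 : 4 * K.C * T < K.s) (h3 : K.C ^ 3 * σ ≤ 1 / 2)
    (h4 : K.C * σ < K.s) :
    barrier (K.P p') p' K.s (K.c * K.s ^ 2 / 4) (r (p' - ((T : ℂ) / K.ℓ p' K.ν) • K.ν)) ≤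
      8 * (3 * Real.log (8 * d / K.s)) * T := by
  have hs := K.s_pos
  have hC0 := K.C_pos
  have hνC := K.norm_ν
  have hpeak := K.peakAt hfr hpps
  have hB := K.norm_B_le
  have hmem := K.mem p' hfr hpps
  have hlog : 0 < Real.log (8 * d / K.s) :=
    Real.log_pos (by rw [lt_div_iff₀ hs]; linarith)
  obtain ⟨κ, hκ⟩ : ∃ κ, κ = 1 / (3 * Real.log (8 * d / K.s)) := ⟨_, rfl⟩
  have hκ0 : 0 < κ := by rw [hκ]; positivity
  have hκ8 : 8 * (3 * Real.log (8 * d / K.s)) = 8 / κ := by rw [hκ]; field_simp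
  obtain ⟨w, hw⟩ : ∃ w, w = K.ℓ p' K.ν := ⟨_, rfl⟩
  rw [hκ8]
  rw [← hw] at hw1 ⊢
  have hwre : 1 / 2 ≤ w.re := by
    have := (abs_le.1 ((abs_re_le_norm (w - 1)).trans hw1)).1
    rw [sub_re, one_re] at this
    linarith
  have hwn : ‖w‖ ≤ 3 / 2 := by
    calc ‖w‖ = ‖(w - 1) + 1‖ := by simp
      _ ≤ ‖w - 1‖ + ‖(1 : ℂ)‖ := norm_add_le _ _
      _ ≤ _ := by rw [norm_one]; linarith
  have hwn' : 1 / 2 ≤ ‖w‖ := hwre.trans (re_le_norm w)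
  have hw0 : w ≠ 0 := by rintro h; rw [h, norm_zero] at hwn'; linarith
  obtain ⟨ψ, hψ⟩ : ∃ ψ : ℂ → E, ψ = fun ζ => p' - ((1 - ζ) * T / w) • K.ν := ⟨_, rfl⟩
  have hψd : Differentiable ℂ ψ := by
    simp only [hψ]
    fun_prop
  have hψΩ : MapsTo ψ (ball 0 1) Ω := by
    intro ζ hζ
    rw [mem_ball_zero_iff] at hζ
    have hsub : ψ ζ - p' = -(((1 - ζ) * T / w) • K.ν) := by simp [hψ]
    have hn : ‖ψ ζ - p'‖ ≤ ‖1 - ζ‖ * (2 * K.C * T) := by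
      rw [hsub, norm_neg, norm_smul, norm_div, norm_mul, Complex.norm_of_nonneg hT0.le]
      calc ‖1 - ζ‖ * T / ‖w‖ * ‖K.ν‖ ≤ ‖1 - ζ‖ * T / (1 / 2) * K.C := by gcongr
        _ = _ := by ring
    have h2 : ‖1 - ζ‖ ≤ 2 := by
      calc _ ≤ ‖(1 : ℂ)‖ + ‖ζ‖ := norm_sub_le _ _
        _ ≤ 2 := by rw [norm_one]; linarith
    have hsq : ‖1 - ζ‖ ^ 2 ≤ 2 * (1 - ζ).re := norm_one_sub_sq_le hζ.le
    have hre0 : 0 < (1 - ζ).re := by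
      rw [sub_re, one_re]
      linarith [re_le_norm ζ]
    refine hmem (ψ ζ) ?_ ?_
    · calc _ ≤ ‖1 - ζ‖ * (2 * K.C * T) := hn
        _ ≤ 2 * (2 * K.C * T) := by gcongr
        _ < _ := by linarith
    · have h5 : (K.ℓ p' (ψ ζ - p')).re = -(T * (1 - ζ).re) := by
        rw [hsub, map_neg, map_smul, ← hw, smul_eq_mul, div_mul_cancel₀ _ hw0, neg_re,
          re_mul_ofReal, mul_comm]
      rw [h5]
      calc _ ≤ -(T * (1 - ζ).re) + K.C * (‖1 - ζ‖ * (2 * K.C * T)) ^ 2 := by gcongr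
        _ = -(T * (1 - ζ).re) + 4 * K.C ^ 3 * T ^ 2 * ‖1 - ζ‖ ^ 2 := by ring
        _ ≤ -(T * (1 - ζ).re) + 4 * K.C ^ 3 * T ^ 2 * (2 * (1 - ζ).re) := by gcongr
        _ = -(T * (1 - ζ).re) * (1 - 8 * K.C ^ 3 * T) := by ring
        _ < 0 := mul_neg_of_neg_of_pos (by linarith [mul_pos hT0 hre0]) (by linarith)
  have hσT0 : 0 < σ / T := by positivity
  have hTne : (T : ℂ) ≠ 0 := by exact_mod_cast hT0.ne'
  obtain ⟨u, hu⟩ : ∃ u : ℂ, u = σ * w / T := ⟨_, rfl⟩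
  have hψz : ψ (1 - u) = z := by
    rw [← sub_left_inj (a := p'), hzp']
    simp only [hψ, hu, sub_sub_cancel, div_mul_cancel₀ _ hTne, mul_div_cancel_right₀ _ hw0]
    abel
  have hunorm : ‖u‖ ≤ 3 / 2 * (σ / T) := by
    rw [hu, norm_div, norm_mul, Complex.norm_of_nonneg hσ0.le, Complex.norm_of_nonneg hT0.le]
    calc σ * ‖w‖ / T ≤ σ * (3 / 2) / T := by gcongr
      _ = _ := by ring
  have hure : 1 / 2 * (σ / T) ≤ u.re := by
    have : u = ((σ / T : ℝ) : ℂ) * w := by rw [hu]; push_cast; ring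
    rw [this, re_ofReal_mul]
    nlinarith
  obtain ⟨hζ1, hζ4⟩ := norm_one_sub_bounds hσT0 hσT hunorm hure
  have hhopf := hpeak.hopf K.η_pos le_rfl hsd hd (φ := r ∘ ψ)
    (hr.comp hψd.differentiableOn hψΩ) (hrm.comp hψΩ) hζ1
  rw [← hκ] at hhopf
  simp only [comp_apply, hψz, hrz] at hhopf
  have hvz : barrier (K.P p') p' K.s (K.c * K.s ^ 2 / 4) z ≤ 2 * σ := by
    refine (barrier_le_neg_re ?_).trans ?_
    · rw [hzp', norm_neg, norm_smul, Complex.norm_of_nonneg hσ0.le]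
      calc σ * ‖K.ν‖ ≤ σ * K.C := by gcongr
        _ < _ := by linarith
    · simp only [P, hzp', map_neg, map_smul, neg_apply, smul_apply, smul_eq_mul, ← hw, mul_neg, neg_neg]
      have h1 : ((σ : ℂ) * w).re ≤ σ * (3 / 2) := by
        rw [re_ofReal_mul]
        exact mul_le_mul_of_nonneg_left ((re_le_norm w).trans hwn) hσ0.le
      have h2 := (abs_le.1 ((abs_re_le_norm ((σ : ℂ) * (σ * K.B K.ν K.ν))).trans
        (show _ ≤ σ / 2 by
          rw [norm_mul, norm_mul, Complex.norm_of_nonneg hσ0.le]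
          have h3 : ‖K.B K.ν K.ν‖ ≤ K.C * K.C * K.C :=
            (hB _ _).trans (by gcongr)
          calc σ * (σ * ‖K.B K.ν K.ν‖) ≤ σ * (σ * (K.C * K.C * K.C)) := by gcongr
            _ = σ * (K.C ^ 3 * σ) := by ring
            _ ≤ σ * (1 / 2) := by gcongr
            _ = _ := by ring))).1
      rw [add_re, neg_re]
      linarith
  have hv0 := hpeak.barrier_nonneg K.η_pos.le (hrm (hψΩ (mem_ball_self one_pos)))
  have hvψ : barrier (K.P p') p' K.s (K.c * K.s ^ 2 / 4) (r (ψ 0)) ≤ 8 / κ * T := by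
    have h1 : κ * barrier (K.P p') p' K.s (K.c * K.s ^ 2 / 4) (r (ψ 0)) * (σ / T / 4) ≤ 2 * σ :=
      le_trans (by gcongr) (hhopf.trans hvz)
    rw [show κ * barrier (K.P p') p' K.s (K.c * K.s ^ 2 / 4) (r (ψ 0)) * (σ / T / 4) =
      σ * (κ * barrier (K.P p') p' K.s (K.c * K.s ^ 2 / 4) (r (ψ 0)) / (4 * T)) by ring,
      mul_comm 2 σ] at h1
    have h2 := le_of_mul_le_mul_left h1 hσ0
    rw [div_le_iff₀ (by positivity)] at h2
    rw [div_mul_eq_mul_div, le_div_iff₀ hκ0]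
    linarith
  have hψ0 : ψ 0 = p' - ((T : ℂ) / w) • K.ν := by simp [hψ]
  rw [← hψ0]
  exact hvψ

/-- Comparison of the barriers at two boundary points. -/
theorem v_le_of_barrier_le {p' : E} (hfr : p' ∈ frontier Ω) (hpps : ‖p' - p‖ < K.s) {x : E}
    (hxΩ : x ∈ Ω) {T A₁ : ℝ} (hT0 : 0 < T)
    (hvx : barrier (K.P p') p' K.s (K.c * K.s ^ 2 / 4) x ≤ A₁ * T)
    (hA : A₁ * T < K.c * K.s ^ 2 / 4) (hgT : ‖p' - p‖ ≤ T) (hgs : ‖p' - p‖ ≤ K.s / 4) :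
    K.v p x ≤ (A₁ + K.C * (1 + 4 * K.s)) * T := by
  have hs := K.s_pos
  have hC0 := K.C_pos
  have hlt := hvx.trans_lt hA
  have hhalf := (K.peakAt hfr hpps).norm_lt_half le_rfl hxΩ hlt
  have hval := (barrier_of_lt hlt).2
  have hxp : x - p = (x - p') + (p' - p) := by abel
  set y := x - p' with hy
  set g := p' - p with hg
  refine (barrier_le_neg_re ?_).trans ?_
  · rw [hxp]
    exact (norm_add_le _ _).trans_lt (by linarith)
  have hdiff : K.P p' x - K.P p x = (K.ℓ p' - K.ℓ p) y - K.ℓ p g - (K.B y g + K.B g y + K.B g g) := by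
    simp only [P, hxp, ← hy, map_add, add_apply, sub_apply]
    ring
  have hbd : ‖K.P p' x - K.P p x‖ ≤ K.C * (1 + 4 * K.s) * T := by
    rw [hdiff]
    have e1 : ‖(K.ℓ p' - K.ℓ p) y‖ ≤ K.C * T * K.s :=
      (ContinuousLinearMap.le_opNorm _ _).trans (by
        gcongr
        · exact (K.lip p' hpps).trans (by gcongr)
        · linarith)
    have e2 : ‖K.ℓ p g‖ ≤ K.C * T := (K.norm_ℓ_le g).trans (by gcongr)
    have e3 : ‖K.B y g‖ ≤ K.C * K.s * T := (K.norm_B_le y g).trans (by gcongr; linarith)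
    have e4 : ‖K.B g y‖ ≤ K.C * T * K.s := (K.norm_B_le g y).trans (by gcongr; linarith)
    have e5 : ‖K.B g g‖ ≤ K.C * T * K.s := (K.norm_B_le g g).trans (by gcongr)
    calc _ ≤ (‖(K.ℓ p' - K.ℓ p) y‖ + ‖K.ℓ p g‖) + (‖K.B y g‖ + ‖K.B g y‖ + ‖K.B g g‖) :=
          (norm_sub_le _ _).trans (add_le_add (norm_sub_le _ _) (norm_add₃_le))
      _ ≤ _ := by linarith
  have hre := (abs_le.1 ((abs_re_le_norm _).trans hbd)).2
  rw [sub_re] at hre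
  rw [hval] at hvx
  rw [add_mul]
  linarith

set_option maxHeartbeats 800000 in
/-- If the fixed points of a holomorphic self-map accumulate at `p`, the map satisfies a
boundary Schwarz type bound at `p` along a sequence of points on the normal. -/
theorem exists_normal_bound (hΩ : IsOpen Ω) (hp : p ∈ frontier Ω) (hsd : K.s ≤ d)
    (hd : ∀ z ∈ Ω, ∀ w ∈ Ω, ‖z - w‖ ≤ d) {r : E → E} (hr : DifferentiableOn ℂ r Ω)
    (hrm : MapsTo r Ω Ω) (hcl : p ∈ closure {z | z ∈ Ω ∧ r z = z}) :
    ∃ A, 0 < A ∧ ∀ δ > 0, ∃ T : ℝ, 0 < T ∧ T < δ ∧ K.v p (r (p - (T : ℂ) • K.ν)) ≤ A * T := by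
  have hs := K.s_pos
  have hc := K.c_pos
  have hC := K.one_le_C
  have hC0 := K.C_pos
  obtain ⟨κ, hκ⟩ : ∃ x, x = 1 / (3 * Real.log (8 * d / K.s)) := ⟨_, rfl⟩
  have hκ0 : 0 < κ := by
    have : 1 < 8 * d / K.s := by rw [lt_div_iff₀ hs]; linarith
    have := Real.log_pos this
    rw [hκ]; positivity
  obtain ⟨H, hH⟩ : ∃ x, x = (3 : ℝ) ^ ⌈4 * d / K.s⌉₊ := ⟨_, rfl⟩
  have hH0 : 0 < H := by rw [hH]; positivity
  obtain ⟨K₂, hK₂⟩ : ∃ x, x = 1 + 2 * K.C ^ 2 := ⟨_, rfl⟩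
  have hK₂1 : 1 ≤ K₂ := by rw [hK₂]; nlinarith
  have hK₂0 : 0 < K₂ := by linarith
  obtain ⟨K₃, hK₃⟩ : ∃ x, x = 32 * K.C * K₂ := ⟨_, rfl⟩
  have hK₃0 : 0 < K₃ := by rw [hK₃]; positivity
  have hK₃9 : 9 * K.C ≤ K₃ := by rw [hK₃]; nlinarith
  obtain ⟨A₁, hA₁⟩ : ∃ x, x = H * (8 / κ) := ⟨_, rfl⟩
  obtain ⟨A₂, hA₂⟩ : ∃ x, x = K.C * (1 + 4 * K.s) := ⟨_, rfl⟩
  have hA₁0 : 0 < A₁ := by rw [hA₁]; positivity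
  have hA₂0 : 0 < A₂ := by rw [hA₂]; positivity
  refine ⟨A₁ + A₂, by positivity, fun δ hδ => ?_⟩
  have ev : ∀ᶠ ε in 𝓝[>] (0 : ℝ), 0 < ε ∧ K₃ * ε < δ ∧ K.C ^ 2 * K₂ * ε < 1 / 2 ∧
      K₂ ^ 2 * ε < 1 ∧ K₂ * ε < K.s / 4 ∧ 8 * K.C ^ 3 * K₃ * ε < 1 ∧ 4 * K.C * K₃ * ε < K.s ∧
      2 * K.C ^ 4 * ε < 1 / 2 ∧ 2 * K.C * (K.C + 1) ^ 2 * K₃ * ε < 1 ∧ (K.C + 1) * K₃ * ε < K.s ∧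
      2 * K.C * (K.C ^ 2 * K₂) * K₃ * ε < K₂ * 2 ∧ A₁ * K₃ * ε < K.c * K.s ^ 2 / 4 := by
    filter_upwards [self_mem_nhdsWithin, eventually_mul_lt_nhdsGT K₃ hδ,
      eventually_mul_lt_nhdsGT (K.C ^ 2 * K₂) (one_half_pos (α := ℝ)),
      eventually_mul_lt_nhdsGT (K₂ ^ 2) one_pos,
      eventually_mul_lt_nhdsGT K₂ (show 0 < K.s / 4 by positivity),
      eventually_mul_lt_nhdsGT (8 * K.C ^ 3 * K₃) one_pos,
      eventually_mul_lt_nhdsGT (4 * K.C * K₃) hs,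
      eventually_mul_lt_nhdsGT (2 * K.C ^ 4) (one_half_pos (α := ℝ)),
      eventually_mul_lt_nhdsGT (2 * K.C * (K.C + 1) ^ 2 * K₃) one_pos,
      eventually_mul_lt_nhdsGT ((K.C + 1) * K₃) hs,
      eventually_mul_lt_nhdsGT (2 * K.C * (K.C ^ 2 * K₂) * K₃) (show 0 < K₂ * 2 by positivity),
      eventually_mul_lt_nhdsGT (A₁ * K₃) K.η_pos] with ε h1 h2 h3 h4 h5 h6 h7 h8 h9 h10 h11 h12
    exact ⟨h1, h2, h3, h4, h5, h6, h7, h8, h9, h10, h11, h12⟩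
  obtain ⟨ε₀, hε₀, hev⟩ := mem_nhdsGT_iff_exists_Ioo_subset.1 ev
  obtain ⟨z, ⟨hzΩ, hrz⟩, hzp⟩ := Metric.mem_closure_iff.1 hcl ε₀ hε₀
  obtain ⟨ε, hε⟩ : ∃ x, x = ‖z - p‖ := ⟨_, rfl⟩
  have hpΩ : p ∉ Ω := by
    rw [hΩ.frontier_eq] at hp; exact hp.2
  have hε0 : 0 < ε := hε ▸ norm_pos_iff.2 (sub_ne_zero.2 fun h => hpΩ (h ▸ hzΩ))
  obtain ⟨-, c2, c3, c4, c5, c6, c7, c8, c9, c10, c11, c12⟩ :=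
    hev ⟨hε0, by rwa [dist_comm, dist_eq_norm, ← hε] at hzp⟩
  clear hev ev
  have hνC := K.norm_ν
  obtain ⟨σ, hσ0, hσ1, hfr, hpp⟩ := K.exists_frontier_above hΩ hp hzΩ hε0 hε.ge
    (by rwa [← hK₂]) (by rw [← hK₂]; linarith)
  rw [← hK₂] at hpp
  obtain ⟨p', hp'⟩ : ∃ x, x = z + (σ : ℂ) • K.ν := ⟨_, rfl⟩
  rw [← hp'] at hpp hfr
  have hpps : ‖p' - p‖ < K.s := by linarith
  obtain ⟨w, hw⟩ : ∃ x, x = K.ℓ p' K.ν := ⟨_, rfl⟩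
  have hw1 : ‖w - 1‖ ≤ K.C ^ 2 * K₂ * ε := by
    have h1 : w - 1 = (K.ℓ p' - K.ℓ p) K.ν := by rw [sub_apply, K.ℓ_ν, hw]
    rw [h1]
    calc _ ≤ ‖K.ℓ p' - K.ℓ p‖ * ‖K.ν‖ := ContinuousLinearMap.le_opNorm _ _
      _ ≤ (K.C * (K₂ * ε)) * K.C := by
        gcongr
        exact (K.lip p' hpps).trans (by gcongr)
      _ = _ := by ring
  have hwn' : 1 / 2 ≤ ‖w‖ := by
    have h1 := norm_sub_norm_le 1 w
    rw [norm_one, norm_sub_rev] at h1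
    linarith
  have hw0 : w ≠ 0 := by rintro h; rw [h, norm_zero] at hwn'; linarith
  obtain ⟨T, hT⟩ : ∃ x, x = K₃ * ε := ⟨_, rfl⟩
  have hT0 : 0 < T := by rw [hT]; positivity
  have hpeak := K.peakAt hfr hpps
  have hzp' : z - p' = -((σ : ℂ) • K.ν) := by rw [hp']; abel
  have hσT : σ / T ≤ 2 / 9 := by
    rw [div_le_iff₀ hT0, hT]
    nlinarith
  obtain ⟨ψ0, hψ⟩ : ∃ ψ0, ψ0 = p' - ((T : ℂ) / w) • K.ν := ⟨_, rfl⟩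
  have hvψ : barrier (K.P p') p' K.s (K.c * K.s ^ 2 / 4) (r ψ0) ≤ 8 / κ * T := by
    have h := K.barrier_normal_le hsd hd hr hrm hfr hpps (hw ▸ hw1.trans c3.le) hσ0 hT0 hzp' hrz hσT
      (by rw [hT]; linarith) (by rw [hT]; linarith) ?_ ?_
    · rw [hψ, hκ, div_div_eq_mul_div, div_one, hw]
      exact h
    · calc K.C ^ 3 * σ ≤ K.C ^ 3 * (2 * K.C * ε) := by gcongr
        _ = 2 * K.C ^ 4 * ε := by ring
        _ ≤ _ := c8.le
    · calc K.C * σ ≤ K.C * (2 * K.C * ε) := by gcongr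
        _ ≤ K₂ * ε := by rw [hK₂]; nlinarith
        _ < _ := by linarith
  -- transport to the normal through `p`
  have hdist : ‖(p - (T : ℂ) • K.ν) - ψ0‖ ≤ T / (8 * K.C) := by
    have h1 : (p - (T : ℂ) • K.ν) - ψ0 = (p - p') + ((T : ℂ) * ((1 - w) / w)) • K.ν := by
      have : (T : ℂ) * ((1 - w) / w) = T / w - T := by field_simp
      rw [this, sub_smul]
      rw [hψ]
      abel
    have h2 : K₂ * ε = T / (32 * K.C) := by rw [hT, hK₃]; field_simp
    rw [h1]
    calc _ ≤ ‖p - p'‖ + T * (‖1 - w‖ / ‖w‖) * ‖K.ν‖ := (norm_add_le _ _).trans (by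
          rw [norm_smul, norm_mul, norm_div, Complex.norm_of_nonneg hT0.le])
      _ ≤ K₂ * ε + T * (K.C ^ 2 * K₂ * ε / (1 / 2)) * K.C := by
        rw [norm_sub_rev p p', norm_sub_rev 1 w]
        gcongr
      _ = K₂ * ε + (2 * K.C * (K.C ^ 2 * K₂) * K₃ * ε) * ε := by rw [hT]; ring
      _ ≤ K₂ * ε + K₂ * 2 * ε := by gcongr
      _ ≤ 4 * (K₂ * ε) := by nlinarith [mul_pos hK₂0 hε0]
      _ = _ := by rw [h2]; ring
  have hb1 := K.ball_subset hp hT0 (by rw [hT]; linarith) (by rw [hT]; linarith)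
  have hb2 : ball (ψ0) (T / (4 * K.C)) ⊆ Ω := by
    refine (ball_subset_ball' ?_).trans hb1
    rw [dist_comm, dist_eq_norm]
    calc _ ≤ T / (4 * K.C) + T / (8 * K.C) := by gcongr
      _ ≤ T / (2 * K.C) := by
        rw [div_add_div _ _ (by positivity) (by positivity),
          div_le_div_iff₀ (by positivity) (by positivity)]
        nlinarith [mul_pos hT0 (mul_pos hC0 hC0)]
  have hpow := hpeak.barrier_le_pow K.η_pos le_rfl hsd hd (φ := r) (x := ψ0)
    (R := T / (4 * K.C)) (by positivity) (hr.mono hb2) (fun x hx => hrm (hb2 hx))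
    (ζ := p - (T : ℂ) • K.ν) (hdist.trans (le_of_eq (by ring)))
  rw [← hH] at hpow
  have hxΩ : r (p - (T : ℂ) • K.ν) ∈ Ω := hrm (hb1 (mem_ball_self (by positivity)))
  have hvx : barrier (K.P p') p' K.s (K.c * K.s ^ 2 / 4) (r (p - (T : ℂ) • K.ν)) ≤ A₁ * T := by
    calc _ ≤ _ := hpow
      _ ≤ H * (8 / κ * T) := by gcongr
      _ = _ := by rw [hA₁]; ring
  refine ⟨T, hT0, hT ▸ c2, hA₂ ▸ K.v_le_of_barrier_le hfr hpps hxΩ hT0 hvx (by rw [hT]; linarith) ?_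
    (by linarith)⟩
  refine hpp.trans ?_
  rw [hT, hK₃]
  nlinarith [mul_pos hK₂0 hε0]

end LocalPeak

section HalfPlaneGrowth

variable {f : ℂ → ℂ}

theorem ball_subset_halfPlane {y : ℝ} : ball (y : ℂ) y ⊆ {w : ℂ | 0 < w.re} := by
  intro w hw
  rw [mem_ball, dist_eq_norm] at hw
  have := (abs_lt.1 ((abs_re_le_norm _).trans_lt hw)).1
  rw [sub_re, ofReal_re] at this
  show 0 < w.re
  linarith

/-- A function with nonnegative real part `O(1 / y)` tending to zero is itself `O(1 / y)`. -/
theorem halfPlane_norm_le (hd : DifferentiableOn ℂ f {w | 0 < w.re})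
    (hre : ∀ w : ℂ, 0 < w.re → 0 ≤ (f w).re) {A : ℝ} (hA : ∀ y : ℝ, 0 < y → (f y).re ≤ A / y)
    (h0 : Tendsto (fun y : ℝ => f y) atTop (𝓝 0)) {y : ℝ} (hy : 0 < y) : ‖f y‖ ≤ 2 * A / y := by
  have step : ∀ x : ℝ, 0 < x → ‖f x‖ ≤ A / x + ‖f (2 * x : ℝ)‖ := by
    intro x hx
    have h1 := norm_sub_le_of_re_nonneg (f := f) (c := ((2 * x : ℝ) : ℂ)) (R := 2 * x) (z := (x : ℂ))
      (hd.mono ball_subset_halfPlane) (fun w hw => hre w (ball_subset_halfPlane hw)) (by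
        rw [mem_ball, dist_eq_norm, ← ofReal_sub, norm_real, Real.norm_eq_abs, abs_lt]
        constructor <;> linarith)
    have h2 : ‖(x : ℂ) - (2 * x : ℝ)‖ = x := by
      rw [← ofReal_sub, norm_real, Real.norm_eq_abs, show x - 2 * x = -x by ring, abs_neg,
        abs_of_pos hx]
    rw [h2, show 2 * x - x = x by ring, mul_div_cancel_right₀ _ hx.ne'] at h1
    have h3 := hA (2 * x) (by positivity)
    have h4 : A / (2 * x) = A / x / 2 := by field_simp
    have h5 := norm_sub_norm_le (f x) (f (2 * x : ℝ))
    linarith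
  have ind : ∀ k : ℕ, ‖f y‖ ≤ 2 * A / y * (1 - (1 / 2) ^ k) + ‖f ((2 ^ k * y : ℝ) : ℂ)‖ := by
    intro k
    induction k with
    | zero => simp
    | succ k ih =>
      have h1 := step (2 ^ k * y) (by positivity)
      rw [show 2 * (2 ^ k * y) = 2 ^ (k + 1) * y by ring] at h1
      have h2 : A / (2 ^ k * y) = A / y * (1 / 2) ^ k := by field_simp; simp
      rw [h2] at h1
      have h3 : 2 * A / y * (1 - (1 / 2) ^ (k + 1)) =
          2 * A / y * (1 - (1 / 2) ^ k) + A / y * (1 / 2) ^ k := by rw [pow_succ]; ring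
      linarith
  have t1 : Tendsto (fun k : ℕ => (2 : ℝ) ^ k * y) atTop atTop :=
    (tendsto_pow_atTop_atTop_of_one_lt one_lt_two).atTop_mul_const hy
  have t2 : Tendsto (fun k : ℕ => 2 * A / y * (1 - (1 / 2) ^ k) + ‖f ((2 ^ k * y : ℝ) : ℂ)‖) atTop
      (𝓝 (2 * A / y * (1 - 0) + ‖(0 : ℂ)‖)) :=
    ((tendsto_const_nhds.sub (tendsto_pow_atTop_nhds_zero_of_lt_one (by norm_num)
      (by norm_num))).const_mul _).add (h0.comp t1).norm
  simpa using ge_of_tendsto' t2 ind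

/-- A function with nonnegative real part growing slowly along the real axis is slowly varying. -/
theorem halfPlane_norm_sub_le (hd : DifferentiableOn ℂ f {w | 0 < w.re})
    (hre : ∀ w : ℂ, 0 < w.re → 0 ≤ (f w).re) {ε Y : ℝ} (hY : 0 < Y)
    (hε : ∀ y : ℝ, Y ≤ y → (f y).re ≤ ε * y) {y : ℝ} (hy : Y ≤ y) :
    ‖f y - f Y‖ ≤ 2 * ε * (y - Y) := by
  have hopen : IsOpen {w : ℂ | 0 < w.re} := isOpen_lt continuous_const continuous_re
  have hder : ∀ x ∈ Icc Y y, HasDerivWithinAt (fun x : ℝ => f x) (deriv f x) (Icc Y y) x := by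
    intro x hx
    have h1 : HasDerivAt f (deriv f x) x :=
      (hd.differentiableAt (hopen.mem_nhds (by
        show 0 < (x : ℂ).re
        rw [ofReal_re]; linarith [hx.1]))).hasDerivAt
    exact h1.comp_ofReal.hasDerivWithinAt
  refine norm_image_sub_le_of_norm_deriv_le_segment' hder (fun x hx => ?_) y ⟨hy, le_rfl⟩
  have hx0 : 0 < x := hY.trans_le hx.1
  have hdx : DifferentiableAt ℂ f x := hd.differentiableAt (hopen.mem_nhds (by
    show 0 < (x : ℂ).re
    rwa [ofReal_re]))
  refine le_of_forall_gt_imp_ge_of_dense fun b hb => ?_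
  have hbx : 2 * (f x).re / x < b := by
    refine lt_of_le_of_lt ?_ hb
    rw [div_le_iff₀ hx0]
    have := hε x hx.1
    linarith
  have hlip : ∀ᶠ z in 𝓝 (x : ℂ), ‖f z - f x‖ ≤ b * ‖z - x‖ := by
    have ht : Tendsto (fun z : ℂ => 2 * (f x).re / (x - ‖z - x‖)) (𝓝 (x : ℂ))
        (𝓝 (2 * (f x).re / (x - ‖(x : ℂ) - x‖))) := by
      refine ContinuousAt.div (by fun_prop) (by fun_prop) ?_
      simpa using hx0.ne'
    simp only [sub_self, norm_zero, sub_zero] at ht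
    filter_upwards [ht.eventually (gt_mem_nhds hbx), ball_mem_nhds (x : ℂ) hx0] with z hz hzb
    refine (norm_sub_le_of_re_nonneg (hd.mono ball_subset_halfPlane)
      (fun w hw => hre w (ball_subset_halfPlane hw)) hzb).trans ?_
    rw [mul_div_right_comm]
    gcongr
  have hb0 : 0 ≤ b := le_trans (by have := hre x (by simpa); positivity) hbx.le
  exact hdx.hasDerivAt.le_of_lip' hb0 hlip

end HalfPlaneGrowth

/-- A retract flow `f m = G m ∘ f 0` whose time maps `G m` are tangent to the identity at the
boundary point `p`, and whose fixed points accumulate at `p`. -/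
structure TangentFlow {E : Type*} [NormedAddCommGroup E] [NormedSpace ℂ E]
    (Ω : Set E) (p : E) (G f : ℕ → E → E) (ms : ℕ → ℕ) : Prop extends RetractFlow Ω f ms where
  G_diff : ∀ m, DifferentiableOn ℂ (G m) Ω
  G_maps : ∀ m, MapsTo (G m) Ω Ω
  G_f : ∀ l m, ∀ z ∈ Ω, G l (f m z) = f (m + l) z
  f_G : ∀ l m, ∀ z ∈ Ω, f m (G l z) = f (m + l) z
  G_tangent : ∀ l, ∀ ε > 0, ∃ δ > 0, ∀ z ∈ Ω, ‖z - p‖ < δ → ‖G l z - z‖ ≤ ε * ‖z - p‖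
  mem_closure : p ∈ closure {z | z ∈ Ω ∧ f 0 z = z}
  mem_frontier : p ∈ frontier Ω

namespace LocalPeak

variable {E : Type*} [NormedAddCommGroup E] [NormedSpace ℂ E] {Ω : Set E} {p : E}
  (K : LocalPeak Ω p) {G f : ℕ → E → E} {ms : ℕ → ℕ} {d : ℝ}

/-- The half-plane disc tangent to the normal direction at `p`. -/
def disc (Y : ℝ) (w : ℂ) : E := p - (w + Y)⁻¹ • K.ν

/-- A shift for which the normal disc lies in `Ω`. -/
def Y₀ : ℝ := 2 * K.C * (K.C + 1) ^ 2 + (K.C + 1) / K.s + 1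

theorem Y₀_pos : 0 < K.Y₀ := by
  have := K.C_pos; have := K.s_pos; unfold Y₀; positivity

theorem disc_ofReal (Y y : ℝ) : K.disc Y y = p - (((y + Y)⁻¹ : ℝ) : ℂ) • K.ν := by
  rw [disc]; push_cast; rfl

theorem norm_disc_sub_le {Y : ℝ} (hY : 0 ≤ Y) {w : ℂ} (hw : 0 < w.re) :
    ‖K.disc Y w - p‖ ≤ K.C / (w.re + Y) := by
  have h1 : w.re + Y ≤ ‖w + Y‖ := by simpa using re_le_norm (w + Y)
  have h0 : 0 < w.re + Y := by linarith
  have : K.disc Y w - p = -((w + Y)⁻¹ • K.ν) := by rw [disc]; abel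
  rw [this, norm_neg, norm_smul, norm_inv, mul_comm, ← div_eq_mul_inv]
  have := K.C_pos
  gcongr
  exact K.norm_ν

theorem disc_mem (hp : p ∈ frontier Ω) {Y : ℝ} (hY : K.Y₀ ≤ Y) {w : ℂ} (hw : 0 < w.re) :
    K.disc Y w ∈ Ω := by
  have hC := K.C_pos
  have hs := K.s_pos
  have hY0 := K.Y₀_pos
  have h0 : 0 < w.re + Y := by linarith
  have h1 : w.re + Y ≤ ‖w + Y‖ := by simpa using re_le_norm (w + Y)
  have hn0 : 0 < ‖w + Y‖ := by linarith
  have hsub : K.disc Y w - p = -((w + Y)⁻¹ • K.ν) := by rw [disc]; abel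
  have hsY : (K.C + 1) / K.s ≤ Y := by
    refine le_trans ?_ hY
    unfold Y₀
    have : 0 ≤ 2 * K.C * (K.C + 1) ^ 2 := by positivity
    linarith
  have hCY : K.C ^ 3 < Y := by
    refine lt_of_lt_of_le ?_ hY
    unfold Y₀
    have : 0 ≤ (K.C + 1) / K.s := by positivity
    nlinarith [pow_pos hC 2, pow_pos hC 3]
  refine K.mem p hp (by simpa using hs) _ ((K.norm_disc_sub_le (by linarith) hw).trans_lt ?_) ?_
  · rw [div_lt_iff₀ h0]
    rw [div_le_iff₀ hs] at hsY
    nlinarith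
  · have hn : ‖K.disc Y w - p‖ ≤ K.C / ‖w + Y‖ := by
      rw [hsub, norm_neg, norm_smul, norm_inv, mul_comm, ← div_eq_mul_inv]
      gcongr
      exact K.norm_ν
    have h2 : (K.ℓ p (K.disc Y w - p)).re = -((w.re + Y) / ‖w + Y‖ ^ 2) := by
      rw [hsub, map_neg, map_smul, K.ℓ_ν, smul_eq_mul, mul_one, neg_re, inv_re, Complex.sq_norm]
      simp
    rw [h2]
    calc _ ≤ -((w.re + Y) / ‖w + Y‖ ^ 2) + K.C * (K.C / ‖w + Y‖) ^ 2 := by gcongr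
      _ = -(w.re + Y - K.C ^ 3) / ‖w + Y‖ ^ 2 := by ring
      _ < 0 := div_neg_of_neg_of_pos (by linarith) (by positivity)

theorem disc_differentiableOn {Y : ℝ} (hY : 0 ≤ Y) :
    DifferentiableOn ℂ (K.disc Y) {w | 0 < w.re} := by
  intro w hw
  have hw' : 0 < w.re := hw
  have h0 : w + Y ≠ 0 := fun h => by
    have := congrArg re h
    simp at this
    linarith
  unfold disc
  refine DifferentiableAt.differentiableWithinAt ?_
  fun_prop (disch := assumption)

theorem ball_disc_subset (hp : p ∈ frontier Ω) {Y y : ℝ} (hY : K.Y₀ ≤ Y) (hy : 0 < y) :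
    ball (K.disc Y y) ((y + Y)⁻¹ / (2 * K.C)) ⊆ Ω := by
  have hC := K.C_pos
  have hs := K.s_pos
  have hY0 := K.Y₀_pos
  rw [disc_ofReal]
  have h3 : K.Y₀ ≤ y + Y := by linarith
  refine K.ball_subset hp (inv_pos.2 (by linarith)) ?_ ?_
  · rw [← div_eq_mul_inv, div_le_one (by linarith)]
    refine le_trans ?_ h3
    unfold Y₀
    have : 0 ≤ (K.C + 1) / K.s := by positivity
    linarith
  · rw [← div_eq_mul_inv, div_lt_iff₀ (by linarith), ← div_lt_iff₀' hs]
    refine lt_of_lt_of_le ?_ h3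
    unfold Y₀
    have : 0 ≤ 2 * K.C * (K.C + 1) ^ 2 := by positivity
    linarith

theorem norm_G_disc_sub_le (h : TangentFlow Ω p G f ms) (l : ℕ) {ε : ℝ} (hε : 0 < ε) :
    ∃ y₀ : ℝ, 0 < y₀ ∧ ∀ Y ≥ K.Y₀, ∀ y : ℝ, y₀ ≤ y → ‖G l (K.disc Y y) - K.disc Y y‖ ≤ ε * (y + Y)⁻¹ := by
  have hC := K.C_pos
  have hY0 := K.Y₀_pos
  obtain ⟨δ, hδ, hG⟩ := h.G_tangent l (ε / K.C) (by positivity)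
  refine ⟨K.C / δ, by positivity, fun Y hY y hy => ?_⟩
  have hy0 : 0 < y := lt_of_lt_of_le (by positivity) hy
  have hn := K.norm_disc_sub_le (Y := Y) (w := y) (by linarith) (by simpa)
  rw [ofReal_re] at hn
  refine (hG _ (K.disc_mem h.mem_frontier hY (by simpa)) (hn.trans_lt ?_)).trans ?_
  · rw [div_lt_iff₀ (by linarith)]
    rw [div_le_iff₀ hδ] at hy
    nlinarith
  · calc _ ≤ ε / K.C * (K.C / (y + Y)) := by gcongr
      _ = _ := by field_simp

/-- The barrier at `p` decays along all the discs `f m ∘ disc`, uniformly in `m`. -/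
theorem exists_v_flow_le (h : TangentFlow Ω p G f ms) (hsd : K.s ≤ d)
    (hd : ∀ z ∈ Ω, ∀ w ∈ Ω, ‖z - w‖ ≤ d) :
    ∃ A > 0, ∀ m, ∀ w : ℂ, 0 < w.re → K.v p (f m (K.disc K.Y₀ w)) ≤ A / w.re := by
  have hC := K.C_pos
  have hs := K.s_pos
  have hY0 := K.Y₀_pos
  have hlog : 0 < Real.log (8 * d / K.s) :=
    Real.log_pos (by rw [lt_div_iff₀ hs]; linarith)
  obtain ⟨A, hA, hT⟩ := K.exists_normal_bound h.isOpen h.mem_frontier hsd hd (h.diff 0) (h.maps 0)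
    h.mem_closure
  have hpk := K.peakAt_self h.mem_frontier
  obtain ⟨κ, hκ⟩ : ∃ κ, κ = 1 / (3 * Real.log (8 * d / K.s)) := ⟨_, rfl⟩
  have hκ0 : 0 < κ := by rw [hκ]; positivity
  obtain ⟨H, hH⟩ : ∃ H, H = (3 : ℝ) ^ ⌈4 * d / K.s⌉₊ := ⟨_, rfl⟩
  have hH0 : 0 < H := by rw [hH]; positivity
  refine ⟨4 * H * A / κ, by positivity, fun m w hw => ?_⟩
  obtain ⟨y₀, hy₀, hG⟩ := K.norm_G_disc_sub_le h m (ε := 1 / (4 * K.C)) (by positivity)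
  obtain ⟨T, hT0, hTδ, hTv⟩ := hT (1 / (y₀ + ‖w‖ + K.Y₀)) (by positivity)
  obtain ⟨y, hy⟩ : ∃ y, y = T⁻¹ - K.Y₀ := ⟨_, rfl⟩
  have hyT : (y + K.Y₀)⁻¹ = T := by rw [hy]; simp
  have hyb : y₀ + ‖w‖ < y := by
    rw [lt_one_div hT0 (by positivity), one_div] at hTδ
    linarith
  have hy0 : 0 < y := by linarith [norm_nonneg w]
  have hdisc : p - (T : ℂ) • K.ν = K.disc K.Y₀ y := by rw [disc_ofReal, hyT]
  rw [hdisc] at hTv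
  have hmem := K.disc_mem h.mem_frontier le_rfl (w := y) (by simpa)
  have hball := K.ball_disc_subset h.mem_frontier le_rfl hy0
  have h1 := hpk.barrier_le_pow K.η_pos le_rfl hsd hd (φ := f 0) (x := K.disc K.Y₀ y)
    (R := (y + K.Y₀)⁻¹ / (2 * K.C)) (by positivity) ((h.diff 0).mono hball)
    (fun z hz => h.maps 0 (hball hz)) (ζ := G m (K.disc K.Y₀ y)) (by
      refine (hG _ le_rfl y (by linarith [norm_nonneg w])).trans (le_of_eq ?_)
      field_simp
      norm_num)
  rw [h.f_G m 0 _ hmem, zero_add, ← hH] at h1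
  have h2 := hpk.hopf_halfPlane K.η_pos le_rfl hsd hd (φ := f m ∘ K.disc K.Y₀)
    ((h.diff m).comp (K.disc_differentiableOn hY0.le)
      (fun z hz => K.disc_mem h.mem_frontier le_rfl hz))
    (fun z hz => h.maps m (K.disc_mem h.mem_frontier le_rfl hz)) hw (w₁ := y) (by simpa)
  simp only [comp_apply] at h2
  rw [← hκ, ofReal_re] at h2
  change κ * K.v p _ * _ ≤ _ at h2
  have h3 : ‖(y : ℂ) + (starRingEnd ℂ) w‖ ≤ 2 * y := by
    refine (norm_add_le _ _).trans ?_
    rw [RCLike.norm_conj, Complex.norm_of_nonneg hy0.le]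
    linarith
  have h3' : 0 < ‖(y : ℂ) + (starRingEnd ℂ) w‖ := by
    refine lt_of_lt_of_le ?_ (re_le_norm _)
    simp
    linarith
  have hv0 : 0 ≤ K.v p (f m (K.disc K.Y₀ w)) :=
    hpk.barrier_nonneg K.η_pos.le (h.maps m (K.disc_mem h.mem_frontier le_rfl hw))
  have h4 : κ * K.v p (f m (K.disc K.Y₀ w)) * (w.re * y / (2 * y) ^ 2) ≤ H * (A * T) :=
    calc _ ≤ κ * K.v p (f m (K.disc K.Y₀ w)) *
          (w.re * y / ‖(y : ℂ) + (starRingEnd ℂ) w‖ ^ 2) := by gcongr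
      _ ≤ _ := h2
      _ ≤ _ := h1
      _ ≤ _ := mul_le_mul_of_nonneg_left hTv hH0.le
  have hTy : T * y ≤ 1 := by
    rw [← hyT, inv_mul_le_iff₀ (by linarith)]
    linarith
  rw [le_div_iff₀ hw, le_div_iff₀ hκ0]
  have h5 : κ * K.v p (f m (K.disc K.Y₀ w)) * (w.re * y / (2 * y) ^ 2) =
      (K.v p (f m (K.disc K.Y₀ w)) * w.re * κ) / (4 * y) := by field_simp; ring
  rw [h5, div_le_iff₀ (by positivity)] at h4
  calc _ ≤ _ := h4
    _ = 4 * H * A * (T * y) := by ring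
    _ ≤ 4 * H * A * 1 := by gcongr
    _ = _ := by ring

end LocalPeak

theorem re_neg_inv (z : ℂ) : (-z⁻¹).re = -z.re / ‖z‖ ^ 2 := by
  rw [neg_re, inv_re, Complex.sq_norm, neg_div]

namespace LocalPeak

variable {E : Type*} [NormedAddCommGroup E] [NormedSpace ℂ E] {Ω : Set E} {p : E}
  (K : LocalPeak Ω p) {G f : ℕ → E → E} {ms : ℕ → ℕ} {d Y A : ℝ}

theorem sq_le_neg_re_P (hp : p ∈ frontier Ω) {z : E} (hz : z ∈ Ω) (hzs : ‖z - p‖ < K.s) :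
    K.c * ‖z - p‖ ^ 2 ≤ -(K.P p z).re := by
  have := (K.peakAt_self hp).re_le z hz hzs.le
  linarith

theorem norm_sub_pos (hΩ : IsOpen Ω) (hp : p ∈ frontier Ω) {z : E} (hz : z ∈ Ω) : 0 < ‖z - p‖ := by
  rw [hΩ.frontier_eq] at hp
  exact norm_pos_iff.2 (sub_ne_zero.2 fun h => hp.2 (h ▸ hz))

theorem re_P_neg (hΩ : IsOpen Ω) (hp : p ∈ frontier Ω) {z : E} (hz : z ∈ Ω)
    (hzs : ‖z - p‖ < K.s) : (K.P p z).re < 0 := by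
  have h1 := K.sq_le_neg_re_P hp hz hzs
  have h2 := norm_sub_pos hΩ hp hz
  have := K.c_pos
  have : 0 < K.c * ‖z - p‖ ^ 2 := by positivity
  linarith

theorem P_ne_zero (hΩ : IsOpen Ω) (hp : p ∈ frontier Ω) {z : E} (hz : z ∈ Ω)
    (hzs : ‖z - p‖ < K.s) : K.P p z ≠ 0 := fun h => by
  have := K.re_P_neg hΩ hp hz hzs
  simp [h] at this

/-- The reciprocal of the peak function, with positive real part on `Ω` near `p`. -/
def q (z : E) : ℂ := -(K.P p z)⁻¹

theorem re_q_pos (hΩ : IsOpen Ω) (hp : p ∈ frontier Ω) {z : E} (hz : z ∈ Ω)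
    (hzs : ‖z - p‖ < K.s) : 0 < (K.q z).re := by
  rw [q, re_neg_inv]
  have h1 := K.re_P_neg hΩ hp hz hzs
  have h2 := norm_pos_iff.2 (K.P_ne_zero hΩ hp hz hzs)
  exact div_pos (by linarith) (by positivity)

/-- The boundary data controlled by a uniform barrier estimate along the discs `f m ∘ disc Y`. -/
structure FlowDisc (f : ℕ → E → E) (Y A : ℝ) : Prop where
  Y_ge : K.Y₀ ≤ Y
  A_pos : 0 < A
  v_le : ∀ m, ∀ w : ℂ, 0 < w.re → K.v p (f m (K.disc Y w)) ≤ A / w.re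
  v_lt : ∀ m, ∀ w : ℂ, 0 < w.re → K.v p (f m (K.disc Y w)) < K.c * K.s ^ 2 / 4

theorem exists_flowDisc (h : TangentFlow Ω p G f ms) (hsd : K.s ≤ d)
    (hd : ∀ z ∈ Ω, ∀ w ∈ Ω, ‖z - w‖ ≤ d) : ∃ Y A, K.FlowDisc f Y A := by
  obtain ⟨A, hA, hv⟩ := K.exists_v_flow_le h hsd hd
  have hη := K.η_pos
  obtain ⟨X, hX⟩ : ∃ X, X = A / (K.c * K.s ^ 2 / 4) := ⟨_, rfl⟩
  have hX0 : 0 < X := by rw [hX]; positivity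
  have key : ∀ w : ℂ, K.disc (K.Y₀ + X) w = K.disc K.Y₀ (w + X) := by
    intro w; simp only [disc]; push_cast; ring_nf
  have hre : ∀ w : ℂ, (w + X).re = w.re + X := by simp
  refine ⟨K.Y₀ + X, A, by linarith, hA, fun m w hw => ?_, fun m w hw => ?_⟩
  · rw [key]
    refine (hv m (w + X) (by rw [hre]; linarith)).trans ?_
    rw [hre]
    gcongr
    linarith
  · rw [key]
    refine (hv m (w + X) (by rw [hre]; linarith)).trans_lt ?_
    rw [hre, div_lt_iff₀ (by linarith), hX, mul_add, mul_div_cancel₀ _ hη.ne']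
    linarith [mul_pos hη hw]

namespace FlowDisc

variable {K}

theorem Y_pos (D : K.FlowDisc f Y A) : 0 < Y := K.Y₀_pos.trans_le D.Y_ge

theorem disc_mem (D : K.FlowDisc f Y A) (h : TangentFlow Ω p G f ms) {w : ℂ} (hw : 0 < w.re) :
    K.disc Y w ∈ Ω := K.disc_mem h.mem_frontier D.Y_ge hw

theorem mem (D : K.FlowDisc f Y A) (h : TangentFlow Ω p G f ms) (m : ℕ) {w : ℂ} (hw : 0 < w.re) :
    f m (K.disc Y w) ∈ Ω := h.maps m (D.disc_mem h hw)

theorem norm_lt (D : K.FlowDisc f Y A) (m : ℕ) {w : ℂ} (hw : 0 < w.re) :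
    ‖f m (K.disc Y w) - p‖ < K.s := (barrier_of_lt (D.v_lt m w hw)).1

theorem neg_re_P_le (D : K.FlowDisc f Y A) (m : ℕ) {w : ℂ} (hw : 0 < w.re) :
    -(K.P p (f m (K.disc Y w))).re ≤ A / w.re :=
  (barrier_of_lt (D.v_lt m w hw)).2 ▸ D.v_le m w hw

theorem P_diff (D : K.FlowDisc f Y A) (h : TangentFlow Ω p G f ms) (m : ℕ) :
    DifferentiableOn ℂ (fun w => K.P p (f m (K.disc Y w))) {w | 0 < w.re} :=
  (K.peakAt_self h.mem_frontier).diff.comp_differentiableOn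
    ((h.diff m).comp (K.disc_differentiableOn D.Y_pos.le) fun _ hw => D.disc_mem h hw)

theorem q_diff (D : K.FlowDisc f Y A) (h : TangentFlow Ω p G f ms) (m : ℕ) :
    DifferentiableOn ℂ (fun w => K.q (f m (K.disc Y w))) {w | 0 < w.re} :=
  ((D.P_diff h m).inv fun _ hw =>
    K.P_ne_zero h.isOpen h.mem_frontier (D.mem h m hw) (D.norm_lt m hw)).neg

theorem re_q_pos (D : K.FlowDisc f Y A) (h : TangentFlow Ω p G f ms) (m : ℕ) {w : ℂ}
    (hw : 0 < w.re) : 0 < (K.q (f m (K.disc Y w))).re :=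
  K.re_q_pos h.isOpen h.mem_frontier (D.mem h m hw) (D.norm_lt m hw)

theorem sq_norm_le (D : K.FlowDisc f Y A) (h : TangentFlow Ω p G f ms) (m : ℕ) {w : ℂ}
    (hw : 0 < w.re) : K.c * ‖f m (K.disc Y w) - p‖ ^ 2 ≤ A / w.re :=
  (K.sq_le_neg_re_P h.mem_frontier (D.mem h m hw) (D.norm_lt m hw)).trans (D.neg_re_P_le m hw)

theorem tendsto (D : K.FlowDisc f Y A) (h : TangentFlow Ω p G f ms) (m : ℕ) :
    Tendsto (fun y : ℝ => f m (K.disc Y y)) atTop (𝓝 p) := by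
  have hc := K.c_pos
  rw [tendsto_iff_norm_sub_tendsto_zero]
  have h1 : Tendsto (fun y : ℝ => Real.sqrt (A / K.c * y⁻¹)) atTop (𝓝 0) := by
    have := (Real.continuous_sqrt.tendsto _).comp (tendsto_inv_atTop_zero.const_mul (A / K.c))
    simpa [comp_def] using this
  refine tendsto_of_tendsto_of_tendsto_of_le_of_le' tendsto_const_nhds h1
    (Eventually.of_forall fun _ => norm_nonneg _) ?_
  filter_upwards [eventually_gt_atTop (0 : ℝ)] with y hy
  refine Real.le_sqrt_of_sq_le ?_
  have h2 := D.sq_norm_le h m (w := y) (by simpa)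
  rw [ofReal_re] at h2
  rw [div_mul_eq_mul_div, le_div_iff₀ hc, ← div_eq_mul_inv]
  linarith

theorem norm_P_le (D : K.FlowDisc f Y A) (h : TangentFlow Ω p G f ms) (m : ℕ) {y : ℝ}
    (hy : 0 < y) : ‖K.P p (f m (K.disc Y y))‖ ≤ 2 * A / y := by
  rw [← norm_neg]
  refine halfPlane_norm_le (f := fun w => -K.P p (f m (K.disc Y w))) (D.P_diff h m).neg
    (fun w hw => ?_) (fun y hy => ?_) ?_ hy
  · have := K.re_P_neg h.isOpen h.mem_frontier (D.mem h m hw) (D.norm_lt m hw)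
    rw [neg_re]; linarith
  · have := D.neg_re_P_le m (w := y) (by simpa)
    rwa [ofReal_re, ← neg_re] at this
  · have h0 : K.P p p = 0 := by simp [P]
    have := (((K.peakAt_self h.mem_frontier).diff.continuous.tendsto p).comp (D.tendsto h m)).neg
    rwa [h0, neg_zero] at this

/-- Linear lower bound for the growth of the reciprocal peak function along the base disc. -/
theorem exists_le_re_q (D : K.FlowDisc f Y A) (h : TangentFlow Ω p G f ms) (hsd : K.s ≤ d)
    (hd : ∀ z ∈ Ω, ∀ w ∈ Ω, ‖z - w‖ ≤ d) :
    ∃ a > 0, ∀ y : ℝ, 1 ≤ y → a * y ≤ (K.q (f 0 (K.disc Y y))).re := by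
  have hs := K.s_pos
  have hlog : 0 < Real.log (8 * d / K.s) :=
    Real.log_pos (by rw [lt_div_iff₀ hs]; linarith)
  obtain ⟨κ, hκ⟩ : ∃ κ, κ = 1 / (3 * Real.log (8 * d / K.s)) := ⟨_, rfl⟩
  have hκ0 : 0 < κ := by rw [hκ]; positivity
  have hpk := K.peakAt_self h.mem_frontier
  obtain ⟨b, hb⟩ : ∃ b, b = K.v p (f 0 (K.disc Y (1 : ℂ))) := ⟨_, rfl⟩
  have hb0 : 0 < b := by
    rw [hb, v, (barrier_of_lt (D.v_lt 0 1 (by simp))).2]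
    have := K.re_P_neg h.isOpen h.mem_frontier (D.mem h 0 (w := 1) (by simp))
      (D.norm_lt 0 (by simp))
    linarith
  have hA := D.A_pos
  refine ⟨κ * b / 4 / (2 * A) ^ 2, by positivity, fun y hy => ?_⟩
  have hy0 : 0 < y := by linarith
  have h2 := hpk.hopf_halfPlane K.η_pos le_rfl hsd hd (φ := f 0 ∘ K.disc Y)
    ((h.diff 0).comp (K.disc_differentiableOn D.Y_pos.le) fun z hz => D.disc_mem h hz)
    (fun z hz => D.mem h 0 hz) (w₀ := 1) (by simp) (w₁ := y) (by simpa)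
  simp only [comp_apply] at h2
  rw [← hκ, ofReal_re, map_one, one_re, one_mul, (barrier_of_lt (D.v_lt 0 y (by simpa))).2] at h2
  change κ * K.v p _ * _ ≤ _ at h2
  rw [← hb] at h2
  have h3 : ‖(y : ℂ) + 1‖ = y + 1 := by
    rw [← ofReal_one, ← ofReal_add, Complex.norm_of_nonneg (by linarith)]
  rw [h3] at h2
  have h4 : κ * b / (4 * y) ≤ -(K.P p (f 0 (K.disc Y y))).re := by
    refine le_trans ?_ h2
    rw [← mul_div_assoc, div_le_div_iff₀ (by positivity) (by positivity)]
    have : (y + 1) ^ 2 ≤ (2 * y) ^ 2 := by gcongr; linarith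
    have hκb : 0 < κ * b := by positivity
    nlinarith
  have h5 := D.norm_P_le h 0 hy0
  have h6 : 0 < ‖K.P p (f 0 (K.disc Y y))‖ := norm_pos_iff.2
    (K.P_ne_zero h.isOpen h.mem_frontier (D.mem h 0 (by simpa)) (D.norm_lt 0 (by simpa)))
  rw [q, re_neg_inv]
  calc κ * b / 4 / (2 * A) ^ 2 * y = κ * b / (4 * y) / (2 * A / y) ^ 2 := by field_simp
    _ ≤ _ := by gcongr; exact le_trans (by positivity) h4

end FlowDisc

end LocalPeak

namespace LocalPeak.FlowDisc

variable {E : Type*} [NormedAddCommGroup E] [NormedSpace ℂ E] {Ω : Set E} {p : E}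
  {K : LocalPeak Ω p} {G f : ℕ → E → E} {ms : ℕ → ℕ} {d Y A : ℝ}

/-- Neighbouring discs have asymptotically equal reciprocal peak functions. -/
theorem exists_norm_q_sub_le (D : K.FlowDisc f Y A) (h : TangentFlow Ω p G f ms) (hsd : K.s ≤ d)
    (hd : ∀ z ∈ Ω, ∀ w ∈ Ω, ‖z - w‖ ≤ d) (l : ℕ) {ε : ℝ} (hε : 0 < ε) :
    ∃ y₀ : ℝ, 0 < y₀ ∧ ∀ y : ℝ, y₀ ≤ y → ∀ m,
      ‖K.q (f (m + l) (K.disc Y y)) - K.q (f m (K.disc Y y))‖ ≤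
        ε * (K.q (f m (K.disc Y y))).re := by
  have hC := K.C_pos
  have hs := K.s_pos
  have hη := K.η_pos
  have hA := D.A_pos
  have hY := D.Y_pos
  have hpk := K.peakAt_self h.mem_frontier
  obtain ⟨H, hH⟩ : ∃ H, H = (3 : ℝ) ^ ⌈4 * d / K.s⌉₊ := ⟨_, rfl⟩
  have hH0 : 0 < H := by rw [hH]; positivity
  obtain ⟨δ, hδ⟩ : ∃ δ, δ = min ε 1 / 4 := ⟨_, rfl⟩
  have hδ0 : 0 < δ := by rw [hδ]; positivity
  have hδε : 4 * δ ≤ ε := by rw [hδ]; linarith [min_le_left ε 1]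
  have hδ1 : 4 * δ ≤ 1 := by rw [hδ]; linarith [min_le_right ε 1]
  obtain ⟨y₀, hy₀, hG⟩ := K.norm_G_disc_sub_le h l (ε := δ / (4 * K.C)) (by positivity)
  obtain ⟨X, hX⟩ : ∃ X, X = H * A / (K.c * K.s ^ 2 / 4) := ⟨_, rfl⟩
  have hX0 : 0 < X := by rw [hX]; positivity
  refine ⟨y₀ + X + 1, by positivity, fun y hy m => ?_⟩
  have hy0 : 0 < y := by linarith
  have hyre : 0 < (y : ℂ).re := by simpa
  have hT0 : 0 < (y + Y)⁻¹ := by positivity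
  have hball := K.ball_disc_subset h.mem_frontier D.Y_ge hy0
  have hnear : ∀ z ∈ ball (K.disc Y y) ((y + Y)⁻¹ / (4 * K.C)), ‖f m z - p‖ < K.s := by
    intro z hz
    rw [mem_ball, dist_eq_norm] at hz
    have h1 := hpk.barrier_le_pow hη le_rfl hsd hd (φ := f m)
      (R := (y + Y)⁻¹ / (2 * K.C)) (by positivity)
      ((h.diff m).mono hball) ((h.maps m).mono_left hball) (ζ := z)
      (hz.le.trans (le_of_eq (by field_simp; norm_num)))
    rw [← hH] at h1
    refine (barrier_of_lt (h1.trans_lt ?_)).1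
    have h2 := D.v_le m y hyre
    rw [ofReal_re] at h2
    calc _ ≤ H * (A / y) := by gcongr; exact h2
      _ = H * A / y := by ring
      _ < _ := by
        rw [div_lt_iff₀ hy0, ← div_lt_iff₀' hη, ← hX]; linarith
  have hsub : ball (K.disc Y y) ((y + Y)⁻¹ / (4 * K.C)) ⊆ Ω :=
    (ball_subset_ball (by gcongr; norm_num)).trans hball
  have hGn := hG Y D.Y_ge y (by linarith)
  have hlt : δ / (4 * K.C) * (y + Y)⁻¹ < (y + Y)⁻¹ / (4 * K.C) := by
    rw [div_mul_eq_mul_div]; gcongr; nlinarith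
  have key := norm_sub_le_of_re_nonneg (f := fun z => K.q (f m z)) (c := K.disc Y y)
    (z := G l (K.disc Y y)) (R := (y + Y)⁻¹ / (4 * K.C)) ?_
    (fun z hz => (K.re_q_pos h.isOpen h.mem_frontier (h.maps m (hsub hz)) (hnear z hz)).le)
    (by rw [mem_ball, dist_eq_norm]; exact hGn.trans_lt hlt)
  · rw [h.f_G l m _ (D.disc_mem h hyre)] at key
    refine key.trans ?_
    have hq0 := D.re_q_pos h m hyre
    rw [div_le_iff₀ (by linarith)]
    calc _ ≤ 2 * (K.q (f m (K.disc Y y))).re * (δ / (4 * K.C) * (y + Y)⁻¹) := by gcongr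
      _ = (K.q (f m (K.disc Y y))).re * ((y + Y)⁻¹ / (4 * K.C)) * (2 * δ) := by ring
      _ ≤ (K.q (f m (K.disc Y y))).re * ((y + Y)⁻¹ / (4 * K.C)) * (ε * (1 - δ)) := by
        have : 2 * δ ≤ ε * (1 - δ) := by nlinarith
        gcongr
      _ = ε * (K.q (f m (K.disc Y y))).re *
          ((y + Y)⁻¹ / (4 * K.C) - δ / (4 * K.C) * (y + Y)⁻¹) := by ring
      _ ≤ _ := by gcongr
  · refine ((hpk.diff.comp_differentiableOn ((h.diff m).mono hsub)).inv fun z hz => ?_).neg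
    exact K.P_ne_zero h.isOpen h.mem_frontier (h.maps m (hsub hz)) (hnear z hz)

/-- All the discs `f m ∘ disc Y` have the same angular derivative at `p`. -/
theorem exists_growth (D : K.FlowDisc f Y A) (h : TangentFlow Ω p G f ms) (hsd : K.s ≤ d)
    (hd : ∀ z ∈ Ω, ∀ w ∈ Ω, ‖z - w‖ ≤ d) :
    ∃ a > 0, ∀ m,
      Tendsto (fun y : ℝ => (K.q (f m (K.disc Y y))).re / y) atTop (𝓝 a) := by
  obtain ⟨a, ha⟩ := halfPlane_tendsto_re_div (D.q_diff h 0) fun w hw => (D.re_q_pos h 0 hw).le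
  refine ⟨a, ?_, fun m => ?_⟩
  · obtain ⟨a', ha', hle⟩ := D.exists_le_re_q h hsd hd
    refine ha'.trans_le (ge_of_tendsto ha ?_)
    filter_upwards [eventually_ge_atTop (1 : ℝ)] with y hy
    rw [le_div_iff₀ (by linarith)]
    exact hle y hy
  · have h1 : Tendsto (fun y : ℝ => (K.q (f m (K.disc Y y))).re / y -
        (K.q (f 0 (K.disc Y y))).re / y) atTop (𝓝 0) := by
      rw [Metric.tendsto_nhds]
      intro ε hε
      obtain ⟨b, hb⟩ : ∃ b, b = |a| + 1 := ⟨_, rfl⟩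
      have hb0 : 0 < b := by rw [hb]; positivity
      obtain ⟨y₀, hy₀, hr⟩ := D.exists_norm_q_sub_le h hsd hd m (ε := ε / (2 * b)) (by positivity)
      have hev : ∀ᶠ y : ℝ in atTop, (K.q (f 0 (K.disc Y y))).re / y < b :=
        ha.eventually_lt_const (by rw [hb]; linarith [le_abs_self a])
      filter_upwards [eventually_ge_atTop y₀, hev] with y hy hyb
      have hy0 : 0 < y := by linarith
      have h2 := hr y hy 0
      rw [zero_add] at h2
      have h3 := (abs_re_le_norm _).trans h2
      rw [sub_re] at h3
      rw [div_lt_iff₀ hy0] at hyb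
      rw [Real.dist_eq, sub_zero, ← sub_div, abs_div, abs_of_pos hy0, div_lt_iff₀ hy0]
      calc _ ≤ _ := h3
        _ ≤ ε / (2 * b) * (b * y) := by gcongr
        _ = ε / 2 * y := by field_simp
        _ < _ := by gcongr; linarith
    simpa using h1.add ha

end LocalPeak.FlowDisc

theorem exists_pos_forall_le (L : ℕ) {δ : ℕ → ℝ} (hδ : ∀ l, 0 < δ l) :
    ∃ c > 0, ∀ l ≤ L, c ≤ δ l := by
  obtain ⟨k, -, hk⟩ := Finset.exists_min_image (Finset.range (L + 1)) δ ⟨0, by simp⟩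
  exact ⟨δ k, hδ k, fun l hl => hk l (Finset.mem_range_succ_iff.2 hl)⟩

/-- The orbit of a point of the retract stays away from the tangency point `p`. -/
theorem TangentFlow.exists_le_norm_sub {E : Type*} [NormedAddCommGroup E] [NormedSpace ℂ E]
    [FiniteDimensional ℂ E] {Ω : Set E} {p : E} {G f : ℕ → E → E} {ms : ℕ → ℕ}
    (h : TangentFlow Ω p G f ms) {x : E} (hx : x ∈ Ω) (hfx : f 0 x = x) :
    ∃ b > 0, ∀ m, b ≤ ‖f m x - p‖ := by
  have hxp := LocalPeak.norm_sub_pos h.isOpen h.mem_frontier hx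
  obtain ⟨L, hL⟩ := h.exists_syndetic_return hx hfx (half_pos hxp)
  choose δ hδ0 hδ using fun l => h.G_tangent l 1 one_pos
  obtain ⟨b, hb, hbδ⟩ := exists_pos_forall_le L hδ0
  refine ⟨min b (‖x - p‖ / 4), by positivity, fun m => ?_⟩
  by_contra! hlt
  obtain ⟨l, hl, hret⟩ := hL m
  have h1 := hδ l (f m x) (h.maps m hx)
    ((hlt.trans_le (min_le_left _ _)).trans_le (hbδ l hl))
  rw [h.G_f l m x hx, one_mul] at h1
  have h2 := hlt.trans_le (min_le_right _ _)
  have h3 : ‖x - p‖ ≤ ‖f (m + l) x - x‖ + ‖f (m + l) x - f m x‖ + ‖f m x - p‖ := by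
    rw [norm_sub_rev (f (m + l) x) x]
    calc ‖x - p‖ = ‖(x - f (m + l) x) + (f (m + l) x - f m x) + (f m x - p)‖ := by congr 1; abel
      _ ≤ _ := norm_add₃_le
  linarith

namespace LocalPeak.FlowDisc

variable {E : Type*} [NormedAddCommGroup E] [NormedSpace ℂ E] {Ω : Set E} {p : E}
  {K : LocalPeak Ω p} {G f : ℕ → E → E} {ms : ℕ → ℕ} {d Y A a : ℝ}

theorem exists_forall_re_q_le [FiniteDimensional ℂ E] (D : K.FlowDisc f Y A)
    (h : TangentFlow Ω p G f ms) (hsd : K.s ≤ d) (hd : ∀ z ∈ Ω, ∀ w ∈ Ω, ‖z - w‖ ≤ d) (ha : 0 < a)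
    (hgrow : ∀ m, Tendsto (fun y : ℝ => (K.q (f m (K.disc Y y))).re / y) atTop (𝓝 a))
    {ε : ℝ} (hε : 0 < ε) :
    ∃ y₁ : ℝ, 0 < y₁ ∧ ∀ y : ℝ, y₁ ≤ y → ∀ m, (K.q (f m (K.disc Y y))).re ≤ (a + ε) * y := by
  obtain ⟨y', hy', hy'0⟩ := (((hgrow 0).eventually_lt_const (show a < a + ε / 4 by linarith)).and
    (eventually_gt_atTop (0 : ℝ))).exists
  have hyre : 0 < (y' : ℂ).re := by simpa
  have hdm := D.disc_mem h hyre
  obtain ⟨x, hx⟩ : ∃ x, x = f 0 (K.disc Y y') := ⟨_, rfl⟩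
  have hxΩ : x ∈ Ω := hx ▸ D.mem h 0 hyre
  have hfx : f 0 x = x := by rw [hx, h.add 0 0 _ hdm]
  have hfm : ∀ m, f m x = f m (K.disc Y y') := fun m => by rw [hx, h.add m 0 _ hdm, add_zero]
  have hxs : ‖x - p‖ < K.s := hx ▸ D.norm_lt 0 hyre
  have hcont : ContinuousAt (fun z => (K.q z).re) x := by
    refine continuous_re.continuousAt.comp (ContinuousAt.neg ?_)
    exact ContinuousAt.inv₀ (K.peakAt_self h.mem_frontier).diff.continuous.continuousAt
      (K.P_ne_zero h.isOpen h.mem_frontier hxΩ hxs)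
  rw [div_lt_iff₀ hy'0, ← hx] at hy'
  obtain ⟨δ, hδ, hball⟩ := Metric.eventually_nhds_iff.1 (hcont.eventually_lt_const
    (show (K.q x).re < (a + ε / 2) * y' by nlinarith))
  obtain ⟨L, hL⟩ := h.exists_syndetic_return hxΩ hfx (half_pos hδ)
  obtain ⟨ε₁, hε₁⟩ : ∃ ε₁, ε₁ = ε / 2 / (a + ε) := ⟨_, rfl⟩
  have hε₁0 : 0 < ε₁ := by rw [hε₁]; positivity
  have hmul : (a + ε) * (1 - ε₁) = a + ε / 2 := by rw [hε₁]; field_simp; ring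
  have hε₁1 : 0 < 1 - ε₁ := by
    refine pos_of_mul_pos_right (a := a + ε) ?_ (by positivity)
    rw [hmul]; positivity
  choose Z hZ0 hZ using fun l => D.exists_norm_q_sub_le h hsd hd l hε₁0
  have hZle : ∀ l ≤ L, Z l ≤ ∑ k ∈ Finset.range (L + 1), Z k := fun l hl =>
    Finset.single_le_sum (fun k _ => (hZ0 k).le) (Finset.mem_range_succ_iff.2 hl)
  refine ⟨y' + ∑ k ∈ Finset.range (L + 1), Z k,
    add_pos_of_pos_of_nonneg hy'0 (Finset.sum_nonneg fun k _ => (hZ0 k).le), fun y hy m => ?_⟩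
  obtain ⟨l, hl, hret⟩ := hL m
  have hZl := hZle l hl
  have hyy : y' ≤ y := by linarith [hZ0 l]
  have hy0 : 0 < y := by linarith
  have h1 : (K.q (f (m + l) (K.disc Y y'))).re < (a + ε / 2) * y' := by
    rw [← hfm]
    refine hball ?_
    rw [dist_eq_norm]
    linarith
  have h2 := halfPlane_re_div_antitone (D.q_diff h (m + l))
    (fun w hw => (D.re_q_pos h (m + l) hw).le) hy'0 hyy
  have h3 := h2.trans ((div_lt_iff₀ hy'0).2 h1).le
  rw [div_le_iff₀ hy0] at h3
  have h4 := (abs_re_le_norm _).trans (hZ l y (by linarith) m)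
  rw [sub_re] at h4
  have h5 := (abs_le.1 h4).1
  refine le_of_mul_le_mul_right ?_ hε₁1
  calc _ ≤ (a + ε / 2) * y := by linarith
    _ = _ := by rw [← hmul]; ring

/-- The reciprocal peak functions along the discs are asymptotic to `a * y`, uniformly in `m`. -/
theorem exists_norm_q_sub_mul_le [FiniteDimensional ℂ E] (D : K.FlowDisc f Y A)
    (h : TangentFlow Ω p G f ms) (hsd : K.s ≤ d) (hd : ∀ z ∈ Ω, ∀ w ∈ Ω, ‖z - w‖ ≤ d) (ha : 0 < a)
    (hgrow : ∀ m, Tendsto (fun y : ℝ => (K.q (f m (K.disc Y y))).re / y) atTop (𝓝 a))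
    {ε : ℝ} (hε : 0 < ε) :
    ∃ y₁ : ℝ, 0 < y₁ ∧ ∀ y : ℝ, y₁ ≤ y → ∀ m, ‖K.q (f m (K.disc Y y)) - a * y‖ ≤ ε * y := by
  have hc := K.c_pos
  obtain ⟨y₁, hy₁, hle⟩ := D.exists_forall_re_q_le h hsd hd ha hgrow (ε := ε / 4) (by positivity)
  have hyre : 0 < (y₁ : ℂ).re := by simpa
  have hdm := D.disc_mem h hyre
  obtain ⟨b, hb, hbm⟩ := h.exists_le_norm_sub (D.mem h 0 hyre) (h.add 0 0 _ hdm)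
  obtain ⟨M, hM⟩ : ∃ M, M = (K.c * b ^ 2)⁻¹ + a * y₁ := ⟨_, rfl⟩
  have hM0 : 0 < M := by rw [hM]; positivity
  refine ⟨y₁ + 2 * M / ε, by positivity, fun y hy m => ?_⟩
  have hMε : 0 < 2 * M / ε := by positivity
  have hy1 : y₁ ≤ y := by linarith
  have h1 := halfPlane_norm_sub_le (f := fun w => K.q (f m (K.disc Y w)) - a * w)
    ((D.q_diff h m).sub (by fun_prop)) (fun w hw => ?_) hy₁ (ε := ε / 4) (fun z hz => ?_) hy1
  · have h2 : ‖K.q (f m (K.disc Y y₁))‖ ≤ (K.c * b ^ 2)⁻¹ := by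
      rw [q, norm_neg, norm_inv]
      gcongr
      have h3 := hbm m
      rw [h.add m 0 _ hdm, add_zero] at h3
      have h4 := K.sq_le_neg_re_P h.mem_frontier (D.mem h m hyre) (D.norm_lt m hyre)
      calc K.c * b ^ 2 ≤ K.c * ‖f m (K.disc Y y₁) - p‖ ^ 2 := by gcongr
        _ ≤ _ := h4
        _ ≤ _ := by rw [← neg_re, ← norm_neg]; exact re_le_norm _
    have h5 : ‖(a : ℂ) * y₁‖ = a * y₁ := by
      rw [← ofReal_mul, Complex.norm_of_nonneg (by positivity)]
    have h6 := (norm_sub_le (K.q (f m (K.disc Y y₁))) ((a : ℂ) * y₁)).trans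
      (add_le_add h2 h5.le)
    rw [← hM] at h6
    have h7 : 2 * M ≤ ε * y := by
      rw [← div_le_iff₀' hε]; linarith
    have h8 := norm_le_norm_add_norm_sub (K.q (f m (K.disc Y y₁)) - a * y₁)
      (K.q (f m (K.disc Y y)) - a * y)
    rw [norm_sub_rev] at h1
    nlinarith
  · have := halfPlane_julia (D.q_diff h m) (fun w hw => (D.re_q_pos h m hw).le) (hgrow m) hw
    simp only [sub_re, re_ofReal_mul]
    linarith
  · have := hle z hz m
    simp only [sub_re, re_ofReal_mul, ofReal_re]
    linarith

/-- Julia inequality for the tangential component of a disc at `p`. -/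
theorem sq_div_sq_le (D : K.FlowDisc f Y A) (h : TangentFlow Ω p G f ms) (ha : 0 < a) {m : ℕ}
    (hgrow : Tendsto (fun y : ℝ => (K.q (f m (K.disc Y y))).re / y) atTop (𝓝 a))
    {w : ℂ} (hw : 0 < w.re) :
    K.c * (‖f m (K.disc Y w) - p‖ / ‖K.P p (f m (K.disc Y w))‖) ^ 2 ≤
      (K.q (f m (K.disc Y w))).re - a * w.re := by
  have hc := K.c_pos
  obtain ⟨e, he, hew⟩ := exists_dual_vector'' ℂ (f m (K.disc Y w) - p)
  obtain ⟨N, hN⟩ : ∃ N : ℂ → ℂ, N = fun w =>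
    e (f m (K.disc Y w) - p) / K.P p (f m (K.disc Y w)) := ⟨_, rfl⟩
  have hNd : DifferentiableOn ℂ N {w | 0 < w.re} := by
    rw [hN]
    refine DifferentiableOn.div ?_ (D.P_diff h m) fun z hz =>
      K.P_ne_zero h.isOpen h.mem_frontier (D.mem h m hz) (D.norm_lt m hz)
    exact e.differentiable.comp_differentiableOn (((h.diff m).comp
      (K.disc_differentiableOn D.Y_pos.le) fun _ hw => D.disc_mem h hw).sub_const p)
  have hNle : ∀ z : ℂ, 0 < z.re → K.c * ‖N z‖ ^ 2 ≤ (K.q (f m (K.disc Y z))).re := by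
    intro z hz
    have h1 := K.sq_le_neg_re_P h.mem_frontier (D.mem h m hz) (D.norm_lt m hz)
    rw [q, re_neg_inv, hN]
    simp only
    rw [norm_div, div_pow, ← mul_div_assoc]
    gcongr
    refine le_trans ?_ h1
    gcongr
    exact (e.le_of_opNorm_le he _).trans (by rw [one_mul])
  obtain ⟨α, hα⟩ : ∃ α, α = (starRingEnd ℂ) (N w) := ⟨_, rfl⟩
  have hS := halfPlane_julia
    (f := fun z => K.q (f m (K.disc Y z)) - ((2 * K.c : ℝ) : ℂ) * (α * N z) + (K.c * ‖α‖ ^ 2 : ℝ))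
    (L := a) (w := w) (((D.q_diff h m).sub ((hNd.const_mul _).const_mul _)).add_const _) (fun z hz => ?_) ?_ hw
  · have h2 : α * N w = ((‖N w‖ ^ 2 : ℝ) : ℂ) := by
      rw [hα, mul_comm, mul_conj, normSq_eq_norm_sq]
    have h3 : ‖α‖ = ‖N w‖ := by rw [hα, RCLike.norm_conj]
    have h4 : ‖N w‖ = ‖f m (K.disc Y w) - p‖ / ‖K.P p (f m (K.disc Y w))‖ := by
      rw [hN]; simp [hew]
    simp only [add_re, sub_re, re_ofReal_mul, ofReal_re, h2] at hS
    rw [h3, h4] at hS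
    linarith
  · simp only [add_re, sub_re, re_ofReal_mul, ofReal_re]
    have h2 := hNle z hz
    have h3 : (α * N z).re ≤ ‖α‖ * ‖N z‖ := (re_le_norm _).trans (norm_mul _ _).le
    have h4 : 0 ≤ K.c * (‖α‖ - ‖N z‖) ^ 2 := by positivity
    nlinarith
  · have h1 : Tendsto (fun y : ℝ => N y / y) atTop (𝓝 0) := by
      have h2 : Tendsto (fun y : ℝ => Real.sqrt ((a + 1) / K.c * y⁻¹)) atTop (𝓝 0) := by
        have := (Real.continuous_sqrt.tendsto _).comp
          (tendsto_inv_atTop_zero.const_mul ((a + 1) / K.c))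
        simpa [comp_def] using this
      refine squeeze_zero_norm' ?_ h2
      filter_upwards [eventually_gt_atTop (0 : ℝ),
        hgrow.eventually_lt_const (show a < a + 1 by linarith)] with y hy hlt
      refine Real.le_sqrt_of_sq_le ?_
      rw [div_lt_iff₀ hy] at hlt
      have h3 := (hNle y (by simpa)).trans hlt.le
      rw [norm_div, Complex.norm_of_nonneg hy.le, div_pow, div_mul_eq_mul_div, div_le_div_iff₀
        (by positivity) hc]
      calc _ = K.c * ‖N y‖ ^ 2 := by ring
        _ ≤ _ := h3
        _ = _ := by field_simp
    have h2 := (continuous_re.tendsto _).comp (h1.const_mul α)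
    have h3 := (hgrow.sub (h2.const_mul (2 * K.c))).add
      (tendsto_inv_atTop_zero.const_mul (K.c * ‖α‖ ^ 2))
    simp only [mul_zero, zero_re, sub_zero, add_zero] at h3
    refine h3.congr fun y => ?_
    simp only [comp_apply, add_re, sub_re, re_ofReal_mul, ofReal_re]
    rw [← mul_div_assoc, div_ofReal_re]
    ring

theorem exists_mul_sq_norm_le [FiniteDimensional ℂ E] (D : K.FlowDisc f Y A)
    (h : TangentFlow Ω p G f ms) (hsd : K.s ≤ d) (hd : ∀ z ∈ Ω, ∀ w ∈ Ω, ‖z - w‖ ≤ d) (ha : 0 < a)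
    (hgrow : ∀ m, Tendsto (fun y : ℝ => (K.q (f m (K.disc Y y))).re / y) atTop (𝓝 a))
    {ε : ℝ} (hε : 0 < ε) :
    ∃ y₁ : ℝ, 0 < y₁ ∧ ∀ y : ℝ, y₁ ≤ y → ∀ m, ‖f m (K.disc Y y) - p‖ ^ 2 ≤ ε / y := by
  have hc := K.c_pos
  have hA := D.A_pos
  obtain ⟨y₁, hy₁, hle⟩ := D.exists_forall_re_q_le h hsd hd ha hgrow
    (ε := ε * K.c / (2 * A) ^ 2) (by positivity)
  refine ⟨y₁, hy₁, fun y hy m => ?_⟩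
  have hy0 : 0 < y := by linarith
  have hyre : 0 < (y : ℂ).re := by simpa
  have h1 := D.sq_div_sq_le h ha (hgrow m) hyre
  rw [ofReal_re] at h1
  have h2 := hle y hy m
  have h3 := D.norm_P_le h m hy0
  have h4 : 0 < ‖K.P p (f m (K.disc Y y))‖ := norm_pos_iff.2
    (K.P_ne_zero h.isOpen h.mem_frontier (D.mem h m hyre) (D.norm_lt m hyre))
  have h5 : K.c * (‖f m (K.disc Y y) - p‖ / (2 * A / y)) ^ 2 ≤ ε * K.c / (2 * A) ^ 2 * y := by
    calc _ ≤ K.c * (‖f m (K.disc Y y) - p‖ / ‖K.P p (f m (K.disc Y y))‖) ^ 2 := by gcongr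
      _ ≤ _ := by linarith
  rw [le_div_iff₀ hy0]
  have h6 : K.c * (‖f m (K.disc Y y) - p‖ / (2 * A / y)) ^ 2 =
      ‖f m (K.disc Y y) - p‖ ^ 2 * y * (K.c * y / (2 * A) ^ 2) := by field_simp
  rw [h6] at h5
  refine le_of_mul_le_mul_right (h5.trans (le_of_eq ?_)) (by positivity : 0 < K.c * y / (2 * A) ^ 2)
  ring

theorem exists_norm_P_add_le [FiniteDimensional ℂ E] (D : K.FlowDisc f Y A)
    (h : TangentFlow Ω p G f ms) (hsd : K.s ≤ d) (hd : ∀ z ∈ Ω, ∀ w ∈ Ω, ‖z - w‖ ≤ d) (ha : 0 < a)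
    (hgrow : ∀ m, Tendsto (fun y : ℝ => (K.q (f m (K.disc Y y))).re / y) atTop (𝓝 a))
    {ε : ℝ} (hε : 0 < ε) :
    ∃ y₁ : ℝ, 0 < y₁ ∧ ∀ y : ℝ, y₁ ≤ y → ∀ m,
      ‖K.P p (f m (K.disc Y y)) + ((a * (y + Y))⁻¹ : ℝ)‖ ≤ ε / y := by
  have hA := D.A_pos
  have hY := D.Y_pos
  obtain ⟨ε', hε'⟩ : ∃ ε', ε' = ε * a / (4 * A) := ⟨_, rfl⟩
  have hε'0 : 0 < ε' := by rw [hε']; positivity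
  obtain ⟨y₁, hy₁, hle⟩ := D.exists_norm_q_sub_mul_le h hsd hd ha hgrow hε'0
  refine ⟨y₁ + a * Y / ε', by positivity, fun y hy m => ?_⟩
  have h0 : 0 < a * Y / ε' := by positivity
  have hy0 : 0 < y := by linarith
  have hyre : 0 < (y : ℂ).re := by simpa
  have haY : a * Y ≤ ε' * y := by rw [← div_le_iff₀' hε'0]; linarith
  have h1 := hle y (by linarith) m
  have h3 := D.norm_P_le h m hy0
  have hP := K.P_ne_zero h.isOpen h.mem_frontier (D.mem h m hyre) (D.norm_lt m hyre)
  have hb : 0 < a * (y + Y) := by positivity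
  have h4 : ‖K.q (f m (K.disc Y y)) - (a * (y + Y) : ℝ)‖ ≤ 2 * ε' * y := by
    have h5 : K.q (f m (K.disc Y y)) - (a * (y + Y) : ℝ) =
        (K.q (f m (K.disc Y y)) - a * y) - (a * Y : ℝ) := by push_cast; ring
    rw [h5]
    refine (norm_sub_le _ _).trans ?_
    rw [Complex.norm_of_nonneg (by positivity)]
    linarith
  have h6 : K.P p (f m (K.disc Y y)) + ((a * (y + Y))⁻¹ : ℝ) =
      K.P p (f m (K.disc Y y)) * ((a * (y + Y))⁻¹ : ℝ) *
        -(K.q (f m (K.disc Y y)) - (a * (y + Y) : ℝ)) := by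
    have : ((a * (y + Y) : ℝ) : ℂ) ≠ 0 := ofReal_ne_zero.2 hb.ne'
    rw [q, ofReal_inv]
    field_simp
    ring
  rw [h6, norm_mul, norm_mul, norm_neg, Complex.norm_of_nonneg (by positivity)]
  calc _ ≤ 2 * A / y * (a * (y + Y))⁻¹ * (2 * ε' * y) := by gcongr
    _ ≤ 2 * A / y * (a * y)⁻¹ * (2 * ε' * y) := by gcongr; linarith
    _ = _ := by rw [hε']; field_simp; ring

end LocalPeak.FlowDisc

/-- Uniform asymptotics of a tangent flow along the inner normal at `p`. -/
theorem LocalPeak.exists_normal_asymptotics {E : Type*} [NormedAddCommGroup E] [NormedSpace ℂ E]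
    [FiniteDimensional ℂ E] {Ω : Set E} {p : E} (K : LocalPeak Ω p) {G f : ℕ → E → E} {ms : ℕ → ℕ}
    {d : ℝ} (h : TangentFlow Ω p G f ms) (hsd : K.s ≤ d) (hd : ∀ z ∈ Ω, ∀ w ∈ Ω, ‖z - w‖ ≤ d) :
    ∃ b > 0, ∀ ε > 0, ∃ t₀ > 0, ∀ t : ℝ, 0 < t → t < t₀ → ∀ m,
      ‖K.P p (f m (p - (t : ℂ) • K.ν)) + ((b * t : ℝ) : ℂ)‖ ≤ ε * t ∧
        ‖f m (p - (t : ℂ) • K.ν) - p‖ ^ 2 ≤ ε * t := by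
  obtain ⟨Y, A, D⟩ := K.exists_flowDisc h hsd hd
  obtain ⟨a, ha, hgrow⟩ := D.exists_growth h hsd hd
  have hY := D.Y_pos
  refine ⟨a⁻¹, by positivity, fun ε hε => ?_⟩
  obtain ⟨y₁, hy₁, h1⟩ := D.exists_norm_P_add_le h hsd hd ha hgrow (half_pos hε)
  obtain ⟨y₂, hy₂, h2⟩ := D.exists_mul_sq_norm_le h hsd hd ha hgrow (half_pos hε)
  refine ⟨(y₁ + y₂ + 2 * Y)⁻¹, by positivity, fun t ht ht' m => ?_⟩
  have ht2 : y₁ + y₂ + 2 * Y < t⁻¹ := (lt_inv_comm₀ ht (by positivity)).1 ht'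
  obtain ⟨y, hy⟩ : ∃ y, y = t⁻¹ - Y := ⟨_, rfl⟩
  have hyt : (y + Y)⁻¹ = t := by rw [hy]; simp
  have hdisc : p - (t : ℂ) • K.ν = K.disc Y y := by rw [disc_ofReal, hyt]
  have hy0 : 0 < y := by linarith
  have hle : ε / 2 / y ≤ ε * t := by
    rw [div_le_iff₀ hy0]
    have h3 : 1 ≤ t * (2 * y) := by
      calc 1 = t * t⁻¹ := by field_simp
        _ ≤ _ := by gcongr; linarith
    nlinarith
  rw [hdisc]
  refine ⟨le_trans ?_ ((h1 y (by linarith) m).trans hle), (h2 y (by linarith) m).trans hle⟩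
  rw [mul_inv, hyt]

namespace LocalPeak

variable {E : Type*} [NormedAddCommGroup E] [NormedSpace ℂ E] {Ω : Set E} {p : E}
  (K : LocalPeak Ω p) {G f : ℕ → E → E} {ms : ℕ → ℕ} {d : ℝ}

/-- The nonisotropic dilation by `τ ^ 2` in the normal and by `τ` in the tangential directions. -/
def dil (τ : ℝ) : E →L[ℂ] E :=
  (τ : ℂ) • ContinuousLinearMap.id ℂ E + ((τ ^ 2 - τ : ℝ) : ℂ) • (K.ℓ p).smulRight K.ν

theorem dil_apply (τ : ℝ) (x : E) :
    K.dil τ x = (τ : ℂ) • x + ((τ ^ 2 - τ : ℝ) : ℂ) • K.ℓ p x • K.ν := by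
  simp [dil]

theorem dil_apply' (τ : ℝ) (x : E) :
    K.dil τ x = (τ : ℂ) • (x - K.ℓ p x • K.ν) + ((τ : ℂ) ^ 2 * K.ℓ p x) • K.ν := by
  rw [dil_apply]; push_cast; module

theorem ℓ_dil (τ : ℝ) (x : E) : K.ℓ p (K.dil τ x) = (τ : ℂ) ^ 2 * K.ℓ p x := by
  rw [dil_apply]
  simp only [map_add, map_smul, K.ℓ_ν, smul_eq_mul]
  push_cast
  ring

theorem dil_dil (τ σ : ℝ) (x : E) : K.dil τ (K.dil σ x) = K.dil (τ * σ) x := by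
  rw [dil_apply, ℓ_dil, dil_apply, dil_apply]
  push_cast
  module

theorem dil_one (x : E) : K.dil 1 x = x := by simp [dil_apply]

theorem dil_smul_ν (τ : ℝ) (b : ℂ) : K.dil τ (b • K.ν) = ((τ : ℂ) ^ 2 * b) • K.ν := by
  rw [dil_apply']
  simp [K.ℓ_ν]

theorem dil_inv_dil {τ : ℝ} (hτ : 0 < τ) (x : E) : K.dil τ⁻¹ (K.dil τ x) = x := by
  rw [dil_dil, inv_mul_cancel₀ hτ.ne', dil_one]

theorem dil_dil_inv {τ : ℝ} (hτ : 0 < τ) (x : E) : K.dil τ (K.dil τ⁻¹ x) = x := by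
  rw [dil_dil, mul_inv_cancel₀ hτ.ne', dil_one]

theorem norm_tangential_le (x : E) : ‖x - K.ℓ p x • K.ν‖ ≤ (1 + K.C ^ 2) * ‖x‖ := by
  have hC := K.C_pos
  refine (norm_sub_le _ _).trans ?_
  rw [norm_smul]
  calc ‖x‖ + ‖K.ℓ p x‖ * ‖K.ν‖ ≤ ‖x‖ + K.C * ‖x‖ * K.C := by
        gcongr
        · exact K.norm_ℓ_le x
        · exact K.norm_ν
    _ = _ := by ring

theorem norm_dil_le {τ : ℝ} (hτ : 0 < τ) (x : E) :
    ‖K.dil τ x‖ ≤ τ * ‖x - K.ℓ p x • K.ν‖ + τ ^ 2 * ‖K.ℓ p x‖ * K.C := by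
  rw [dil_apply']
  refine (norm_add_le _ _).trans ?_
  rw [norm_smul, norm_smul, norm_mul, norm_pow, Complex.norm_of_nonneg hτ.le]
  gcongr
  exact K.norm_ν

/-- A ball around the normal point `-b • ν` lies in all the rescaled domains. -/
theorem exists_ball_dil_subset (hp : p ∈ frontier Ω) {b : ℝ} (hb : 0 < b) :
    ∃ R > 0, ∀ᶠ τ : ℝ in 𝓝[>] 0, ball (-((b : ℂ) • K.ν)) R ⊆ {x | p + K.dil τ x ∈ Ω} := by
  have hC := K.C_pos
  have hs := K.s_pos
  obtain ⟨R, hR⟩ : ∃ R, R = min 1 (b / (16 * K.C * (1 + K.C ^ 2) ^ 2)) := ⟨_, rfl⟩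
  have hR0 : 0 < R := by rw [hR]; positivity
  have hR1 : R ≤ 1 := by rw [hR]; exact min_le_left _ _
  have hR2 : 16 * K.C * (1 + K.C ^ 2) ^ 2 * R ≤ b := by
    rw [← le_div_iff₀' (by positivity), hR]; exact min_le_right _ _
  have hCR : K.C * R ≤ b / 4 := by
    have : 1 ≤ (1 + K.C ^ 2) ^ 2 := one_le_pow₀ (by nlinarith)
    nlinarith [mul_pos hC hR0]
  obtain ⟨M, hM⟩ : ∃ M, M = (1 + K.C ^ 2) * R := ⟨_, rfl⟩
  have hM0 : 0 < M := by rw [hM]; positivity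
  have hM2 : K.C * (2 * M) ^ 2 ≤ b / 4 := by
    rw [hM]
    calc _ = 4 * K.C * (1 + K.C ^ 2) ^ 2 * R * R := by ring
      _ ≤ 4 * K.C * (1 + K.C ^ 2) ^ 2 * R * 1 := by gcongr
      _ ≤ _ := by linarith
  refine ⟨R, hR0, ?_⟩
  filter_upwards [Ioo_mem_nhdsGT (show 0 < min (M / (2 * b * K.C)) (K.s / (4 * M)) by positivity)]
    with τ ⟨hτ, hτ'⟩ x hx
  have hτ1 : τ * (2 * b * K.C) < M := by
    rw [← lt_div_iff₀ (by positivity)]; exact hτ'.trans_le (min_le_left _ _)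
  have hτ2 : τ * (4 * M) < K.s := by
    rw [← lt_div_iff₀ (by positivity)]; exact hτ'.trans_le (min_le_right _ _)
  obtain ⟨u, hu⟩ : ∃ u, x = -((b : ℂ) • K.ν) + u := ⟨x + (b : ℂ) • K.ν, by abel⟩
  have huR : ‖u‖ < R := by simpa [mem_ball, dist_eq_norm, hu] using hx
  have hℓ : K.ℓ p x = -b + K.ℓ p u := by simp [hu, K.ℓ_ν]
  have hℓu : ‖K.ℓ p u‖ ≤ b / 4 := (K.norm_ℓ_le u).trans (by nlinarith)
  have hT : x - K.ℓ p x • K.ν = u - K.ℓ p u • K.ν := by rw [hℓ, hu]; module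
  have hTn : ‖x - K.ℓ p x • K.ν‖ ≤ M := by
    rw [hT, hM]
    refine (K.norm_tangential_le u).trans ?_
    gcongr
  have hℓn : ‖K.ℓ p x‖ ≤ 2 * b := by
    rw [hℓ]
    refine (norm_add_le _ _).trans ?_
    rw [norm_neg, Complex.norm_of_nonneg hb.le]
    linarith
  have hn : ‖K.dil τ x‖ ≤ τ * (2 * M) := by
    refine (K.norm_dil_le hτ x).trans ?_
    calc _ ≤ τ * M + τ ^ 2 * (2 * b) * K.C := by gcongr
      _ = τ * (M + τ * (2 * b * K.C)) := by ring
      _ ≤ τ * (M + M) := by gcongr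
      _ = _ := by ring
  have hre : (K.ℓ p x).re ≤ -(3 / 4 * b) := by
    rw [hℓ, add_re, neg_re, ofReal_re]
    linarith [re_le_norm (K.ℓ p u)]
  refine K.mem p hp (by simpa using hs) _ ?_ ?_
  · rw [add_sub_cancel_left]
    nlinarith
  · rw [add_sub_cancel_left, ℓ_dil, ← ofReal_pow, re_ofReal_mul]
    calc _ ≤ τ ^ 2 * -(3 / 4 * b) + K.C * (τ * (2 * M)) ^ 2 := by gcongr
      _ = τ ^ 2 * (K.C * (2 * M) ^ 2 - 3 / 4 * b) := by ring
      _ < 0 := mul_neg_of_pos_of_neg (by positivity) (by linarith)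

/-- The map `φ` conjugated by the dilation centred at `p`. -/
def resc (τ : ℝ) (φ : E → E) (x : E) : E := K.dil τ⁻¹ (φ (p + K.dil τ x) - p)

/-- The rescaled domain. -/
def rescDomain (τ : ℝ) : Set E := {x | p + K.dil τ x ∈ Ω}

theorem dil_resc {τ : ℝ} (hτ : 0 < τ) (φ : E → E) (x : E) :
    p + K.dil τ (K.resc τ φ x) = φ (p + K.dil τ x) := by
  rw [resc, dil_dil_inv _ hτ]; abel

theorem resc_diff {τ : ℝ} {φ : E → E} (hφ : DifferentiableOn ℂ φ Ω) :
    DifferentiableOn ℂ (K.resc τ φ) (K.rescDomain τ) := by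
  refine (K.dil τ⁻¹).differentiable.comp_differentiableOn (DifferentiableOn.sub_const ?_ p)
  exact hφ.comp ((K.dil τ).differentiable.const_add p).differentiableOn fun x hx => hx

theorem resc_fderiv (hΩ : IsOpen Ω) {τ : ℝ} {φ : E → E} (hφ : DifferentiableOn ℂ φ Ω) {x : E}
    (hx : p + K.dil τ x ∈ Ω) :
    fderiv ℂ (K.resc τ φ) x = K.dil τ⁻¹ ∘L fderiv ℂ φ (p + K.dil τ x) ∘L K.dil τ := by
  have h1 : HasFDerivAt φ (fderiv ℂ φ (p + K.dil τ x)) (p + K.dil τ x) :=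
    (hφ.differentiableAt (hΩ.mem_nhds hx)).hasFDerivAt
  have h2 : HasFDerivAt (fun x => p + K.dil τ x) (K.dil τ) x := (K.dil τ).hasFDerivAt.const_add p
  exact ((K.dil τ⁻¹).hasFDerivAt.comp x ((h1.comp x h2).sub_const p)).fderiv

theorem resc_retractFlow (h : RetractFlow Ω f ms) {τ : ℝ} (hτ : 0 < τ) :
    RetractFlow (K.rescDomain τ) (fun m => K.resc τ (f m)) ms where
  isOpen := h.isOpen.preimage (by fun_prop)
  bdd := by
    obtain ⟨M, hM⟩ := h.bdd.exists_norm_le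
    refine isBounded_iff_forall_norm_le.2 ⟨‖K.dil τ⁻¹‖ * (M + ‖p‖), fun x hx => ?_⟩
    rw [← K.dil_inv_dil hτ x]
    refine ((K.dil τ⁻¹).le_opNorm _).trans ?_
    gcongr
    have h1 := hM _ hx
    calc ‖K.dil τ x‖ = ‖(p + K.dil τ x) - p‖ := by rw [add_sub_cancel_left]
      _ ≤ _ := norm_sub_le _ _
      _ ≤ _ := by gcongr
  diff m := K.resc_diff (h.diff m)
  maps m x hx := by
    show p + K.dil τ _ ∈ Ω
    rw [K.dil_resc hτ]
    exact h.maps m hx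
  add l m x hx := by
    rw [resc, K.dil_resc hτ, h.add l m _ hx, ← resc]
  ms_tendsto := h.ms_tendsto
  tendsto x hx := ((K.dil τ⁻¹).continuous.tendsto _).comp ((h.tendsto _ hx).sub_const p)

/-- Rescaled self-maps of `Ω` are bounded on a ball as soon as they are controlled at one point. -/
theorem exists_resc_bound (hp : p ∈ frontier Ω) (hsd : K.s ≤ d)
    (hd : ∀ z ∈ Ω, ∀ w ∈ Ω, ‖z - w‖ ≤ d) {A : ℝ} (hA : 0 < A) :
    ∃ M > 0, ∀ᶠ τ : ℝ in 𝓝[>] 0, ∀ φ : E → E, DifferentiableOn ℂ φ Ω →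
      MapsTo φ Ω Ω → ∀ (x : E) (R : ℝ), 0 < R → ball x R ⊆ K.rescDomain τ →
      ‖φ (p + K.dil τ x) - p‖ < K.s → ‖K.P p (φ (p + K.dil τ x))‖ ≤ A * τ ^ 2 →
      ∀ y ∈ ball x (R / 4), ‖K.resc τ φ y‖ ≤ M := by
  have hC := K.C_pos
  have hc := K.c_pos
  have hη := K.η_pos
  have hpk := K.peakAt_self hp
  obtain ⟨H, hH⟩ : ∃ H, H = (3 : ℝ) ^ ⌈4 * d / K.s⌉₊ := ⟨_, rfl⟩
  have hH0 : 0 < H := by rw [hH]; positivity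
  obtain ⟨M₁, hM₁⟩ : ∃ M₁, M₁ = 3 * A / K.c := ⟨_, rfl⟩
  have hM₁0 : 0 < M₁ := by rw [hM₁]; positivity
  refine ⟨(1 + K.C ^ 2) * √M₁ + (3 * A + K.C * M₁) * K.C, by positivity, ?_⟩
  filter_upwards [Ioo_mem_nhdsGT (show 0 < √(K.c * K.s ^ 2 / 4 / (H * A)) by positivity)]
    with τ ⟨hτ, hτ'⟩ φ hφ hmaps x R hR hball hnear hPx y hy
  have hτ2 : H * (A * τ ^ 2) < K.c * K.s ^ 2 / 4 := by
    have := (Real.lt_sqrt hτ.le).1 hτ'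
    rw [lt_div_iff₀ (by positivity)] at this
    linarith
  obtain ⟨ψ, hψ⟩ : ∃ ψ, ψ = fun x => φ (p + K.dil τ x) := ⟨_, rfl⟩
  have hψd : DifferentiableOn ℂ ψ (ball x R) := by
    rw [hψ]
    exact (hφ.comp ((K.dil τ).differentiable.const_add p).differentiableOn fun x hx => hx).mono hball
  have hψm : MapsTo ψ (ball x R) Ω := fun z hz => by rw [hψ]; exact hmaps (hball hz)
  have hψx : ψ x = φ (p + K.dil τ x) := by rw [hψ]
  rw [← hψx] at hnear hPx
  have hv : K.v p (ψ x) ≤ A * τ ^ 2 :=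
    ((barrier_le_neg_re hnear).trans (by rw [← neg_re, ← norm_neg]; exact re_le_norm _)).trans hPx
  have hs : ∀ z ∈ ball x (R / 2), ‖ψ z - p‖ < K.s := by
    intro z hz
    rw [mem_ball, dist_eq_norm] at hz
    have h1 := hpk.barrier_le_pow hη le_rfl hsd hd hR hψd hψm hz.le
    rw [← hH] at h1
    exact (barrier_of_lt (h1.trans_lt (lt_of_le_of_lt (by gcongr; exact hv) hτ2))).1
  have hsub : ball x (R / 2) ⊆ ball x R := ball_subset_ball (by linarith)
  have hyn : ‖y - x‖ < R / 4 := by rwa [mem_ball, dist_eq_norm] at hy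
  have hy2 : y ∈ ball x (R / 2) := ball_subset_ball (by linarith) hy
  have h1 := norm_sub_le_of_re_nonneg (f := fun z => -K.P p (ψ z)) (c := x) (z := y) (R := R / 2)
    (hpk.diff.comp_differentiableOn (hψd.mono hsub)).neg (fun z hz => by
      have := K.sq_le_neg_re_P hp (hψm (hsub hz)) (hs z hz)
      rw [neg_re]
      exact le_trans (by positivity) this) hy2
  have hre : (-K.P p (ψ x)).re ≤ A * τ ^ 2 := (re_le_norm _).trans (by rwa [norm_neg])
  have hP : ‖K.P p (ψ y)‖ ≤ 3 * A * τ ^ 2 := by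
    have h2 : 2 * (-K.P p (ψ x)).re * ‖y - x‖ / (R / 2 - ‖y - x‖) ≤ 2 * (A * τ ^ 2) := by
      rw [div_le_iff₀ (by linarith)]
      have : 0 ≤ A * τ ^ 2 := by positivity
      nlinarith [norm_nonneg (y - x)]
    have h3 : ‖K.P p (ψ y)‖ ≤ ‖K.P p (ψ x)‖ + ‖-K.P p (ψ y) - -K.P p (ψ x)‖ := by
      rw [neg_sub_neg]
      exact norm_le_norm_add_norm_sub _ _
    linarith
  obtain ⟨z, hz⟩ : ∃ z, z = ψ y - p := ⟨_, rfl⟩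
  have hz2 : ‖z‖ ^ 2 ≤ M₁ * τ ^ 2 := by
    have h2 := K.sq_le_neg_re_P hp (hψm (hsub hy2)) (hs y hy2)
    have h3 : -(K.P p (ψ y)).re ≤ ‖K.P p (ψ y)‖ := by
      rw [← neg_re, ← norm_neg]; exact re_le_norm _
    rw [hM₁, div_mul_eq_mul_div, le_div_iff₀ hc, hz]
    linarith
  have hz1 : ‖z‖ ≤ √M₁ * τ := by
    rw [← Real.sqrt_sq (norm_nonneg z), ← Real.sqrt_sq hτ.le, ← Real.sqrt_mul hM₁0.le]
    exact Real.sqrt_le_sqrt hz2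
  have hℓ : ‖K.ℓ p z‖ ≤ (3 * A + K.C * M₁) * τ ^ 2 := by
    have h2 : K.ℓ p z = K.P p (ψ y) - K.B z z := by rw [P, hz]; ring
    rw [h2]
    refine (norm_sub_le _ _).trans ?_
    calc _ ≤ 3 * A * τ ^ 2 + K.C * ‖z‖ * ‖z‖ := add_le_add hP (K.norm_B_le z z)
      _ = 3 * A * τ ^ 2 + K.C * ‖z‖ ^ 2 := by ring
      _ ≤ 3 * A * τ ^ 2 + K.C * (M₁ * τ ^ 2) := by gcongr
      _ = _ := by ring
  have h4 : K.resc τ φ y = K.dil τ⁻¹ z := by rw [resc, hz, hψ]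
  rw [h4]
  refine (K.norm_dil_le (by positivity) z).trans ?_
  calc _ ≤ τ⁻¹ * ((1 + K.C ^ 2) * (√M₁ * τ)) +
        τ⁻¹ ^ 2 * ((3 * A + K.C * M₁) * τ ^ 2) * K.C := by
        gcongr
        exact (K.norm_tangential_le z).trans (by gcongr)
    _ = _ := by field_simp

end LocalPeak

namespace LocalPeak

variable {E : Type*} [NormedAddCommGroup E] [NormedSpace ℂ E] {Ω : Set E} {p : E}
  (K : LocalPeak Ω p) {G f : ℕ → E → E} {ms : ℕ → ℕ} {d b : ℝ}

theorem norm_dil_inv_sub_le {τ ε : ℝ} (hτ : 0 < τ) (hε : 0 < ε) {z : E}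
    (hP : ‖K.P p z + ((b * τ ^ 2 : ℝ) : ℂ)‖ ≤ ε ^ 2 * τ ^ 2) (hz : ‖z - p‖ ^ 2 ≤ ε ^ 2 * τ ^ 2) :
    ‖K.dil τ⁻¹ (z - p) - -((b : ℂ) • K.ν)‖ ≤ ((1 + K.C ^ 2) + (1 + K.C) * K.C * ε) * ε := by
  have hC := K.C_pos
  have hz1 : ‖z - p‖ ≤ ε * τ := by
    rw [← mul_pow] at hz
    exact le_of_sq_le_sq hz (by positivity)
  have hℓ : ‖K.ℓ p (z - p) + ((b * τ ^ 2 : ℝ) : ℂ)‖ ≤ (1 + K.C) * ε ^ 2 * τ ^ 2 := by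
    have h2 : K.ℓ p (z - p) + ((b * τ ^ 2 : ℝ) : ℂ) =
        (K.P p z + ((b * τ ^ 2 : ℝ) : ℂ)) - K.B (z - p) (z - p) := by rw [P]; ring
    rw [h2]
    refine (norm_sub_le _ _).trans ?_
    calc _ ≤ ε ^ 2 * τ ^ 2 + K.C * ‖z - p‖ * ‖z - p‖ := add_le_add hP (K.norm_B_le _ _)
      _ = ε ^ 2 * τ ^ 2 + K.C * ‖z - p‖ ^ 2 := by ring
      _ ≤ ε ^ 2 * τ ^ 2 + K.C * (ε ^ 2 * τ ^ 2) := by gcongr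
      _ = _ := by ring
  have h3 : K.dil τ⁻¹ (z - p) - -((b : ℂ) • K.ν) =
      ((τ⁻¹ : ℝ) : ℂ) • (z - p - K.ℓ p (z - p) • K.ν) +
        (((τ⁻¹ ^ 2 : ℝ) : ℂ) * (K.ℓ p (z - p) + ((b * τ ^ 2 : ℝ) : ℂ))) • K.ν := by
    have h4 : ((τ⁻¹ ^ 2 : ℝ) : ℂ) * (K.ℓ p (z - p) + ((b * τ ^ 2 : ℝ) : ℂ)) =
        ((τ⁻¹ : ℝ) : ℂ) ^ 2 * K.ℓ p (z - p) + b := by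
      have : (τ : ℂ) ≠ 0 := ofReal_ne_zero.2 hτ.ne'
      push_cast
      field_simp
    rw [h4, dil_apply']
    module
  rw [h3]
  refine (norm_add_le _ _).trans ?_
  rw [norm_smul, norm_smul, norm_mul, Complex.norm_of_nonneg (by positivity),
    Complex.norm_of_nonneg (by positivity)]
  calc _ ≤ τ⁻¹ * ((1 + K.C ^ 2) * (ε * τ)) + τ⁻¹ ^ 2 * ((1 + K.C) * ε ^ 2 * τ ^ 2) * K.C := by
        gcongr
        · exact (K.norm_tangential_le _).trans (by gcongr)
        · exact K.norm_ν
    _ = _ := by field_simp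

theorem dil_neg_ν (τ : ℝ) : p + K.dil τ (-K.ν) = p - ((τ ^ 2 : ℝ) : ℂ) • K.ν := by
  have := K.dil_smul_ν τ (-1)
  rw [neg_one_smul] at this
  rw [this]
  push_cast
  module

theorem eventually_normal_mem (hp : p ∈ frontier Ω) {b : ℝ} (hb : 0 < b) :
    ∀ᶠ τ : ℝ in 𝓝[>] 0,
      ball (p - ((b * τ ^ 2 : ℝ) : ℂ) • K.ν) (b * τ ^ 2 / (2 * K.C)) ⊆ Ω := by
  have hC := K.C_pos
  have h1 : Tendsto (fun τ : ℝ => b * τ ^ 2) (𝓝[>] 0) (𝓝 0) := by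
    have : ContinuousAt (fun τ : ℝ => b * τ ^ 2) 0 := by fun_prop
    simpa using this.tendsto.mono_left nhdsWithin_le_nhds
  filter_upwards [self_mem_nhdsWithin, h1.eventually_lt_const
    (show 0 < 1 / (2 * K.C * (K.C + 1) ^ 2) by positivity),
    h1.eventually_lt_const (show 0 < K.s / (K.C + 1) by have := K.s_pos; positivity)]
    with τ hτ h2 h3
  have hτ0 : 0 < τ := hτ
  refine K.ball_subset hp (by positivity) ?_ ?_
  · rw [lt_div_iff₀' (by positivity)] at h2; exact h2.le
  · rwa [lt_div_iff₀' (by positivity)] at h3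

/-- The conclusion of the normal asymptotics: at the scale `τ`, the normal segment is mapped by
all `f m` to within `ε` of the normal point `p - b * τ ^ 2 • ν`. -/
def NormalAsymptotics (f : ℕ → E → E) (b : ℝ) : Prop :=
  ∀ ε > 0, ∀ᶠ τ : ℝ in 𝓝[>] 0, ∀ m,
    ‖K.P p (f m (p - ((τ ^ 2 : ℝ) : ℂ) • K.ν)) + ((b * τ ^ 2 : ℝ) : ℂ)‖ ≤ ε * τ ^ 2 ∧
      ‖f m (p - ((τ ^ 2 : ℝ) : ℂ) • K.ν) - p‖ ^ 2 ≤ ε * τ ^ 2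

theorem exists_normalAsymptotics [FiniteDimensional ℂ E] (h : TangentFlow Ω p G f ms)
    (hsd : K.s ≤ d) (hd : ∀ z ∈ Ω, ∀ w ∈ Ω, ‖z - w‖ ≤ d) :
    ∃ b > 0, K.NormalAsymptotics f b := by
  obtain ⟨b, hb, hε⟩ := K.exists_normal_asymptotics h hsd hd
  refine ⟨b, hb, fun ε hε0 => ?_⟩
  obtain ⟨t₀, ht₀, ht⟩ := hε ε hε0
  filter_upwards [Ioo_mem_nhdsGT (Real.sqrt_pos.2 ht₀)] with τ ⟨hτ, hτ'⟩ m
  exact ht _ (by positivity) ((Real.lt_sqrt hτ.le).1 hτ') m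

theorem NormalAsymptotics.eventually_resc_near {K : LocalPeak Ω p} (hn : K.NormalAsymptotics f b)
    {ε : ℝ} (hε : 0 < ε) :
    ∀ᶠ τ : ℝ in 𝓝[>] 0, ∀ m, ‖K.resc τ (f m) (-K.ν) - -((b : ℂ) • K.ν)‖ ≤ ε := by
  have hC := K.C_pos
  obtain ⟨D, hD⟩ : ∃ D, D = (1 + K.C ^ 2) + (1 + K.C) * K.C := ⟨_, rfl⟩
  have hD0 : 0 < D := by rw [hD]; positivity
  obtain ⟨e, he⟩ : ∃ e, e = min 1 (ε / D) := ⟨_, rfl⟩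
  have he0 : 0 < e := by rw [he]; positivity
  have he1 : e ≤ 1 := by rw [he]; exact min_le_left _ _
  have he2 : D * e ≤ ε := by rw [← le_div_iff₀' hD0, he]; exact min_le_right _ _
  filter_upwards [self_mem_nhdsWithin, hn (e ^ 2) (by positivity)] with τ hτ h1 m
  rw [resc, dil_neg_ν]
  refine (K.norm_dil_inv_sub_le hτ he0 (h1 m).1 (h1 m).2).trans (le_trans ?_ he2)
  rw [hD]
  have : (1 + K.C) * K.C * e ≤ (1 + K.C) * K.C := mul_le_of_le_one_right (by positivity) he1
  gcongr

/-- The rescaled flows are uniformly bounded on a fixed ball. -/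
theorem NormalAsymptotics.exists_flow_bound {K : LocalPeak Ω p} (hn : K.NormalAsymptotics f b)
    (hb : 0 < b) (h : TangentFlow Ω p G f ms) (hsd : K.s ≤ d)
    (hd : ∀ z ∈ Ω, ∀ w ∈ Ω, ‖z - w‖ ≤ d) :
    ∃ R > 0, ∃ M > 0, ∀ᶠ τ : ℝ in 𝓝[>] 0, ball (-((b : ℂ) • K.ν)) R ⊆ K.rescDomain τ ∧
      ∀ m, ∀ x ∈ ball (-((b : ℂ) • K.ν)) R, ‖K.resc τ (f m) x‖ ≤ M := by
  obtain ⟨R, hR, hball⟩ := K.exists_ball_dil_subset h.mem_frontier hb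
  obtain ⟨M, hM, hbd⟩ := K.exists_resc_bound h.mem_frontier hsd hd (show 0 < b + 1 by positivity)
  refine ⟨R / 16, by positivity, M, hM, ?_⟩
  have hs := K.s_pos
  filter_upwards [hball, hbd, hn.eventually_resc_near (show 0 < R / 32 by positivity),
    hn 1 one_pos, Ioo_mem_nhdsGT hs, K.eventually_normal_mem h.mem_frontier one_pos]
    with τ hball hbd hnear h1 ⟨hτ, hτs⟩ hmem
  refine ⟨(ball_subset_ball (by linarith)).trans hball, fun m y hy => ?_⟩
  obtain ⟨x, hx⟩ : ∃ x, x = K.resc τ (f 0) (-K.ν) := ⟨_, rfl⟩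
  have hν : p - ((τ ^ 2 : ℝ) : ℂ) • K.ν ∈ Ω := by
    rw [one_mul] at hmem
    have := K.C_pos
    exact hmem (mem_ball_self (by positivity))
  have hxp : f m (p + K.dil τ x) = f m (p - ((τ ^ 2 : ℝ) : ℂ) • K.ν) := by
    rw [hx, K.dil_resc hτ, dil_neg_ν, h.add m 0 _ hν, add_zero]
  have hxd : dist x (-((b : ℂ) • K.ν)) ≤ R / 32 := by rw [dist_eq_norm, hx]; exact hnear 0
  obtain ⟨h2, h3⟩ := h1 m
  refine hbd (f m) (h.diff m) (h.maps m) x (R / 2) (by positivity)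
    ((ball_subset_ball' (by linarith)).trans hball) ?_ ?_ y
    (ball_subset_ball' (by rw [dist_comm]; linarith) hy)
  · rw [hxp]
    refine lt_of_le_of_lt (le_of_sq_le_sq (h3.trans (le_of_eq (one_mul _))) hτ.le) hτs
  · rw [hxp]
    have h4 := norm_le_norm_add_norm_sub (-((b * τ ^ 2 : ℝ) : ℂ))
      (K.P p (f m (p - ((τ ^ 2 : ℝ) : ℂ) • K.ν)))
    rw [norm_neg, Complex.norm_of_nonneg (by positivity), ← norm_neg (-_ - _), neg_sub,
      sub_neg_eq_add] at h4
    linarith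

/-- At every small scale there is a point near `-b • ν` fixed by the whole rescaled flow. -/
theorem NormalAsymptotics.eventually_exists_fixedPoint [FiniteDimensional ℂ E] {K : LocalPeak Ω p}
    (hn : K.NormalAsymptotics f b) (h : TangentFlow Ω p G f ms) {R M : ℝ} (hR : 0 < R) (hM : 0 < M)
    (hbd : ∀ᶠ τ : ℝ in 𝓝[>] 0, ball (-((b : ℂ) • K.ν)) R ⊆ K.rescDomain τ ∧
      ∀ m, ∀ x ∈ ball (-((b : ℂ) • K.ν)) R, ‖K.resc τ (f m) x‖ ≤ M) {ε : ℝ} (hε : 0 < ε) :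
    ∀ᶠ τ : ℝ in 𝓝[>] 0, ∃ q ∈ ball (-((b : ℂ) • K.ν)) ε, ∀ m, K.resc τ (f m) q = q := by
  obtain ⟨δ, hδ⟩ : ∃ δ, δ = min (min (R / 32) (R ^ 2 / (256 * M))) (ε / 3) := ⟨_, rfl⟩
  have hδ0 : 0 < δ := by rw [hδ]; positivity
  have hδ1 : δ ≤ R / 32 := by rw [hδ]; exact (min_le_left _ _).trans (min_le_left _ _)
  have hδ2 : 256 * M * δ ≤ R ^ 2 := by
    rw [← le_div_iff₀' (by positivity), hδ]; exact (min_le_left _ _).trans (min_le_right _ _)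
  have hδ3 : δ ≤ ε / 3 := by rw [hδ]; exact min_le_right _ _
  have hC := K.C_pos
  filter_upwards [hbd, hn.eventually_resc_near (half_pos hδ0), self_mem_nhdsWithin,
    K.eventually_normal_mem h.mem_frontier one_pos] with τ ⟨hball, hbd⟩ hnear hτ hmem
  have hτ0 : 0 < τ := hτ
  have hfl := K.resc_retractFlow h.toRetractFlow hτ0
  obtain ⟨x, hx⟩ : ∃ x, x = K.resc τ (f 0) (-K.ν) := ⟨_, rfl⟩
  have hν : -K.ν ∈ K.rescDomain τ := by
    show p + K.dil τ (-K.ν) ∈ Ω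
    rw [one_mul] at hmem
    rw [dil_neg_ν]
    exact hmem (mem_ball_self (by positivity))
  have hx0 : ‖x - -((b : ℂ) • K.ν)‖ ≤ δ / 2 := by rw [hx]; exact hnear 0
  obtain ⟨q, hq, hfix⟩ := hfl.exists_fixedPoint hR hδ0 hball hbd (x := x)
    (by rw [mem_ball, dist_eq_norm]; linarith) (by linarith) hδ2 fun m => by
      have h1 : K.resc τ (f m) x = K.resc τ (f m) (-K.ν) := by
        have := hfl.add m 0 _ hν
        rw [hx]
        simpa using this
      rw [h1, ← sub_sub_sub_cancel_right _ _ (-((b : ℂ) • K.ν))]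
      refine (norm_sub_le _ _).trans ?_
      linarith [hnear m]
  refine ⟨q, ?_, hfix⟩
  rw [mem_ball, dist_eq_norm, ← sub_add_sub_cancel q x]
  refine (norm_add_le _ _).trans_lt ?_
  linarith

end LocalPeak

namespace LocalPeak

variable {E : Type*} [NormedAddCommGroup E] [NormedSpace ℂ E] {Ω : Set E} {p : E}
  (K : LocalPeak Ω p) {G f : ℕ → E → E} {ms : ℕ → ℕ} {d b : ℝ}

theorem dil_normal (τ b : ℝ) :
    p + K.dil τ (-((b : ℂ) • K.ν)) = p - ((b * τ ^ 2 : ℝ) : ℂ) • K.ν := by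
  rw [map_neg, dil_smul_ν]
  push_cast
  module

theorem eventually_mul_sq_lt (a : ℝ) {e : ℝ} (he : 0 < e) : ∀ᶠ τ : ℝ in 𝓝[>] 0, a * τ ^ 2 < e := by
  have h1 : ContinuousAt (fun τ : ℝ => a * τ ^ 2) 0 := by fun_prop
  have h2 : Tendsto (fun τ : ℝ => a * τ ^ 2) (𝓝[>] 0) (𝓝 0) := by
    simpa using h1.tendsto.mono_left nhdsWithin_le_nhds
  exact h2.eventually_lt_const he

/-- The rescaled time-one maps are uniformly bounded on a fixed ball. -/
theorem exists_map_bound (h : TangentFlow Ω p G f ms) (hsd : K.s ≤ d)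
    (hd : ∀ z ∈ Ω, ∀ w ∈ Ω, ‖z - w‖ ≤ d) (hb : 0 < b) (l : ℕ) :
    ∃ R > 0, ∃ M > 0, ∀ᶠ τ : ℝ in 𝓝[>] 0, ball (-((b : ℂ) • K.ν)) R ⊆ K.rescDomain τ ∧
      ∀ x ∈ ball (-((b : ℂ) • K.ν)) R, ‖K.resc τ (G l) x‖ ≤ M := by
  have hC := K.C_pos
  obtain ⟨R, hR, hball⟩ := K.exists_ball_dil_subset h.mem_frontier hb
  obtain ⟨M, hM, hbd⟩ := K.exists_resc_bound h.mem_frontier hsd hd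
    (show 0 < K.C * (2 * b * K.C) + K.C * (2 * b * K.C) ^ 2 by positivity)
  obtain ⟨δ, hδ, hG⟩ := h.G_tangent l 1 one_pos
  refine ⟨R / 4, by positivity, M, hM, ?_⟩
  filter_upwards [hball, hbd, Ioo_mem_nhdsGT one_pos, eventually_mul_sq_lt (b * K.C) hδ,
    eventually_mul_sq_lt (2 * b * K.C) K.s_pos] with τ hball hbd ⟨hτ, hτ1⟩ h1 h2
  refine ⟨(ball_subset_ball (by linarith)).trans hball,
    hbd (G l) (h.G_diff l) (h.G_maps l) _ R hR hball ?_ ?_⟩ <;>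
  have hz : p + K.dil τ (-((b : ℂ) • K.ν)) ∈ Ω := hball (mem_ball_self hR) <;>
  rw [dil_normal] at hz ⊢ <;>
  obtain ⟨z, hzd⟩ : ∃ z, z = p - ((b * τ ^ 2 : ℝ) : ℂ) • K.ν := ⟨_, rfl⟩ <;>
  rw [← hzd] at hz ⊢ <;>
  have hzn : ‖z - p‖ ≤ b * K.C * τ ^ 2 := by
    rw [hzd, sub_sub_cancel_left, norm_neg, norm_smul, Complex.norm_of_nonneg (by positivity)]
    calc _ ≤ b * τ ^ 2 * K.C := by gcongr; exact K.norm_ν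
      _ = _ := by ring
  all_goals
    have h3 := hG z hz (hzn.trans_lt h1)
    have h4 : ‖G l z - p‖ ≤ 2 * b * K.C * τ ^ 2 := by
      rw [← sub_add_sub_cancel _ z]
      refine (norm_add_le _ _).trans ?_
      linarith
  · exact h4.trans_lt h2
  · refine (K.norm_P_le _).trans ?_
    have h5 : τ ^ 2 ≤ 1 := pow_le_one₀ hτ.le hτ1.le
    calc _ ≤ K.C * (2 * b * K.C * τ ^ 2) + K.C * (2 * b * K.C * τ ^ 2) ^ 2 := by gcongr
      _ = K.C * (2 * b * K.C) * τ ^ 2 + K.C * (2 * b * K.C) ^ 2 * τ ^ 2 * τ ^ 2 := by ring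
      _ ≤ K.C * (2 * b * K.C) * τ ^ 2 + K.C * (2 * b * K.C) ^ 2 * τ ^ 2 * 1 := by gcongr
      _ = _ := by ring

/-- The derivative of a map tangent to the identity tends to the identity along the normal. -/
theorem eventually_norm_fderiv_sub_id_le (h : TangentFlow Ω p G f ms) (hb : 0 < b) (l : ℕ)
    {ε : ℝ} (hε : 0 < ε) :
    ∀ᶠ τ : ℝ in 𝓝[>] 0,
      ‖fderiv ℂ (G l) (p - ((b * τ ^ 2 : ℝ) : ℂ) • K.ν) - ContinuousLinearMap.id ℂ E‖ ≤ ε := by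
  have hC := K.C_pos
  have hC1 := K.one_le_C
  obtain ⟨δ, hδ, hG⟩ := h.G_tangent l (ε / (4 * K.C * (K.C + 1))) (by positivity)
  filter_upwards [self_mem_nhdsWithin, K.eventually_normal_mem h.mem_frontier hb,
    eventually_mul_sq_lt (b * (K.C + 1)) hδ] with τ hτ hball h1
  have hτ0 : 0 < τ := hτ
  obtain ⟨c, hc⟩ : ∃ c, c = p - ((b * τ ^ 2 : ℝ) : ℂ) • K.ν := ⟨_, rfl⟩
  rw [← hc] at hball ⊢
  have hρ : 0 < b * τ ^ 2 / (2 * K.C) := by positivity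
  have hcn : ‖c - p‖ ≤ b * τ ^ 2 * K.C := by
    rw [hc, sub_sub_cancel_left, norm_neg, norm_smul, Complex.norm_of_nonneg (by positivity)]
    gcongr
    exact K.norm_ν
  have hdiff := (h.G_diff l).mono hball
  have h2 := norm_fderiv_le_of_bound (f := fun z => G l z - z) (x := c)
    (C := ε / (4 * K.C * (K.C + 1)) * (b * (K.C + 1) * τ ^ 2)) hρ
    (hdiff.sub differentiableOn_id) (fun z hz => ?_)
  · have h3 : fderiv ℂ (fun z => G l z - z) c =
        fderiv ℂ (G l) c - ContinuousLinearMap.id ℂ E := by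
      have h4 : DifferentiableAt ℂ (G l) c :=
        hdiff.differentiableAt (isOpen_ball.mem_nhds (mem_ball_self hρ))
      exact (h4.hasFDerivAt.sub (hasFDerivAt_id c)).fderiv
    rw [h3] at h2
    refine h2.trans (le_of_eq ?_)
    field_simp
    norm_num
  · have hzn : ‖z - p‖ ≤ b * (K.C + 1) * τ ^ 2 := by
      rw [← sub_add_sub_cancel _ c]
      refine (norm_add_le _ _).trans ?_
      have h4 : ‖z - c‖ ≤ b * τ ^ 2 / (2 * K.C) := by
        rw [mem_ball, dist_eq_norm] at hz; exact hz.le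
      have h5 : b * τ ^ 2 / (2 * K.C) ≤ b * τ ^ 2 :=
        div_le_self (by positivity) (by linarith)
      linarith
    refine (hG z (hball hz) (hzn.trans_lt h1)).trans ?_
    gcongr

/-- Conjugation of a small operator by the dilation is nilpotent up to a small error. -/
theorem norm_conj_sq_le {τ e M : ℝ} (hτ : 0 < τ) (hτ1 : τ ≤ 1) {X : E →L[ℂ] E} (hX : ‖X‖ ≤ e)
    (hM : ‖K.dil τ⁻¹ * X * K.dil τ‖ ≤ M) :
    ‖(K.dil τ⁻¹ * X * K.dil τ) * (K.dil τ⁻¹ * X * K.dil τ)‖ ≤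
      3 * (1 + K.C ^ 2) ^ 2 * e * (2 * M + 3 * (1 + K.C ^ 2) ^ 2 * e) := by
  have hC := K.C_pos
  have he : 0 ≤ e := (norm_nonneg _).trans hX
  obtain ⟨π, hπ⟩ : ∃ π : E →L[ℂ] E, π = (K.ℓ p).smulRight K.ν := ⟨_, rfl⟩
  obtain ⟨σ, hσ⟩ : ∃ σ : E →L[ℂ] E, σ = 1 - π := ⟨_, rfl⟩
  have hdil : ∀ t : ℝ, K.dil t = (t : ℂ) • σ + ((t : ℂ) ^ 2) • π := by
    intro t
    ext x
    rw [dil_apply', hσ, hπ]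
    simp [smul_smul]
  have hσπ : σ * π = 0 := by
    ext x
    simp [hσ, hπ, K.ℓ_ν]
  have hπn : ‖π‖ ≤ 1 + K.C ^ 2 := by
    refine π.opNorm_le_bound (by positivity) fun x => ?_
    rw [hπ, ContinuousLinearMap.smulRight_apply, norm_smul]
    calc _ ≤ K.C * ‖x‖ * K.C := by
          gcongr
          · exact K.norm_ℓ_le x
          · exact K.norm_ν
      _ ≤ _ := by nlinarith [norm_nonneg x]
  have hσn : ‖σ‖ ≤ 1 + K.C ^ 2 := by
    refine σ.opNorm_le_bound (by positivity) fun x => ?_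
    have : σ x = x - K.ℓ p x • K.ν := by simp [hσ, hπ]
    rw [this]
    exact K.norm_tangential_le x
  obtain ⟨N, hN⟩ : ∃ N, N = K.dil τ⁻¹ * X * K.dil τ := ⟨_, rfl⟩
  obtain ⟨S, hS⟩ : ∃ S, S = σ * X * σ + π * X * π + (τ : ℂ) • (σ * X * π) := ⟨_, rfl⟩
  have hNS : N = S + (τ : ℂ)⁻¹ • (π * X * σ) := by
    have hτc : (τ : ℂ) ≠ 0 := ofReal_ne_zero.2 hτ.ne'
    rw [hN, hS, hdil, hdil, ofReal_inv]
    simp only [mul_add, add_mul, smul_mul_assoc, mul_smul_comm, smul_smul, smul_add]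
    match_scalars <;> field_simp
  have hnil : (τ : ℂ)⁻¹ • (π * X * σ) * ((τ : ℂ)⁻¹ • (π * X * σ)) = 0 := by
    have : π * X * σ * (π * X * σ) = π * X * (σ * π) * (X * σ) := by noncomm_ring
    rw [smul_mul_smul_comm, this, hσπ]
    simp
  have hNN : N * N = S * N + (N - S) * S := by
    have h1 : (N - S) * (N - S) = 0 := by rw [hNS, add_sub_cancel_left, hnil]
    have h2 : N * N = S * N + (N - S) * S + (N - S) * (N - S) := by noncomm_ring
    rw [h2, h1, add_zero]
  have h3 : ∀ A B : E →L[ℂ] E, ‖A‖ ≤ 1 + K.C ^ 2 → ‖B‖ ≤ 1 + K.C ^ 2 →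
      ‖A * X * B‖ ≤ (1 + K.C ^ 2) ^ 2 * e := by
    intro A B hA hB
    calc _ ≤ ‖A‖ * ‖X‖ * ‖B‖ := (norm_mul_le _ _).trans (by gcongr; exact norm_mul_le _ _)
      _ ≤ (1 + K.C ^ 2) * e * (1 + K.C ^ 2) := by gcongr
      _ = _ := by ring
  have hSn : ‖S‖ ≤ 3 * (1 + K.C ^ 2) ^ 2 * e := by
    rw [hS]
    refine norm_add₃_le.trans ?_
    rw [norm_smul, Complex.norm_of_nonneg hτ.le]
    have := h3 σ σ hσn hσn
    have := h3 π π hπn hπn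
    have := h3 σ π hσn hπn
    have := mul_le_of_le_one_left (norm_nonneg (σ * X * π)) hτ1
    linarith
  rw [← hN] at hM ⊢
  have hM0 : 0 ≤ M := (norm_nonneg _).trans hM
  rw [hNN]
  calc _ ≤ ‖S‖ * ‖N‖ + (‖N‖ + ‖S‖) * ‖S‖ := by
        refine (norm_add_le _ _).trans (add_le_add (norm_mul_le _ _) ((norm_mul_le _ _).trans ?_))
        gcongr
        exact norm_sub_le _ _
    _ = ‖S‖ * (2 * ‖N‖ + ‖S‖) := by ring
    _ ≤ _ := by gcongr

/-- Eigenvalues of the rescaled time-`l` maps near the normal point tend to `1`. -/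
theorem exists_eigenvalue_near (h : TangentFlow Ω p G f ms) (hsd : K.s ≤ d)
    (hd : ∀ z ∈ Ω, ∀ w ∈ Ω, ‖z - w‖ ≤ d) (hb : 0 < b) (l : ℕ) {ε : ℝ} (hε : 0 < ε) :
    ∃ δ > 0, ∀ᶠ τ : ℝ in 𝓝[>] 0, ∀ x ∈ ball (-((b : ℂ) • K.ν)) δ, ∀ v ≠ 0, ∀ μ : ℂ,
      fderiv ℂ (K.resc τ (G l)) x v = μ • v → ‖μ - 1‖ ≤ ε := by
  have hC := K.C_pos
  obtain ⟨R, hR, M, hM, hbd⟩ := K.exists_map_bound h hsd hd hb l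
  obtain ⟨M', hM'⟩ : ∃ M', M' = 2 * M / R + 1 := ⟨_, rfl⟩
  have hM'0 : 0 < M' := by rw [hM']; positivity
  obtain ⟨Q, hQ⟩ : ∃ Q, Q = 3 * (1 + K.C ^ 2) ^ 2 := ⟨_, rfl⟩
  have hQ0 : 0 < Q := by rw [hQ]; positivity
  obtain ⟨e, he⟩ : ∃ e, e = min 1 (ε ^ 2 / (2 * (Q * (2 * M' + Q)))) := ⟨_, rfl⟩
  have he0 : 0 < e := by rw [he]; positivity
  have he1 : e ≤ 1 := by rw [he]; exact min_le_left _ _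
  have he2 : 2 * (Q * (2 * M' + Q)) * e ≤ ε ^ 2 := by
    rw [← le_div_iff₀' (by positivity), he]; exact min_le_right _ _
  obtain ⟨r, hr⟩ : ∃ r, r = min 1 (ε ^ 2 / (2 * (2 * M' + 1))) := ⟨_, rfl⟩
  have hr0 : 0 < r := by rw [hr]; positivity
  have hr1 : r ≤ 1 := by rw [hr]; exact min_le_left _ _
  have hr2 : 2 * (2 * M' + 1) * r ≤ ε ^ 2 := by
    rw [← le_div_iff₀' (by positivity), hr]; exact min_le_right _ _
  refine ⟨min (R / 4) (r / (32 * M / R ^ 2)), by positivity, ?_⟩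
  filter_upwards [hbd, K.eventually_norm_fderiv_sub_id_le h hb l he0, Ioo_mem_nhdsGT one_pos]
    with τ ⟨hball, hbd⟩ hX ⟨hτ, hτ1⟩ x hx v hv μ hev
  have hdiff := (K.resc_diff (τ := τ) (h.G_diff l)).mono hball
  have hxn : ‖x - -((b : ℂ) • K.ν)‖ < min (R / 4) (r / (32 * M / R ^ 2)) := by
    rwa [mem_ball, dist_eq_norm] at hx
  obtain ⟨D, hD⟩ : ∃ D, D = fderiv ℂ (K.resc τ (G l)) (-((b : ℂ) • K.ν)) := ⟨_, rfl⟩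
  have hΔ : ‖fderiv ℂ (K.resc τ (G l)) x - D‖ ≤ r := by
    rw [hD]
    refine (norm_fderiv_sub_le_of_bound hR hdiff hbd (mem_ball_self (by positivity))
      (ball_subset_ball (min_le_left _ _) hx)).trans ?_
    have := hxn.le.trans (min_le_right _ _)
    rwa [le_div_iff₀' (by positivity)] at this
  have hz : p + K.dil τ (-((b : ℂ) • K.ν)) ∈ Ω := hball (mem_ball_self hR)
  obtain ⟨N, hN⟩ : ∃ N, N = K.dil τ⁻¹ * (fderiv ℂ (G l) (p - ((b * τ ^ 2 : ℝ) : ℂ) • K.ν) -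
    ContinuousLinearMap.id ℂ E) * K.dil τ := ⟨_, rfl⟩
  have hND : N = D - 1 := by
    rw [hN, hD, K.resc_fderiv h.isOpen (h.G_diff l) hz, dil_normal]
    ext y
    simp [K.dil_inv_dil hτ]
  have hNn : ‖N‖ ≤ M' := by
    rw [hND, hM']
    refine (norm_sub_le _ _).trans (add_le_add ?_ ContinuousLinearMap.norm_id_le)
    rw [hD]
    exact norm_fderiv_le_of_bound hR hdiff hbd
  have hNN : ‖N * N‖ ≤ ε ^ 2 / 2 := by
    have h1 := K.norm_conj_sq_le hτ hτ1.le hX (M := M') (by rw [← hN]; exact hNn)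
    rw [← hN, ← hQ] at h1
    refine h1.trans ?_
    calc _ ≤ Q * e * (2 * M' + Q * 1) := by gcongr
      _ ≤ _ := by linarith
  obtain ⟨Δ, hΔd⟩ : ∃ Δ, Δ = fderiv ℂ (K.resc τ (G l)) x - D := ⟨_, rfl⟩
  rw [← hΔd] at hΔ
  have hsq : ‖(N + Δ) * (N + Δ)‖ ≤ ε ^ 2 := by
    have h2 : (N + Δ) * (N + Δ) = N * N + (N * Δ + Δ * N) + Δ * Δ := by noncomm_ring
    rw [h2]
    have h4 : ‖N * Δ‖ ≤ M' * r := (norm_mul_le _ _).trans (by gcongr)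
    have h5 : ‖Δ * N‖ ≤ r * M' := (norm_mul_le _ _).trans (by gcongr)
    have h6 : ‖Δ * Δ‖ ≤ r * 1 := (norm_mul_le _ _).trans (by gcongr; linarith)
    have h7 := norm_add₃_le (a := N * N) (b := N * Δ + Δ * N) (c := Δ * Δ)
    have h8 := norm_add_le (N * Δ) (Δ * N)
    linarith
  have hv1 : (N + Δ) v = (μ - 1) • v := by
    rw [hND, hΔd]
    simp only [add_apply, sub_apply, one_apply_eq_self, hev]
    module
  have hv2 : ((N + Δ) * (N + Δ)) v = (μ - 1) ^ 2 • v := by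
    rw [_root_.mul_apply_eq_comp, hv1, map_smul, hv1, smul_smul, sq]
  have h3 := ((N + Δ) * (N + Δ)).le_of_opNorm_le hsq v
  rw [hv2, norm_smul, norm_pow] at h3
  exact le_of_sq_le_sq (le_of_mul_le_mul_right h3 (norm_pos_iff.2 hv)) hε.le

end LocalPeak

namespace LocalPeak

variable {E : Type*} [NormedAddCommGroup E] [NormedSpace ℂ E] {Ω : Set E} {p : E}
  (K : LocalPeak Ω p) {G f : ℕ → E → E} {ms : ℕ → ℕ} {d b : ℝ}

theorem resc_eq_self_iff {τ : ℝ} (hτ : 0 < τ) {φ : E → E} {x : E} :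
    K.resc τ φ x = x ↔ φ (p + K.dil τ x) = p + K.dil τ x := by
  constructor
  · intro h
    rw [← K.dil_resc hτ φ, h]
  · intro h
    rw [resc, h, add_sub_cancel_left, K.dil_inv_dil hτ]

theorem dil_ne_zero {τ : ℝ} (hτ : 0 < τ) {v : E} (hv : v ≠ 0) : K.dil τ v ≠ 0 := fun h =>
  hv (by rw [← K.dil_inv_dil hτ v, h, map_zero])

theorem exists_eigenvector_resc_iff (hΩ : IsOpen Ω) {τ : ℝ} (hτ : 0 < τ) {φ : E → E}
    (hφ : DifferentiableOn ℂ φ Ω) {x : E} (hx : p + K.dil τ x ∈ Ω) {μ : ℂ} :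
    (∃ v, v ≠ 0 ∧ fderiv ℂ (K.resc τ φ) x v = μ • v) ↔
      ∃ v, v ≠ 0 ∧ fderiv ℂ φ (p + K.dil τ x) v = μ • v := by
  rw [K.resc_fderiv hΩ hφ hx]
  simp only [ContinuousLinearMap.comp_apply]
  constructor
  · rintro ⟨v, hv, h⟩
    refine ⟨K.dil τ v, K.dil_ne_zero hτ hv, ?_⟩
    rw [← map_smul, ← h, K.dil_dil_inv hτ]
  · rintro ⟨v, hv, h⟩
    refine ⟨K.dil τ⁻¹ v, K.dil_ne_zero (inv_pos.2 hτ) hv, ?_⟩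
    rw [K.dil_dil_inv hτ, h, map_smul]

/-- Nearby fixed points of a bounded flow have the same nonzero eigenvalues. -/
theorem exists_eigenvector_of_fixed_near [FiniteDimensional ℂ E] (h : RetractFlow Ω f ms)
    {x₀ x y : E} {R M ε : ℝ} (hR : 0 < R) (hball : ball x₀ R ⊆ Ω)
    (hM : ∀ m, ∀ z ∈ ball x₀ R, ‖f m z‖ ≤ M) (hεR : ε ≤ R / 4)
    (hεM : 32 * M / R ^ 2 * (2 * ε) ≤ 1 / 2) (hx : x ∈ ball x₀ ε) (hy : y ∈ ball x₀ ε)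
    (hfx : ∀ m, f m x = x) (hfy : ∀ m, f m y = y) {μ : ℂ} (hμ : μ ≠ 0)
    (hev : ∃ v, v ≠ 0 ∧ fderiv ℂ (f 1) x v = μ • v) :
    ∃ v, v ≠ 0 ∧ fderiv ℂ (f 1) y v = μ • v := by
  obtain ⟨v, hv, hev⟩ := hev
  have hsub : ball x₀ ε ⊆ ball x₀ (R / 4) := ball_subset_ball hεR
  have hsub' : ball x₀ (R / 4) ⊆ Ω := (ball_subset_ball (by linarith)).trans hball
  have hM0 : 0 ≤ M := (norm_nonneg _).trans (hM 0 x₀ (mem_ball_self hR))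
  obtain ⟨h1, hm⟩ := h.norm_eigenvalue_eq_one (hsub' (hsub hx)) hfx hv hμ hev
  refine exists_eigenvector_of_near (D := fun m => fderiv ℂ (f m) x)
    (D' := fun m => fderiv ℂ (f m) y) (h.fderiv_comp_fderiv (hsub' (hsub hy)) hfy) (fun m => ?_)
    h1 hv hm
  refine (norm_fderiv_sub_le_of_bound hR ((h.diff m).mono hball) (hM m) (hsub hx)
    (hsub hy)).trans (le_trans ?_ hεM)
  gcongr
  rw [mem_ball, dist_eq_norm] at hx hy
  calc ‖y - x‖ = ‖(y - x₀) - (x - x₀)‖ := by congr 1; abel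
    _ ≤ _ := norm_sub_le _ _
    _ ≤ _ := by linarith

theorem dil_mem_ball {θ ε ε' : ℝ} (hθ : 0 < θ) (hθ1 : θ ≤ 1) (hb : 0 < b)
    (hε : (1 + 2 * K.C ^ 2) * ε' + b * K.C * (1 - θ ^ 2) ≤ ε) {x : E}
    (hx : x ∈ ball (-((b : ℂ) • K.ν)) ε') : K.dil θ x ∈ ball (-((b : ℂ) • K.ν)) ε := by
  have hC := K.C_pos
  rw [mem_ball, dist_eq_norm] at hx ⊢
  obtain ⟨u, hu⟩ : ∃ u, u = x - -((b : ℂ) • K.ν) := ⟨_, rfl⟩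
  rw [← hu] at hx
  have hθ2 : θ ^ 2 ≤ 1 := pow_le_one₀ hθ.le hθ1
  have h1 : K.dil θ x - -((b : ℂ) • K.ν) =
      K.dil θ u + ((b * (1 - θ ^ 2) : ℝ) : ℂ) • K.ν := by
    have : x = u - (b : ℂ) • K.ν := by rw [hu]; abel
    rw [this, map_sub, dil_smul_ν]
    push_cast
    module
  have h2 : ‖K.dil θ u‖ ≤ (1 + 2 * K.C ^ 2) * ‖u‖ := by
    refine (K.norm_dil_le hθ u).trans ?_
    calc _ ≤ 1 * ((1 + K.C ^ 2) * ‖u‖) + 1 * (K.C * ‖u‖) * K.C := by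
          gcongr
          · exact K.norm_tangential_le u
          · exact K.norm_ℓ_le u
      _ = _ := by ring
  rw [h1]
  calc _ ≤ ‖K.dil θ u‖ + b * (1 - θ ^ 2) * K.C := by
        refine (norm_add_le _ _).trans ?_
        have : 0 ≤ b * (1 - θ ^ 2) := mul_nonneg hb.le (by linarith)
        rw [norm_smul, Complex.norm_of_nonneg this]
        gcongr
        exact K.norm_ν
    _ < (1 + 2 * K.C ^ 2) * ε' + b * K.C * (1 - θ ^ 2) := by
        have := mul_lt_mul_of_pos_left hx (show 0 < 1 + 2 * K.C ^ 2 by positivity)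
        linarith
    _ ≤ _ := hε

/-- At a fixed point of the flow, an eigenvector of `f 1` is one of `G 1`. -/
theorem fderiv_G_one_apply (h : TangentFlow Ω p G f ms) {q : E} (hq : q ∈ Ω)
    (hfix : ∀ m, f m q = q) {v : E} (hv : v ≠ 0) {μ : ℂ} (hμ : μ ≠ 0)
    (hev : fderiv ℂ (f 1) q v = μ • v) : fderiv ℂ (G 1) q v = μ • v := by
  have hn := h.isOpen.mem_nhds hq
  have h0 : fderiv ℂ (f 0) q v = v := by
    simpa using (h.toRetractFlow.norm_eigenvalue_eq_one hq hfix hv hμ hev).2 0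
  have h1 : fderiv ℂ (f 1) q = fderiv ℂ (G 1 ∘ f 0) q := by
    refine Filter.EventuallyEq.fderiv_eq ?_
    filter_upwards [hn] with z hz
    exact (h.G_f 1 0 z hz).symm
  rw [fderiv_comp q (by rw [hfix]; exact (h.G_diff 1).differentiableAt hn)
    ((h.diff 0).differentiableAt hn), hfix] at h1
  rw [← hev, h1, ContinuousLinearMap.comp_apply, h0]

/-- There is a fixed point of the flow at which `f 1` has no nonzero eigenvalue other than `1`. -/
theorem exists_unipotent_fixedPoint [FiniteDimensional ℂ E] (h : TangentFlow Ω p G f ms)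
    (hsd : K.s ≤ d) (hd : ∀ z ∈ Ω, ∀ w ∈ Ω, ‖z - w‖ ≤ d) :
    ∃ q ∈ Ω, (∀ m, f m q = q) ∧
      ∀ v, v ≠ 0 → ∀ μ : ℂ, μ ≠ 0 → fderiv ℂ (f 1) q v = μ • v → μ = 1 := by
  have hC := K.C_pos
  obtain ⟨b, hb, hn⟩ := K.exists_normalAsymptotics h hsd hd
  obtain ⟨R, hR, M, hM, hbd⟩ := hn.exists_flow_bound hb h hsd hd
  obtain ⟨ε₁, hε₁⟩ : ∃ ε₁, ε₁ = min (R / 4) (1 / 4 / (32 * M / R ^ 2)) := ⟨_, rfl⟩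
  have hε₁0 : 0 < ε₁ := by rw [hε₁]; positivity
  have hεR : ε₁ ≤ R / 4 := by rw [hε₁]; exact min_le_left _ _
  have hεM : 32 * M / R ^ 2 * (2 * ε₁) ≤ 1 / 2 := by
    have : 32 * M / R ^ 2 * ε₁ ≤ 1 / 4 := by
      rw [← le_div_iff₀' (by positivity), hε₁]; exact min_le_right _ _
    linarith
  obtain ⟨t, ht⟩ : ∃ t, t = min (1 / 2) (ε₁ / (4 * (b * K.C))) := ⟨_, rfl⟩
  have ht0 : 0 < t := by rw [ht]; positivity
  have ht1 : t ≤ 1 / 2 := by rw [ht]; exact min_le_left _ _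
  have ht2 : 4 * (b * K.C) * t ≤ ε₁ := by
    rw [← le_div_iff₀' (by positivity), ht]; exact min_le_right _ _
  obtain ⟨θ, hθ⟩ : ∃ θ, θ = 1 - t := ⟨_, rfl⟩
  have hθ0 : 0 < θ := by linarith
  have hθ1 : θ < 1 := by linarith
  obtain ⟨ε₂, hε₂⟩ : ∃ ε₂, ε₂ = ε₁ / (2 * (1 + 2 * K.C ^ 2)) := ⟨_, rfl⟩
  have hε₂0 : 0 < ε₂ := by rw [hε₂]; positivity
  have hε₂₁ : ε₂ ≤ ε₁ := by
    rw [hε₂]; exact div_le_self hε₁0.le (by nlinarith)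
  have hdil : (1 + 2 * K.C ^ 2) * ε₂ + b * K.C * (1 - θ ^ 2) ≤ ε₁ := by
    have h1 : (1 + 2 * K.C ^ 2) * ε₂ = ε₁ / 2 := by rw [hε₂]; field_simp
    have h2 : b * K.C * (1 - θ ^ 2) ≤ b * K.C * (2 * t) := by
      gcongr
      rw [hθ]
      nlinarith
    linarith
  obtain ⟨τ₀, hτ₀, hsmall⟩ := mem_nhdsGT_iff_exists_Ioo_subset.1
    (hbd.and (hn.eventually_exists_fixedPoint h hR hM hbd hε₂0))
  rw [mem_Ioi] at hτ₀
  have hsmall : ∀ τ, 0 < τ → τ < τ₀ → _ := fun τ h1 h2 => hsmall ⟨h1, h2⟩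
  have htrans : ∀ τ, 0 < τ → τ < τ₀ → ∀ x ∈ ball (-((b : ℂ) • K.ν)) ε₁,
      ∀ y ∈ ball (-((b : ℂ) • K.ν)) ε₁, (∀ m, K.resc τ (f m) x = x) →
      (∀ m, K.resc τ (f m) y = y) → ∀ μ : ℂ, μ ≠ 0 →
      (∃ v, v ≠ 0 ∧ fderiv ℂ (f 1) (p + K.dil τ x) v = μ • v) →
      ∃ v, v ≠ 0 ∧ fderiv ℂ (f 1) (p + K.dil τ y) v = μ • v := by
    intro τ hτ hτ' x hx y hy hfx hfy μ hμ hev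
    obtain ⟨⟨hball, hbd⟩, -⟩ := hsmall τ hτ hτ'
    have hsub : ball (-((b : ℂ) • K.ν)) ε₁ ⊆ K.rescDomain τ :=
      (ball_subset_ball (by linarith)).trans hball
    rw [← K.exists_eigenvector_resc_iff h.isOpen hτ (h.diff 1) (hsub hx)] at hev
    rw [← K.exists_eigenvector_resc_iff h.isOpen hτ (h.diff 1) (hsub hy)]
    exact exists_eigenvector_of_fixed_near (K.resc_retractFlow h.toRetractFlow hτ) hR hball hbd
      hεR hεM hx hy hfx hfy hμ hev
  have hτ1 : 0 < τ₀ / 2 := by positivity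
  have hτk : ∀ k : ℕ, 0 < τ₀ / 2 * θ ^ k ∧ τ₀ / 2 * θ ^ k < τ₀ := fun k =>
    ⟨by positivity, by
      have : τ₀ / 2 * θ ^ k ≤ τ₀ / 2 * 1 := by gcongr; exact pow_le_one₀ hθ0.le hθ1.le
      linarith⟩
  choose q hq hfix using fun k => (hsmall _ (hτk k).1 (hτk k).2).2
  have hmem : ∀ k, p + K.dil (τ₀ / 2 * θ ^ k) (q k) ∈ Ω := fun k =>
    (hsmall _ (hτk k).1 (hτk k).2).1.1 (ball_subset_ball (by linarith) (hq k))
  have hchain : ∀ k, ∀ μ : ℂ, μ ≠ 0 →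
      (∃ v, v ≠ 0 ∧ fderiv ℂ (f 1) (p + K.dil (τ₀ / 2 * θ ^ 0) (q 0)) v = μ • v) →
      ∃ v, v ≠ 0 ∧ fderiv ℂ (f 1) (p + K.dil (τ₀ / 2 * θ ^ k) (q k)) v = μ • v := by
    intro k μ hμ h0
    induction k with
    | zero => exact h0
    | succ k ih =>
      have hd1 : p + K.dil (τ₀ / 2 * θ ^ (k + 1)) (q (k + 1)) =
          p + K.dil (τ₀ / 2 * θ ^ k) (K.dil θ (q (k + 1))) := by
        rw [dil_dil, pow_succ, mul_assoc]
      rw [hd1]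
      refine htrans _ (hτk k).1 (hτk k).2 _ (ball_subset_ball hε₂₁ (hq k)) _
        (K.dil_mem_ball hθ0 hθ1.le hb hdil (hq (k + 1))) (hfix k) (fun m => ?_) μ hμ ih
      rw [K.resc_eq_self_iff (hτk k).1, ← hd1, ← K.resc_eq_self_iff (hτk (k + 1)).1]
      exact hfix (k + 1) m
  refine ⟨_, hmem 0, fun m => (K.resc_eq_self_iff (hτk 0).1).1 (hfix 0 m),
    fun v hv μ hμ hev => ?_⟩
  refine sub_eq_zero.1 (norm_le_zero_iff.1 (le_of_forall_pos_le_add fun ε hε => ?_))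
  rw [zero_add]
  obtain ⟨δ, hδ, hnear⟩ := K.exists_eigenvalue_near h hsd hd hb 1 hε
  have hlim : Tendsto (fun k : ℕ => τ₀ / 2 * θ ^ k) atTop (𝓝[>] 0) := by
    refine tendsto_nhdsWithin_iff.2 ⟨?_, Eventually.of_forall fun k => (hτk k).1⟩
    simpa using (tendsto_pow_atTop_nhds_zero_of_lt_one hθ0.le hθ1).const_mul (τ₀ / 2)
  obtain ⟨k, hnear, y, hy, hfy⟩ := (hlim.eventually (hnear.and
    (hn.eventually_exists_fixedPoint h hR hM hbd (lt_min hδ hε₂0)))).exists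
  have hyε : y ∈ ball (-((b : ℂ) • K.ν)) ε₁ :=
    ball_subset_ball ((min_le_right _ _).trans hε₂₁) hy
  have hyΩ : p + K.dil (τ₀ / 2 * θ ^ k) y ∈ Ω :=
    (hsmall _ (hτk k).1 (hτk k).2).1.1 (ball_subset_ball (by linarith) hyε)
  obtain ⟨u, hu, heu⟩ := htrans _ (hτk k).1 (hτk k).2 _ (ball_subset_ball hε₂₁ (hq k)) y hyε
    (hfix k) hfy μ hμ (hchain k μ hμ ⟨v, hv, hev⟩)
  have hG := fderiv_G_one_apply h hyΩ (fun m => (K.resc_eq_self_iff (hτk k).1).1 (hfy m)) hu hμ heu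
  obtain ⟨w, hw, hew⟩ := (K.exists_eigenvector_resc_iff h.isOpen (hτk k).1 (h.G_diff 1) hyΩ).2
    ⟨u, hu, hG⟩
  exact hnear y (ball_subset_ball (min_le_left _ _) hy) w hw μ hew

/-- A flow tangent to the identity at a strongly pseudoconvex point is trivial on its retract. -/
theorem flow_one_eq_zero [FiniteDimensional ℂ E] (K : LocalPeak Ω p)
    (h : TangentFlow Ω p G f ms)
    (hc : IsPreconnected Ω) : ∀ z ∈ Ω, f 1 z = f 0 z := by
  have hcomp : CompleteSpace E := FiniteDimensional.complete ℂ E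
  obtain ⟨d, hd⟩ := isBounded_iff.1 h.bdd
  obtain ⟨q, hq, hfix, hev⟩ := K.exists_unipotent_fixedPoint h (le_max_left K.s d)
    fun z hz w hw => by
      rw [← dist_eq_norm]; exact (hd hz hw).trans (le_max_right _ _)
  exact eqOn_of_eventuallyEq_of_differentiableOn h.isOpen hc (h.diff 1) (h.diff 0) hq
    (h.toRetractFlow.eventually_eq hq hfix (h.toRetractFlow.fderiv_one_eq hq hfix hev))

end LocalPeak

section Iterates

variable {E : Type*} [NormedAddCommGroup E] {Ω : Set E} {F : E → E} {p : E}

/-- Iterates of a map tangent to the identity at `p` are tangent to the identity at `p`. -/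
theorem iterate_tangent (hF : MapsTo F Ω Ω)
    (ht : ∀ ε > 0, ∃ δ > 0, ∀ z ∈ Ω, ‖z - p‖ < δ → ‖F z - z‖ ≤ ε * ‖z - p‖) (l : ℕ) :
    ∀ ε > 0, ∃ δ > 0, ∀ z ∈ Ω, ‖z - p‖ < δ → ‖F^[l] z - z‖ ≤ ε * ‖z - p‖ := by
  induction l with
  | zero => exact fun ε hε => ⟨1, one_pos, fun z _ _ => by simp; positivity⟩
  | succ l ih =>
    intro ε hε
    obtain ⟨e, he⟩ : ∃ e, e = min 1 (ε / 3) := ⟨_, rfl⟩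
    have he0 : 0 < e := by rw [he]; positivity
    have he1 : e ≤ 1 := by rw [he]; exact min_le_left _ _
    have he2 : e ≤ ε / 3 := by rw [he]; exact min_le_right _ _
    obtain ⟨δ₁, hδ₁, h1⟩ := ht e he0
    obtain ⟨δ₂, hδ₂, h2⟩ := ih e he0
    refine ⟨min δ₁ (δ₂ / 2), by positivity, fun z hz hzδ => ?_⟩
    have h3 := h1 z hz (hzδ.trans_le (min_le_left _ _))
    have h4 : ‖F z - p‖ ≤ 2 * ‖z - p‖ := by
      calc ‖F z - p‖ = ‖(F z - z) + (z - p)‖ := by congr 1; abel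
        _ ≤ ‖F z - z‖ + ‖z - p‖ := norm_add_le _ _
        _ ≤ _ := by nlinarith [norm_nonneg (z - p)]
    have h5 := h2 (F z) (hF hz) (by linarith [hzδ.trans_le (min_le_right _ _)])
    rw [iterate_succ_apply]
    calc ‖F^[l] (F z) - z‖ = ‖(F^[l] (F z) - F z) + (F z - z)‖ := by congr 1; abel
      _ ≤ e * ‖F z - p‖ + e * ‖z - p‖ := (norm_add_le _ _).trans (add_le_add h5 h3)
      _ ≤ e * (2 * ‖z - p‖) + e * ‖z - p‖ := by gcongr
      _ = 3 * e * ‖z - p‖ := by ring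
      _ ≤ _ := by gcongr; linarith

end Iterates

theorem LittleOh.exists_bound {n : ℕ} {Ω : Set (En n)} {F : En n → En n} {p : En n}
    (hp : p ∉ Ω) (ho : LittleOh Ω F p 1) :
    ∀ ε > 0, ∃ δ > 0, ∀ z ∈ Ω, ‖z - p‖ < δ → ‖F z - z‖ ≤ ε * ‖z - p‖ := by
  intro ε hε
  obtain ⟨δ, hδ, h⟩ := Metric.mem_nhdsWithin_iff.1 (ho.eventually_lt_const hε)
  refine ⟨δ, hδ, fun z hz hzδ => ?_⟩
  have h1 : ‖F z - z‖ / ‖z - p‖ ^ 1 < ε := h ⟨by rwa [mem_ball, dist_eq_norm], hz⟩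
  have h2 : 0 < ‖z - p‖ := norm_pos_iff.2 (sub_ne_zero.2 fun e => hp (e ▸ hz))
  rw [pow_one, div_lt_iff₀ h2] at h1
  exact h1.le

/-- A retraction which is a limit of iterates of `F` generates a flow tangent to the identity. -/
theorem tangentFlow_iterate {E : Type*} [NormedAddCommGroup E] [NormedSpace ℂ E] {Ω : Set E}
    {F r : E → E} {p : E} {ms : ℕ → ℕ} (hΩ : IsOpen Ω) (hbd : Bornology.IsBounded Ω)
    (hF : DifferentiableOn ℂ F Ω) (hFself : MapsTo F Ω Ω) (hr : DifferentiableOn ℂ r Ω)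
    (hrself : MapsTo r Ω Ω) (hretr : ∀ z ∈ Ω, r (r z) = r z) (hms : StrictMono ms)
    (hlim : ∀ z ∈ Ω, Tendsto (fun j => F^[ms j] z) atTop (𝓝 (r z)))
    (ht : ∀ ε > 0, ∃ δ > 0, ∀ z ∈ Ω, ‖z - p‖ < δ → ‖F z - z‖ ≤ ε * ‖z - p‖)
    (hp : p ∈ frontier Ω) (hpM : p ∈ closure (r '' Ω)) :
    TangentFlow Ω p (fun m => F^[m]) (fun m => F^[m] ∘ r) ms := by
  have hmaps : ∀ m, MapsTo F^[m] Ω Ω := fun m => hFself.iterate m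
  have hdiff : ∀ m, DifferentiableOn ℂ F^[m] Ω := by
    intro m
    induction m with
    | zero => exact differentiableOn_id
    | succ m ih => exact ih.comp hF hFself
  have hcomm : ∀ m, ∀ z ∈ Ω, r (F^[m] z) = F^[m] (r z) := by
    intro m z hz
    refine tendsto_nhds_unique (hlim _ (hmaps m hz)) ?_
    have h1 := ((hdiff m).continuousOn.continuousAt
      (hΩ.mem_nhds (hrself hz))).tendsto.comp (hlim z hz)
    refine h1.congr fun j => ?_
    simp only [comp_apply, ← iterate_add_apply, add_comm]
  refine ⟨⟨hΩ, hbd, fun m => (hdiff m).comp hr hrself, fun m => (hmaps m).comp hrself,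
    fun l m z hz => ?_, hms.tendsto_atTop, fun z hz => ?_⟩, hdiff, hmaps, fun l m z hz => ?_,
    fun l m z hz => ?_, iterate_tangent hFself ht, ?_, hp⟩
  · simp only [comp_apply]
    rw [hcomm m _ (hrself hz), hretr z hz, iterate_add_apply]
  · simpa [hretr z hz] using hlim _ (hrself hz)
  · simp only [comp_apply]
    rw [add_comm, iterate_add_apply]
  · simp only [comp_apply]
    rw [hcomm l z hz, iterate_add_apply]
  · refine closure_mono ?_ hpM
    rintro _ ⟨z, hz, rfl⟩
    exact ⟨hrself hz, hretr z hz⟩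

theorem fixed_on_retract
    {n : ℕ} (hn : 2 ≤ n) (Ω : Set (En n)) (ρ : En n → ℝ)
    (hΩ : IsDomain' Ω) (hbd : Bornology.IsBounded Ω)
    (hρ : IsPcxCinfBoundary Ω ρ)
    (p : En n) (hp : p ∈ frontier Ω) (hspc : StronglyPcxAt ρ p)
    (F : En n → En n) (hF : DifferentiableOn ℂ F Ω) (hFself : MapsTo F Ω Ω)
    (ho : LittleOh Ω F p 1)
    (r : En n → En n) (hr : DifferentiableOn ℂ r Ω) (hrself : MapsTo r Ω Ω)
    (hretr : ∀ z ∈ Ω, r (r z) = r z)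
    (hlim : ∃ ms : ℕ → ℕ, StrictMono ms ∧ ∀ K ⊆ Ω, IsCompact K →
      TendstoUniformlyOn (fun j => F^[ms j]) r atTop K)
    (hnc : ¬ ∃ c : En n, ∀ z ∈ Ω, r z = c)
    (hnid : ¬ ∀ z ∈ Ω, r z = z)
    (hpM : p ∈ closure (r '' Ω)) :
    ∀ w ∈ r '' Ω, F w = w := by
  obtain ⟨ms, hms, hconv⟩ := hlim
  obtain ⟨K⟩ := exists_localPeak hρ.1 hp hspc
  have hpΩ : p ∉ Ω := fun h => (hΩ.1.inter_frontier_eq.subset ⟨h, hp⟩).elim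
  have h := tangentFlow_iterate hΩ.1 hbd hF hFself hr hrself hretr hms
    (fun z hz => (hconv {z} (singleton_subset_iff.2 hz) isCompact_singleton).tendsto_at
      (mem_singleton z)) (ho.exists_bound hpΩ) hp hpM
  rintro _ ⟨z, hz, rfl⟩
  exact K.flow_one_eq_zero h hΩ.2.isPreconnected z hz
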